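/- arXiv:math/0610654 — 2 statements merged into one kernel-verified Lean document; each statement's English description precedes it below -/
import Mathlib

section
/- Suppose X_V satisfies conditions (M) and (P) and is a Gaussian process, i.e., for every finite collection (v₁,t₁),…,(v_n,t_n) with v_i∈V, t_i∈ℤ and all real coefficients c₁,…,c_n, the random variable c₁X_{v₁}(t₁)+⋯+c_nX_{v_n}(t_n) has a (possibly degenerate) Gaussian distribution on ℝ. Then, for every mixed graph G=(V,E), the three Granger-causal Markov properties (BC), (LC), and (PC) of X_V with respect to G are equivalent. -/
open MeasureTheory ProbabilityTheory Filter

noncomputable section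

namespace GraphicalTS

/-! ### Mixed graphs, paths and p-separation -/

/-- A mixed graph on vertex type `V`, with directed edges `dir a b` (i.e. `a → b`)
and (symmetric) undirected edges `undir a b` (i.e. `a — b`). -/
structure MixedGraph (V : Type*) where
  dir : V → V → Prop
  undir : V → V → Prop
  undir_symm : ∀ a b, undir a b → undir b a

namespace MixedGraph

variable {V : Type*}

/-- Parents of a set `A`: vertices `v ∉ A` with `v → a` for some `a ∈ A`. -/
def pa (G : MixedGraph V) (A : Set V) : Set V := {v | ∃ a ∈ A, G.dir v a} \ A

/-- Neighbours of a set `A`: vertices `v ∉ A` with `v — a` for some `a ∈ A`. -/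
def nb (G : MixedGraph V) (A : Set V) : Set V := {v | ∃ a ∈ A, G.undir v a} \ A

/-- Children of a set `A`: vertices `v ∉ A` with `a → v` for some `a ∈ A`. -/
def ch (G : MixedGraph V) (A : Set V) : Set V := {v | ∃ a ∈ A, G.dir a v} \ A

/-- `b` is an ancestor of `a`: `b = a` or there is a directed path `b → ⋯ → a`. -/
def ancestor (G : MixedGraph V) (b a : V) : Prop := Relation.ReflTransGen G.dir b a

/-- The set of ancestors of elements of `A`. -/
def anc (G : MixedGraph V) (A : Set V) : Set V := {b | ∃ a ∈ A, G.ancestor b a}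

end MixedGraph

/-- The orientation of an edge as traversed along a path: forward directed (tail at the
current vertex, arrowhead at the next), backward directed, or undirected. -/
inductive EdgeKind : Type
  | fwd | bwd | un

/-- A path between `a` and `b` in the mixed graph `G`: a sequence of `n` edges along
vertices `vert 0 = a, vert 1, …, vert n = b`; vertices and edges may repeat.
(`vert` and `kind` are total functions on `ℕ`; only the values `vert 0,…,vert n` and
`kind 0,…,kind (n-1)` are constrained.) -/
structure MGPath {V : Type*} (G : MixedGraph V) (a b : V) where
  n : ℕ
  vert : ℕ → V
  kind : ℕ → EdgeKind
  src : vert 0 = a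
  tgt : vert n = b
  valid : ∀ i, i < n →
    (kind i = EdgeKind.fwd → G.dir (vert i) (vert (i + 1))) ∧
    (kind i = EdgeKind.bwd → G.dir (vert (i + 1)) (vert i)) ∧
    (kind i = EdgeKind.un → G.undir (vert i) (vert (i + 1)))

namespace MGPath

variable {V : Type*} {G : MixedGraph V} {a b : V}

/-- The intermediate vertex at position `j` (for `0 < j < n`) is a p-collider: the two
adjacent edges form `→ c ←`, `→ c —` or `— c ←`. -/
def colliderAt (p : MGPath G a b) (j : ℕ) : Prop :=
  p.kind (j - 1) ≠ EdgeKind.bwd ∧ p.kind j ≠ EdgeKind.fwd ∧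
    ¬(p.kind (j - 1) = EdgeKind.un ∧ p.kind j = EdgeKind.un)

/-- The path is p-connecting given `S`: every intermediate p-noncollider is outside `S`
and every intermediate p-collider is in `S`. -/
def pConnecting (p : MGPath G a b) (S : Set V) : Prop :=
  ∀ j, 0 < j → j < p.n →
    (p.colliderAt j → p.vert j ∈ S) ∧ (¬p.colliderAt j → p.vert j ∉ S)

/-- The path has an arrowhead at its endpoint `b`. -/
def bPointing (p : MGPath G a b) : Prop :=
  0 < p.n ∧ p.kind (p.n - 1) = EdgeKind.fwd

/-- The path has arrowheads at both endpoints. -/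
def biPointing (p : MGPath G a b) : Prop :=
  0 < p.n ∧ p.kind 0 = EdgeKind.bwd ∧ p.kind (p.n - 1) = EdgeKind.fwd

/-- The path consists of undirected edges only. -/
def undirected (p : MGPath G a b) : Prop := ∀ i, i < p.n → p.kind i = EdgeKind.un

/-- The path is a composition of finitely many subpaths, each of which is undirected
or bi-pointing (cut points `c 0 = 0 < c 1 < ⋯ < c m = n`). -/
def extBiPointing (p : MGPath G a b) : Prop :=
  ∃ (m : ℕ) (c : ℕ → ℕ), c 0 = 0 ∧ c m = p.n ∧ (∀ k, k < m → c k < c (k + 1)) ∧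
    ∀ k, k < m →
      (∀ i, c k ≤ i → i < c (k + 1) → p.kind i = EdgeKind.un) ∨
      (p.kind (c k) = EdgeKind.bwd ∧ p.kind (c (k + 1) - 1) = EdgeKind.fwd)

/-- Every intermediate vertex on the path is a p-collider. -/
def pureCollider (p : MGPath G a b) : Prop := ∀ j, 0 < j → j < p.n → p.colliderAt j

/-- The path is a trail: all intermediate vertices are distinct. -/
def isTrail (p : MGPath G a b) : Prop :=
  ∀ i j, 0 < i → i < p.n → 0 < j → j < p.n → p.vert i = p.vert j → i = j

/-- The trail is p-active relative to `S` (Andersson–Madigan–Perlman): every p-collider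
lies in `an(S)`, and every p-noncollider `v` either lies outside `S`, or its two adjacent
edges are undirected and `pa(v) ∖ S ≠ ∅`. -/
def pActive (p : MGPath G a b) (S : Set V) : Prop :=
  ∀ j, 0 < j → j < p.n →
    (p.colliderAt j → p.vert j ∈ G.anc S) ∧
    (¬p.colliderAt j →
      p.vert j ∉ S ∨
        (p.kind (j - 1) = EdgeKind.un ∧ p.kind j = EdgeKind.un ∧
          ({v | G.dir v (p.vert j)} \ S).Nonempty))

end MGPath

/-- `A` and `B` are p-separated given `S`: every path between a vertex of `A` and a
vertex of `B` is p-blocked given `S`. -/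
def pSeparated {V : Type*} (G : MixedGraph V) (A B S : Set V) : Prop :=
  ∀ a ∈ A, ∀ b ∈ B, ∀ p : MGPath G a b, ¬p.pConnecting S

/-- `a` and `b` are joined in `G` by an undirected path none of whose intermediate
vertices lies in `an(W) ∖ {a, b}`. -/
def undirAvoiding {V : Type*} (G : MixedGraph V) (W : Set V) (a b : V) : Prop :=
  ∃ p : MGPath G a b, 0 < p.n ∧ p.undirected ∧
    ∀ j, 0 < j → j < p.n → p.vert j ∉ G.anc W \ {a, b}

/-- The marginal ancestral graph `G_[A]` (for an ancestral set `A`): the subgraph of `G`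
induced by `A`, together with an additional undirected edge `a — b` for each pair
`a, b ∈ A` joined in `G` by an undirected path avoiding `an(A) ∖ {a, b}`. -/
def marginalGraph {V : Type*} (G : MixedGraph V) (A : Set V) : MixedGraph V where
  dir u v := G.dir u v ∧ u ∈ A ∧ v ∈ A
  undir u v := (G.undir u v ∧ u ∈ A ∧ v ∈ A) ∨
    (u ∈ A ∧ v ∈ A ∧ (undirAvoiding G A u v ∨ undirAvoiding G A v u))
  undir_symm := by
    rintro x y (⟨h, hx, hy⟩ | ⟨hx, hy, h⟩)
    · exact Or.inl ⟨G.undir_symm _ _ h, hy, hx⟩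
    · exact Or.inr ⟨hy, hx, h.symm⟩

/-! ### σ-algebras, conditional independence, Granger causality -/

variable {Ω : Type*}

/-- The `μ`-completion of a sub-σ-algebra `m`: the σ-algebra generated by `m` together
with all `μ`-null sets. -/
def mComplete [MeasurableSpace Ω] (μ : Measure Ω) (m : MeasurableSpace Ω) :
    MeasurableSpace Ω :=
  m ⊔ MeasurableSpace.generateFrom {s : Set Ω | μ s = 0}

/-- `ℱ_A(t)`: the `μ`-completed σ-algebra generated by `{X_a(s) : a ∈ A, s ≤ t}`. -/
def pastSigma {V : Type*} [MeasurableSpace Ω] (μ : Measure Ω) (X : V → ℤ → Ω → ℝ)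
    (A : Set V) (t : ℤ) : MeasurableSpace Ω :=
  mComplete μ (⨆ a ∈ A, ⨆ s ≤ t, MeasurableSpace.comap (X a s) inferInstance)

/-- Conditional independence `m₁ ⟂ m₂ | m₃` of sub-σ-algebras:
`E[1_G | m₂ ∨ m₃] = E[1_G | m₃]` a.s. for every `G ∈ m₁`. -/
def CondIndepSigma [MeasurableSpace Ω] (μ : Measure Ω) (m₁ m₂ m₃ : MeasurableSpace Ω) :
    Prop :=
  ∀ s : Set Ω, MeasurableSet[m₁] s →
    μ[s.indicator fun _ => (1 : ℝ) | m₂ ⊔ m₃] =ᵐ[μ] μ[s.indicator fun _ => (1 : ℝ) | m₃]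

/-- `X_A` is (strongly) Granger-noncausal for `X_B` with respect to `ℱ_S`
(`X_A ⇸ X_B [ℱ_S]`): `ℱ_B(t+1) ⟂ ℱ_A(t) | ℱ_{S∖A}(t)` for all `t`. -/
def GrangerNoncausal {V : Type*} [MeasurableSpace Ω] (μ : Measure Ω)
    (X : V → ℤ → Ω → ℝ) (A B S : Set V) : Prop :=
  ∀ t : ℤ, CondIndepSigma μ (pastSigma μ X B (t + 1)) (pastSigma μ X A t)
    (pastSigma μ X (S \ A) t)

/-- `X_A` and `X_B` are contemporaneously conditionally independent with respect to
`ℱ_S` (`X_A ≁ X_B [ℱ_S]`): `ℱ_A(t+1) ⟂ ℱ_B(t+1) | ℱ_S(t) ∨ ℱ_{S∖(A∪B)}(t+1)`. -/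
def ContempIndep {V : Type*} [MeasurableSpace Ω] (μ : Measure Ω)
    (X : V → ℤ → Ω → ℝ) (A B S : Set V) : Prop :=
  ∀ t : ℤ, CondIndepSigma μ (pastSigma μ X A (t + 1)) (pastSigma μ X B (t + 1))
    (pastSigma μ X S t ⊔ pastSigma μ X (S \ (A ∪ B)) (t + 1))

/-! ### Granger-causal Markov properties (ground set `W`, usually `W = Set.univ`) -/

/-- (PC) the pairwise Granger-causal Markov property w.r.t. `G` (on ground set `W`). -/
def PairwiseMarkov {V : Type*} [MeasurableSpace Ω] (μ : Measure Ω)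
    (X : V → ℤ → Ω → ℝ) (G : MixedGraph V) (W : Set V) : Prop :=
  ∀ a ∈ W, ∀ b ∈ W, a ≠ b →
    (¬G.dir a b → GrangerNoncausal μ X {a} {b} W) ∧
    (¬G.undir a b → ContempIndep μ X {a} {b} W)

/-- (LC) the local Granger-causal Markov property w.r.t. `G` (on ground set `W`). -/
def LocalMarkov {V : Type*} [MeasurableSpace Ω] (μ : Measure Ω)
    (X : V → ℤ → Ω → ℝ) (G : MixedGraph V) (W : Set V) : Prop :=
  ∀ a ∈ W,
    GrangerNoncausal μ X (W \ (G.pa {a} ∪ {a})) {a} W ∧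
    ContempIndep μ X (W \ (G.nb {a} ∪ {a})) {a} W

/-- (BC) the block-recursive Granger-causal Markov property w.r.t. `G`
(on ground set `W`). -/
def BlockRecursiveMarkov {V : Type*} [MeasurableSpace Ω] (μ : Measure Ω)
    (X : V → ℤ → Ω → ℝ) (G : MixedGraph V) (W : Set V) : Prop :=
  ∀ A ⊆ W,
    GrangerNoncausal μ X (W \ (G.pa A ∪ A)) A W ∧
    ContempIndep μ X (W \ (G.nb A ∪ A)) A W

/-- (GC) the global Granger-causal Markov property w.r.t. `G`. -/
def GlobalMarkov {V : Type*} [MeasurableSpace Ω] (μ : Measure Ω)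
    (X : V → ℤ → Ω → ℝ) (G : MixedGraph V) : Prop :=
  ∀ A B S : Set V, Disjoint A B → Disjoint A S → Disjoint B S →
    ((∀ a ∈ A, ∀ b ∈ B, ∀ p : MGPath G a b, p.bPointing → ¬p.pConnecting (S ∪ B)) →
      GrangerNoncausal μ X A B (A ∪ B ∪ S)) ∧
    ((∀ a ∈ A, ∀ b ∈ B, ∀ p : MGPath G a b, p.extBiPointing →
        ¬p.pConnecting (A ∪ B ∪ S)) →
      ContempIndep μ X A B (A ∪ B ∪ S))

/-! ### Conditions (M) and (P) -/

/-- Stationarity: the joint law of `(X_V(t+s))_{s∈ℤ}` does not depend on `t`. -/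
def Stationary {V : Type*} [MeasurableSpace Ω] (μ : Measure Ω)
    (X : V → ℤ → Ω → ℝ) : Prop :=
  ∀ t : ℤ,
    Measure.map (fun ω => fun q : ℤ × V => X q.2 (t + q.1) ω) μ =
    Measure.map (fun ω => fun q : ℤ × V => X q.2 q.1 ω) μ

/-- Strong mixing: `sup |P(S₁ ∩ S₂) − P(S₁) P(S₂)| → 0` as `k → ∞`, the supremum being
over `S₁ ∈ σ(X_V(s) : s ≤ t)` and `S₂ ∈ σ(X_V(s) : s ≥ t + k)`. -/
def StrongMixing {V : Type*} [MeasurableSpace Ω] (μ : Measure Ω)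
    (X : V → ℤ → Ω → ℝ) : Prop :=
  ∀ t : ℤ, ∀ ε > (0 : ℝ), ∃ K : ℕ, ∀ k : ℕ, K ≤ k → ∀ S₁ S₂ : Set Ω,
    MeasurableSet[⨆ (v : V), ⨆ s ≤ t, MeasurableSpace.comap (X v s) inferInstance] S₁ →
    MeasurableSet[⨆ (v : V), ⨆ (s : ℤ) (_ : t + k ≤ s),
      MeasurableSpace.comap (X v s) inferInstance] S₂ →
    |(μ (S₁ ∩ S₂)).toReal - (μ S₁).toReal * (μ S₂).toReal| ≤ ε

/-- Condition (M): the process is stationary and strongly mixing. -/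
def ConditionM {V : Type*} [MeasurableSpace Ω] (μ : Measure Ω)
    (X : V → ℤ → Ω → ℝ) : Prop :=
  Stationary μ X ∧ StrongMixing μ X

/-- `ν` is a product measure on `ℝ^V`. -/
def IsProductMeasure {V : Type*} [Fintype V] (ν : Measure (V → ℝ)) : Prop :=
  ∃ νv : V → Measure ℝ, ∀ B : V → Set ℝ, (∀ v, MeasurableSet (B v)) →
    ν (Set.univ.pi B) = ∏ v, νv v (B v)

/-- The past trajectory `(X_V(s))_{s ≤ t}` of the process at time `t`. -/
def pastTraj {V : Type*} (X : V → ℤ → Ω → ℝ) (t : ℤ) (ω : Ω) : ℤ → V → ℝ :=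
  fun s v => if s ≤ t then X v s ω else 0

/-- Condition (P): the conditional distribution of `X_V(t+1)` given the past
`(X_V(s))_{s≤t}` has a regular version (a Markov kernel `κ` applied to the past
trajectory) that is almost surely absolutely continuous with respect to some product
measure `ν` on `ℝ^V` with a `ν`-a.e. positive and continuous density `f`. -/
def ConditionP {V : Type*} [Fintype V] [MeasurableSpace Ω] (μ : Measure Ω)
    (X : V → ℤ → Ω → ℝ) : Prop :=
  ∃ ν : Measure (V → ℝ), IsProductMeasure ν ∧
    ∀ t : ℤ, ∃ (κ : Kernel (ℤ → V → ℝ) (V → ℝ)) (f : (ℤ → V → ℝ) → (V → ℝ) → ℝ),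
      IsMarkovKernel κ ∧
      (∀ B : Set (V → ℝ), MeasurableSet B →
        (μ[fun ω => B.indicator (fun _ => (1 : ℝ)) (fun v => X v (t + 1) ω) |
            pastSigma μ X Set.univ t]) =ᵐ[μ]
          fun ω => (κ (pastTraj X t ω) B).toReal) ∧
      (∀ᵐ ω ∂μ,
        κ (pastTraj X t ω) =
          ν.withDensity (fun y => ENNReal.ofReal (f (pastTraj X t ω) y)) ∧
        (∀ᵐ y ∂ν, 0 < f (pastTraj X t ω) y ∧ ContinuousAt (f (pastTraj X t ω)) y))

/-! ### Closed spans of process segments -/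

section ClosedSpan

variable {𝕜 E : Type*} [RCLike 𝕜] [NormedAddCommGroup E] [InnerProductSpace 𝕜 E]

/-- The closed linear span of a set. -/
def cspan (𝕜 : Type*) {E : Type*} [RCLike 𝕜] [NormedAddCommGroup E] [InnerProductSpace 𝕜 E]
    (T : Set E) : Submodule 𝕜 E := (Submodule.span 𝕜 T).topologicalClosure

lemma isClosed_cspan (T : Set E) : IsClosed (cspan 𝕜 T : Set E) :=
  Submodule.isClosed_topologicalClosure _

lemma span_le_cspan (T : Set E) : Submodule.span 𝕜 T ≤ cspan 𝕜 T :=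
  Submodule.le_topologicalClosure _

lemma subset_cspan (T : Set E) : T ⊆ cspan 𝕜 T :=
  Submodule.subset_span.trans (span_le_cspan T)

lemma cspan_le {T : Set E} {L : Submodule 𝕜 E} (hL : IsClosed (L : Set E)) (h : T ⊆ L) :
    cspan 𝕜 T ≤ L :=
  Submodule.topologicalClosure_minimal _ (Submodule.span_le.2 h) hL

lemma cspan_mono {T T' : Set E} (h : T ⊆ T') : cspan 𝕜 T ≤ cspan 𝕜 T' :=
  cspan_le (isClosed_cspan _) (h.trans (subset_cspan _))

instance [CompleteSpace E] (T : Set E) : CompleteSpace (cspan 𝕜 T) :=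
  (isClosed_cspan T).completeSpace_coe

instance [CompleteSpace E] (T : Set E) : (cspan 𝕜 T).HasOrthogonalProjection :=
  Submodule.HasOrthogonalProjection.ofCompleteSpace _

lemma map_mem_cspan {F : Type*} [NormedAddCommGroup F] [InnerProductSpace 𝕜 F]
    {T : Set E} {T' : Set F} (f : E →L[𝕜] F) (h : ∀ z ∈ T, f z ∈ cspan 𝕜 T') {z : E}
    (hz : z ∈ cspan 𝕜 T) : f z ∈ cspan 𝕜 T' := by
  have : cspan 𝕜 T ≤ (cspan 𝕜 T').comap (f : E →ₗ[𝕜] F) :=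
    cspan_le ((isClosed_cspan T').preimage f.continuous) h
  exact this hz

lemma inner_eq_zero_of_mem_cspan {T : Set E} {w : E} (h : ∀ z ∈ T, inner 𝕜 z w = 0) {z : E}
    (hz : z ∈ cspan 𝕜 T) : inner 𝕜 z w = 0 := by
  have : cspan 𝕜 T ≤ (Submodule.span 𝕜 {w})ᗮ :=
    cspan_le (Submodule.isClosed_orthogonal _) fun z hz => by
      simpa [Submodule.mem_orthogonal_singleton_iff_inner_left] using h z hz
  simpa [Submodule.mem_orthogonal_singleton_iff_inner_left] using this hz

/-- The set of values `y v n`, `v ∈ B`, `n ∈ J`, of a process `y`. -/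
def seg {V : Type*} (y : V → ℤ → E) (B : Set V) (J : Set ℤ) : Set E :=
  {z | ∃ v ∈ B, ∃ n ∈ J, y v n = z}

variable {V : Type*} {y : V → ℤ → E}

omit [NormedAddCommGroup E] in
lemma mem_seg {B : Set V} {J : Set ℤ} {v : V} {n : ℤ} (hv : v ∈ B) (hn : n ∈ J) :
    y v n ∈ seg y B J := ⟨v, hv, n, hn, rfl⟩

lemma mem_cspan_seg {B : Set V} {J : Set ℤ} {v : V} {n : ℤ} (hv : v ∈ B) (hn : n ∈ J) :
    y v n ∈ cspan 𝕜 (seg y B J) := subset_cspan _ (mem_seg hv hn)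

omit [NormedAddCommGroup E] in
lemma seg_mono {B B' : Set V} {J J' : Set ℤ} (hB : B ⊆ B') (hJ : J ⊆ J') :
    seg y B J ⊆ seg y B' J' := by
  rintro _ ⟨v, hv, n, hn, rfl⟩
  exact mem_seg (hB hv) (hJ hn)

/-- The values at time `n` of the components in `B`. -/
def slice (y : V → ℤ → E) (B : Set V) (n : ℤ) : Set E := (fun v => y v n) '' B

lemma exists_coeff_of_mem_span_slice [Fintype V] {B : Set V} {n : ℤ} {z : E}
    (hz : z ∈ Submodule.span 𝕜 (slice y B n)) :
    ∃ c : V → 𝕜, (∀ v ∉ B, c v = 0) ∧ ∑ v, c v • y v n = z := by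
  classical
  induction hz using Submodule.span_induction with
  | mem x hx =>
    obtain ⟨v, hv, rfl⟩ := hx
    refine ⟨Pi.single v 1, fun w hw => ?_, ?_⟩
    · rw [Pi.single_eq_of_ne]
      rintro rfl
      exact hw hv
    · simp [Pi.single_apply, ite_smul]
  | zero => exact ⟨0, by simp, by simp⟩
  | add a b _ _ ha hb =>
    obtain ⟨c, hc, rfl⟩ := ha
    obtain ⟨d, hd, rfl⟩ := hb
    exact ⟨c + d, fun v hv => by simp [hc v hv, hd v hv],
      by simp [add_smul, Finset.sum_add_distrib]⟩
  | smul r a _ ha =>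
    obtain ⟨c, hc, rfl⟩ := ha
    exact ⟨r • c, fun v hv => by simp [hc v hv], by simp [Finset.smul_sum, smul_smul]⟩

lemma sum_mem_span_slice [Fintype V] {B : Set V} {n : ℤ} {c : V → 𝕜} (hc : ∀ v ∉ B, c v = 0) :
    ∑ v, c v • y v n ∈ Submodule.span 𝕜 (slice y B n) := by
  refine Submodule.sum_mem _ fun v _ => ?_
  by_cases hv : v ∈ B
  · exact Submodule.smul_mem _ _ (Submodule.subset_span ⟨v, hv, rfl⟩)
  · simp [hc v hv]

lemma finiteDimensional_span_slice [Finite V] (B : Set V) (n : ℤ) :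
    FiniteDimensional 𝕜 (Submodule.span 𝕜 (slice y B n)) :=
  FiniteDimensional.span_of_finite _ (B.toFinite.image _)

/-- An element of the closed span of a set together with the values at one time decomposes. -/
lemma exists_decomp_of_mem_cspan [Fintype V] {T T' : Set E} {B : Set V} {n : ℤ}
    (hT : T ⊆ T' ∪ slice y B n) {z : E} (hz : z ∈ cspan 𝕜 T) :
    ∃ c : V → 𝕜, (∀ v ∉ B, c v = 0) ∧ ∃ p ∈ cspan 𝕜 T', z = p + ∑ v, c v • y v n := by
  have := finiteDimensional_span_slice (𝕜 := 𝕜) (y := y) B n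
  have hle : cspan 𝕜 T ≤ cspan 𝕜 T' ⊔ Submodule.span 𝕜 (slice y B n) := by
    refine cspan_le (Submodule.isClosed_sup_finiteDimensional _ _ (isClosed_cspan _)) ?_
    intro x hx
    rcases hT hx with h | h
    · exact Submodule.mem_sup_left (subset_cspan _ h)
    · exact Submodule.mem_sup_right (Submodule.subset_span h)
  obtain ⟨p, hp, q, hq, rfl⟩ := Submodule.mem_sup.1 (hle hz)
  obtain ⟨c, hc, rfl⟩ := exists_coeff_of_mem_span_slice hq
  exact ⟨c, hc, p, hp, rfl⟩

omit [NormedAddCommGroup E] in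
lemma seg_Iic_subset (B : Set V) (n : ℤ) :
    seg y B (Set.Iic n) ⊆ seg y B (Set.Iic (n - 1)) ∪ slice y B n := by
  rintro _ ⟨v, hv, m, hm, rfl⟩
  rcases (Set.mem_Iic.1 hm).lt_or_eq with h | rfl
  · exact Or.inl (mem_seg hv (by simp; omega))
  · exact Or.inr ⟨v, hv, rfl⟩

end ClosedSpan

/-! ### Sums of closed subspaces -/

section ClosedSum

variable {𝕜 E : Type*} [RCLike 𝕜] [NormedAddCommGroup E] [InnerProductSpace 𝕜 E] [CompleteSpace E]

lemma isClosed_sup_of_inner_le {P Q : Submodule 𝕜 E} (hP : IsClosed (P : Set E))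
    (hQ : IsClosed (Q : Set E))
    (h : ∀ p ∈ P, ∀ q ∈ Q, ‖inner 𝕜 p q‖ ≤ 1 / 2 * ‖p‖ * ‖q‖) :
    IsClosed ((P ⊔ Q : Submodule 𝕜 E) : Set E) := by
  have := hP.completeSpace_coe
  have := hQ.completeSpace_coe
  let f : (P × Q) →L[𝕜] E := P.subtypeL.coprod Q.subtypeL
  have hf : ∀ z : P × Q, ‖z‖ ≤ (2 : NNReal) * ‖f z‖ := by
    rintro ⟨p, q⟩
    have h1 := h p p.2 q q.2
    have h2 : ‖(p : E) + q‖ ^ 2 = ‖(p : E)‖ ^ 2 + 2 * RCLike.re (inner 𝕜 (p : E) q) + ‖(q : E)‖ ^ 2 :=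
      norm_add_sq _ _
    have h3 := (abs_le.1 (RCLike.abs_re_le_norm (inner 𝕜 (p : E) q))).1
    have hp := norm_nonneg (p : E)
    have hq := norm_nonneg (q : E)
    have hs := norm_nonneg ((p : E) + q)
    change max ‖(p : E)‖ ‖(q : E)‖ ≤ 2 * ‖(p : E) + q‖
    refine max_le ?_ ?_
    · refine le_of_sq_le_sq ?_ (by positivity)
      nlinarith [sq_nonneg (‖(p : E)‖ - 2 * ‖(q : E)‖)]
    · refine le_of_sq_le_sq ?_ (by positivity)
      nlinarith [sq_nonneg (2 * ‖(p : E)‖ - ‖(q : E)‖)]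
  have hr : ((P ⊔ Q : Submodule 𝕜 E) : Set E) = Set.range f := by
    ext z
    simp only [SetLike.mem_coe, Submodule.mem_sup, Set.mem_range]
    constructor
    · rintro ⟨p, hp, q, hq, rfl⟩
      exact ⟨(⟨p, hp⟩, ⟨q, hq⟩), rfl⟩
    · rintro ⟨⟨p, q⟩, rfl⟩
      exact ⟨p, p.2, q, q.2, rfl⟩
  rw [hr]
  exact (f.antilipschitz_of_bound hf).isClosed_range f.uniformContinuous

omit [CompleteSpace E] in
lemma eq_zero_of_inner_le {z : E} (h : ‖inner 𝕜 z z‖ ≤ 1 / 2 * ‖z‖ * ‖z‖) : z = 0 := by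
  rw [inner_self_eq_norm_sq_to_K] at h
  have h' : ‖z‖ ^ 2 ≤ 1 / 2 * ‖z‖ * ‖z‖ := by simpa using h
  have : ‖z‖ = 0 := by nlinarith [norm_nonneg z]
  simpa using this

lemma exists_bounded_decomp {P Q : Submodule 𝕜 E} (hP : IsClosed (P : Set E))
    (hQ : IsClosed (Q : Set E)) (hPQ : IsClosed ((P ⊔ Q : Submodule 𝕜 E) : Set E)) :
    ∃ C : ℝ, 0 < C ∧ ∀ z ∈ P ⊔ Q, ∃ p ∈ P, ∃ q ∈ Q, z = p + q ∧ ‖p‖ ≤ C * ‖z‖ := by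
  have := hP.completeSpace_coe
  have := hQ.completeSpace_coe
  have := hPQ.completeSpace_coe
  let f₀ : (P × Q) →L[𝕜] E := P.subtypeL.coprod Q.subtypeL
  have hf₀ : ∀ z, f₀ z ∈ P ⊔ Q := fun z =>
    Submodule.add_mem_sup z.1.2 z.2.2
  let f : (P × Q) →L[𝕜] (P ⊔ Q : Submodule 𝕜 E) := f₀.codRestrict _ hf₀
  have hsurj : Function.Surjective f := by
    rintro ⟨z, hz⟩
    obtain ⟨p, hp, q, hq, rfl⟩ := Submodule.mem_sup.1 hz
    exact ⟨(⟨p, hp⟩, ⟨q, hq⟩), rfl⟩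
  obtain ⟨C, hC, h⟩ := f.exists_preimage_norm_le hsurj
  refine ⟨C, hC, fun z hz => ?_⟩
  obtain ⟨⟨p, q⟩, hpq, hn⟩ := h ⟨z, hz⟩
  refine ⟨p, p.2, q, q.2, ?_, (le_max_left _ _).trans hn⟩
  exact (congrArg Subtype.val hpq).symm

end ClosedSum

/-! ### Intersections of pasts of a stationary process in a complex Hilbert space -/

section Stationary

variable {V H : Type*} [NormedAddCommGroup H] [InnerProductSpace ℂ H]
  {y : V → ℤ → H}

lemma map_mem_cspan_seg {W : H ≃ₗᵢ[ℂ] H} {j : ℤ} (hW : ∀ v n, W (y v n) = y v (n + j))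
    {B : Set V} {J J' : Set ℤ} (hJ : ∀ n ∈ J, n + j ∈ J') {z : H}
    (hz : z ∈ cspan ℂ (seg y B J)) : W z ∈ cspan ℂ (seg y B J') := by
  refine map_mem_cspan (W.toContinuousLinearEquiv : H →L[ℂ] H) ?_ hz
  rintro _ ⟨v, hv, n, hn, rfl⟩
  change W (y v n) ∈ _
  rw [hW]
  exact mem_cspan_seg hv (hJ n hn)

lemma pow_apply_process {U : H ≃ₗᵢ[ℂ] H} (hU : ∀ v n, U (y v n) = y v (n + 1)) (k : ℕ) (v : V)
    (n : ℤ) : (U ^ k) (y v n) = y v (n + k) := by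
  induction k with
  | zero => simp
  | succ k ih =>
    rw [pow_succ', LinearIsometryEquiv.coe_mul, Function.comp_apply, ih, hU]
    push_cast
    ring_nf

lemma symm_apply_process {U : H ≃ₗᵢ[ℂ] H} (hU : ∀ v n, U (y v n) = y v (n + 1)) (v : V)
    (n : ℤ) : U.symm (y v n) = y v (n + (-1)) := by
  rw [LinearIsometryEquiv.symm_apply_eq, hU]
  ring_nf

variable [CompleteSpace H]

/-- Values at time `0` of a process with linearly independent innovations stay linearly
independent modulo the range of `S - μ` on the past. -/
lemma eq_zero_of_sum_eq_shift_sub [Fintype V] {S : H ≃ₗᵢ[ℂ] H}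
    (hS : ∀ v n, S (y v n) = y v (n + (-1)))
    (hind : ∀ c : V → ℂ, ∑ v, c v • y v 0 ∈ cspan ℂ (seg y Set.univ (Set.Iic (-1))) → c = 0)
    {μ : ℂ} (hμ : ‖μ‖ < 1) {α : V → ℂ} {z : H}
    (hz : z ∈ cspan ℂ (seg y Set.univ (Set.Iic 0))) (h : ∑ v, α v • y v 0 = S z - μ • z) :
    α = 0 := by
  classical
  set N := cspan ℂ (seg y Set.univ (Set.Iic 0))
  set N' := cspan ℂ (seg y Set.univ (Set.Iic (-1)))
  have hSN : ∀ z ∈ N, S z ∈ N' := fun z hz =>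
    map_mem_cspan_seg hS (fun n hn => by simp at hn ⊢; omega) hz
  have hN'N : N' ≤ N := cspan_mono (seg_mono subset_rfl (Set.Iic_subset_Iic.2 (by norm_num)))
  have hyN : ∀ v, y v 0 ∈ N := fun v => mem_cspan_seg (Set.mem_univ v) (by simp)
  let e : V → H := fun v => y v 0 - N'.starProjection (y v 0)
  have heN : ∀ v, e v ∈ N := fun v =>
    N.sub_mem (hyN v) (hN'N (Submodule.starProjection_apply_mem _ _))
  have heo : ∀ v, ∀ w ∈ N', inner ℂ (e v) w = 0 := fun v w hw =>
    Submodule.starProjection_inner_eq_zero _ w hw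
  have hk : ∀ v, ∃ k ∈ N, k = e v + (starRingEnd ℂ μ) • S k := by
    intro v
    let f : N → N := fun k => ⟨e v + (starRingEnd ℂ μ) • S k,
      N.add_mem (heN v) (N.smul_mem _ (hN'N (hSN k k.2)))⟩
    have hf : ContractingWith ‖μ‖₊ f := by
      refine ⟨by exact_mod_cast hμ, LipschitzWith.of_dist_le_mul fun a b => ?_⟩
      rw [Subtype.dist_eq, Subtype.dist_eq, dist_eq_norm, dist_eq_norm]
      simp only [f, add_sub_add_left_eq_sub, ← smul_sub, ← map_sub, norm_smul, RCLike.norm_conj,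
        LinearIsometryEquiv.norm_map, coe_nnnorm]
      exact le_rfl
    have := hf.fixedPoint_isFixedPt
    exact ⟨hf.fixedPoint, Subtype.coe_prop _, (congrArg Subtype.val this).symm⟩
  choose k hkN hk using hk
  have hks : ∀ v, ∀ z ∈ N, inner ℂ (k v) (S z) = μ * inner ℂ (k v) z := by
    intro v z hz
    conv_lhs => rw [hk v]
    rw [inner_add_left, heo v _ (hSN z hz), inner_smul_left, LinearIsometryEquiv.inner_map_map]
    simp
  let M : Matrix V V ℂ := fun v w => inner ℂ (k v) (y w 0)
  have hM : Function.Injective fun β : V → ℂ => Matrix.vecMul β M := by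
    have hinj : ∀ β : V → ℂ, Matrix.vecMul β M = 0 → β = 0 := by
      intro β hβ
      let κ : H := ∑ v, (starRingEnd ℂ (β v)) • k v
      have hκN : κ ∈ N := N.sum_mem fun v _ => N.smul_mem _ (hkN v)
      have hκ0 : ∀ w, inner ℂ κ (y w 0) = 0 := by
        intro w
        have := congrFun hβ w
        simpa [κ, sum_inner, inner_smul_left, Matrix.vecMul, dotProduct, M, mul_comm] using this
      have hκS : ∀ z ∈ N, inner ℂ κ (S z) = μ * inner ℂ κ z := by
        intro z hz
        simp only [κ, sum_inner, inner_smul_left, hks _ z hz, Finset.mul_sum]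
        exact Finset.sum_congr rfl fun v _ => by ring
      have hκn : ∀ (n : ℕ) w, inner ℂ κ (y w (-n)) = 0 := by
        intro n
        induction n with
        | zero => simpa using hκ0
        | succ n ih =>
          intro w
          have h1 : y w (-((n + 1 : ℕ) : ℤ)) = S (y w (-n)) := by
            rw [hS]; push_cast; ring_nf
          rw [h1, hκS _ (mem_cspan_seg (Set.mem_univ w) (by simp)), ih w, mul_zero]
      have hκ : κ = 0 := by
        have h0 : inner ℂ κ κ = 0 := by
          refine inner_eq_zero_of_mem_cspan ?_ hκN
          rintro _ ⟨v, -, n, hn, rfl⟩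
          obtain ⟨m, rfl⟩ : ∃ m : ℕ, n = -m := ⟨(-n).toNat, by simp at hn; omega⟩
          rw [inner_eq_zero_symm]
          exact hκn m v
        exact inner_self_eq_zero.1 h0
      have hsum : ∑ v, (starRingEnd ℂ (β v)) • e v = 0 := by
        have h1 : κ = ∑ v, (starRingEnd ℂ (β v)) • e v + (starRingEnd ℂ μ) • S κ := by
          simp only [κ, map_sum, map_smul, Finset.smul_sum, ← Finset.sum_add_distrib]
          refine Finset.sum_congr rfl fun v _ => ?_
          conv_lhs => rw [hk v]
          rw [smul_add, smul_comm]
        rw [hκ] at h1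
        simpa using h1.symm
      have h2 := hind (fun v => starRingEnd ℂ (β v)) (by
        have h3 : ∑ v, (starRingEnd ℂ (β v)) • y v 0
            = ∑ v, (starRingEnd ℂ (β v)) • N'.starProjection (y v 0) := by
          rw [← sub_eq_zero, ← Finset.sum_sub_distrib, ← hsum]
          exact Finset.sum_congr rfl fun v _ => (smul_sub _ _ _).symm
        rw [h3]
        exact N'.sum_mem fun v _ => N'.smul_mem _ (Submodule.starProjection_apply_mem _ _))
      funext v
      simpa using congrFun h2 v
    intro a b hab
    have := hinj (a - b) (by rw [Matrix.sub_vecMul]; exact sub_eq_zero.2 hab)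
    exact sub_eq_zero.1 this
  have hM' := Matrix.mulVec_injective_iff_isUnit.2 (Matrix.vecMul_injective_iff_isUnit.1 hM)
  refine hM' ?_
  rw [Matrix.mulVec_zero]
  funext v
  have h1 : inner ℂ (k v) (∑ w, α w • y w 0) = 0 := by
    rw [h, inner_sub_right, hks v z hz, inner_smul_right, sub_self]
  simpa [inner_sum, inner_smul_right, Matrix.mulVec, dotProduct, M, mul_comm] using h1

end Stationary


section StationaryIntersection

open Set

set_option linter.unusedSectionVars false

variable {V H : Type*} [NormedAddCommGroup H] [InnerProductSpace ℂ H] [CompleteSpace H]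
  {y : V → ℤ → H}

/-- Correlations between the past up to time `0` and the future from time `k` on tend to zero
uniformly as `k` grows. -/
def DecayingCorrelations {V H : Type*} [NormedAddCommGroup H] [InnerProductSpace ℂ H]
    (y : V → ℤ → H) : Prop :=
  ∀ ε > (0 : ℝ), ∃ k : ℕ, ∀ a ∈ cspan ℂ (seg y univ (Iic 0)),
    ∀ b ∈ cspan ℂ (seg y univ (Ici (k : ℤ))), ‖inner ℂ a b‖ ≤ ε * ‖a‖ * ‖b‖

lemma symm_mem_past {U : H ≃ₗᵢ[ℂ] H} (hU : ∀ v n, U (y v n) = y v (n + 1)) {B : Set V} {z : H}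
    (hz : z ∈ cspan ℂ (seg y B (Iic 0))) : U.symm z ∈ cspan ℂ (seg y B (Iic 0)) :=
  map_mem_cspan_seg (symm_apply_process hU) (fun n hn => by simp at hn ⊢; omega) hz

lemma mem_past_of_shift_sub_mem_of_norm_lt_one [Fintype V] {U : H ≃ₗᵢ[ℂ] H}
    (hU : ∀ v n, U (y v n) = y v (n + 1))
    (hind : ∀ c : V → ℂ, ∑ v, c v • y v 0 ∈ cspan ℂ (seg y univ (Iic (-1))) → c = 0)
    {A : Set V} {μ : ℂ} (hμ : ‖μ‖ < 1) {z : H} (hz : z ∈ cspan ℂ (seg y univ (Iic 0)))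
    (h : U.symm z - μ • z ∈ cspan ℂ (seg y A (Iic 0))) : z ∈ cspan ℂ (seg y A (Iic 0)) := by
  let T : H →L[ℂ] H := (U.symm.toContinuousLinearEquiv : H →L[ℂ] H) - μ • ContinuousLinearMap.id ℂ H
  have hT : ∀ w, T w = U.symm w - μ • w := fun w => rfl
  have hanti : AntilipschitzWith (Real.toNNReal (1 - ‖μ‖))⁻¹ T := by
    refine ContinuousLinearMap.antilipschitz_of_bound _ fun w => ?_
    have h1 : ‖w‖ - ‖μ‖ * ‖w‖ ≤ ‖T w‖ := by
      rw [hT]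
      have := norm_sub_norm_le (U.symm w) (μ • w)
      rwa [norm_smul, LinearIsometryEquiv.norm_map] at this
    rw [NNReal.coe_inv, Real.coe_toNNReal _ (by linarith)]
    rw [inv_mul_eq_div, le_div_iff₀ (by linarith)]
    linarith
  have hclosed : IsClosed (((cspan ℂ (seg y A (Iic 0))).map (T : H →ₗ[ℂ] H) : Submodule ℂ H) : Set H) := by
    rw [Submodule.map_coe]
    exact (hanti.isClosedEmbedding T.uniformContinuous).isClosedMap _ (isClosed_cspan _)
  have := finiteDimensional_span_slice (𝕜 := ℂ) (y := y) A 0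
  have hle : cspan ℂ (seg y A (Iic 0)) ≤
      (cspan ℂ (seg y A (Iic 0))).map (T : H →ₗ[ℂ] H) ⊔ Submodule.span ℂ (slice y A 0) := by
    refine cspan_le (Submodule.isClosed_sup_finiteDimensional _ _ hclosed) ?_
    rintro _ ⟨a, ha, n, hn, rfl⟩
    obtain ⟨m, rfl⟩ : ∃ m : ℕ, n = -m := ⟨(-n).toNat, by simp at hn; omega⟩
    clear hn
    induction m with
    | zero => exact Submodule.mem_sup_right (Submodule.subset_span ⟨a, ha, by simp⟩)
    | succ m ih =>
      have h1 : y a (-((m + 1 : ℕ) : ℤ)) = T (y a (-m)) + μ • y a (-m) := by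
        rw [hT, symm_apply_process hU, sub_add_cancel]
        push_cast
        ring_nf
      rw [h1]
      exact Submodule.add_mem _ (Submodule.mem_sup_left
        ⟨_, mem_cspan_seg ha (by simp), rfl⟩) (Submodule.smul_mem _ _ ih)
  obtain ⟨_, ⟨m, hm, rfl⟩, q, hq, hpq⟩ := Submodule.mem_sup.1 (hle h)
  obtain ⟨α, -, rfl⟩ := exists_coeff_of_mem_span_slice hq
  have hm' : (T : H →ₗ[ℂ] H) m = U.symm m - μ • m := rfl
  rw [hm'] at hpq
  have hα : ∑ v, α v • y v 0 = U.symm (z - m) - μ • (z - m) := by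
    rw [map_sub, smul_sub, sub_sub_sub_comm, ← hpq]
    abel
  have h0 := eq_zero_of_sum_eq_shift_sub (symm_apply_process hU) hind hμ
    (Submodule.sub_mem _ hz (cspan_mono (seg_mono (subset_univ A) subset_rfl) hm)) hα
  have h1 : T (z - m) = T 0 := by
    rw [hT, ← hα, h0]
    simp
  rw [sub_eq_zero.1 (hanti.injective h1)]
  exact hm

lemma exists_inner_pow_le {U : H ≃ₗᵢ[ℂ] H} (hU : ∀ v n, U (y v n) = y v (n + 1))
    (hmix : DecayingCorrelations y) {h : H} (hh : h ∈ cspan ℂ (seg y univ univ)) {ε : ℝ}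
    (hε : 0 < ε) :
    ∃ K : ℕ, ∀ k ≥ K, ∀ a ∈ cspan ℂ (seg y univ (Iic 0)), ‖inner ℂ a ((U ^ k) h)‖ ≤ ε * ‖a‖ := by
  have hspan : ∀ h ∈ Submodule.span ℂ (seg y univ univ), ∀ ε > (0 : ℝ),
      ∃ K : ℕ, ∀ k ≥ K, ∀ a ∈ cspan ℂ (seg y univ (Iic 0)),
        ‖inner ℂ a ((U ^ k) h)‖ ≤ ε * ‖a‖ := by
    intro h hh
    induction hh using Submodule.span_induction with
    | mem x hx =>
      obtain ⟨v, -, n, -, rfl⟩ := hx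
      intro ε hε
      obtain ⟨k₀, hk₀⟩ := hmix (ε / (‖y v n‖ + 1)) (by positivity)
      refine ⟨k₀ + n.natAbs, fun k hk a ha => ?_⟩
      have h1 := hk₀ a ha ((U ^ k) (y v n)) (by
        rw [pow_apply_process hU]
        exact mem_cspan_seg (mem_univ v) (by simp; omega))
      rw [LinearIsometryEquiv.norm_map] at h1
      refine h1.trans ?_
      rw [div_mul_eq_mul_div, div_mul_eq_mul_div, div_le_iff₀ (by positivity)]
      nlinarith [mul_nonneg hε.le (norm_nonneg a)]
    | zero =>
      intro ε hε
      exact ⟨0, fun k _ a _ => by simp; positivity⟩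
    | add b c _ _ hb hc =>
      intro ε hε
      obtain ⟨K, hK⟩ := hb (ε / 2) (by positivity)
      obtain ⟨L, hL⟩ := hc (ε / 2) (by positivity)
      refine ⟨max K L, fun k hk a ha => ?_⟩
      rw [map_add, inner_add_right]
      refine (norm_add_le _ _).trans ?_
      linarith [hK k (le_of_max_le_left hk) a ha, hL k (le_of_max_le_right hk) a ha]
    | smul r b _ hb =>
      intro ε hε
      obtain ⟨K, hK⟩ := hb (ε / (‖r‖ + 1)) (by positivity)
      refine ⟨K, fun k hk a ha => ?_⟩
      rw [map_smul, inner_smul_right, norm_mul]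
      refine (mul_le_mul_of_nonneg_left (hK k hk a ha) (norm_nonneg r)).trans ?_
      rw [div_mul_eq_mul_div, ← mul_div_assoc, div_le_iff₀ (by positivity)]
      nlinarith [mul_nonneg hε.le (norm_nonneg a)]
  obtain ⟨h', hh', hd⟩ := Metric.mem_closure_iff.1 hh (ε / 2) (by positivity)
  obtain ⟨K, hK⟩ := hspan h' hh' (ε / 2) (by positivity)
  refine ⟨K, fun k hk a ha => ?_⟩
  have h1 : h = h' + (h - h') := by abel
  rw [h1, map_add, inner_add_right]
  refine (norm_add_le _ _).trans ?_
  have h2 := norm_inner_le_norm (𝕜 := ℂ) a ((U ^ k) (h - h'))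
  rw [LinearIsometryEquiv.norm_map, ← dist_eq_norm] at h2
  nlinarith [hK k hk a ha, norm_nonneg a]

lemma symm_pow_apply (U : H ≃ₗᵢ[ℂ] H) (k : ℕ) (z w : H) :
    inner ℂ ((U ^ k) z) w = inner ℂ z ((U.symm ^ k) w) := by
  induction k generalizing w with
  | zero => simp
  | succ k ih =>
    rw [pow_succ', pow_succ, LinearIsometryEquiv.coe_mul, LinearIsometryEquiv.coe_mul,
      Function.comp_apply, Function.comp_apply, ← ih, ← LinearIsometryEquiv.inner_map_map U.symm,
      LinearIsometryEquiv.symm_apply_apply]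

lemma mem_past_of_shift_sub_mem_of_one_le_norm {U : H ≃ₗᵢ[ℂ] H}
    (hU : ∀ v n, U (y v n) = y v (n + 1)) (hmix : DecayingCorrelations y)
    {A : Set V} {μ : ℂ} (hμ : 1 ≤ ‖μ‖) {z : H} (hz : z ∈ cspan ℂ (seg y univ (Iic 0)))
    (h : U.symm z - μ • z ∈ cspan ℂ (seg y A (Iic 0))) : z ∈ cspan ℂ (seg y A (Iic 0)) := by
  set N := cspan ℂ (seg y A (Iic 0))
  have hk : ∀ k : ℕ, (U.symm ^ k) z - μ ^ k • z ∈ N := by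
    intro k
    induction k with
    | zero => simp
    | succ k ih =>
      have h1 : (U.symm ^ (k + 1)) z - μ ^ (k + 1) • z
          = U.symm ((U.symm ^ k) z - μ ^ k • z) + μ ^ k • (U.symm z - μ • z) := by
        rw [pow_succ', LinearIsometryEquiv.coe_mul, Function.comp_apply, map_sub, map_smul,
          smul_sub, smul_smul, pow_succ]
        abel
      rw [h1]
      exact N.add_mem (symm_mem_past hU ih) (N.smul_mem _ h)
  let g := z - N.starProjection z
  have hgN : ∀ w ∈ N, inner ℂ g w = 0 := fun w hw =>
    Submodule.starProjection_inner_eq_zero _ w hw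
  have hgz : inner ℂ g z = inner ℂ g g := by
    have h1 : z = g + N.starProjection z := by simp [g]
    conv_lhs => rw [h1]
    rw [inner_add_right, hgN _ (Submodule.starProjection_apply_mem _ _), add_zero]
  have hg : g ∈ cspan ℂ (seg y univ univ) :=
    Submodule.sub_mem _ (cspan_mono (seg_mono subset_rfl (subset_univ _)) hz)
      (cspan_mono (seg_mono (subset_univ _) (subset_univ _))
        (Submodule.starProjection_apply_mem N z))
  have hbound : ∀ ε > (0 : ℝ), ‖g‖ ^ 2 ≤ 0 + ε := by
    intro ε hε
    obtain ⟨K, hK⟩ := exists_inner_pow_le hU hmix hg (ε := ε / (‖z‖ + 1)) (by positivity)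
    have h1 := hK K le_rfl z hz
    rw [norm_inner_symm, symm_pow_apply] at h1
    have h2 : inner ℂ g ((U.symm ^ K) z) = μ ^ K * inner ℂ g g := by
      have h3 : (U.symm ^ K) z = ((U.symm ^ K) z - μ ^ K • z) + μ ^ K • z := by abel
      rw [h3, inner_add_right, hgN _ (hk K), inner_smul_right, hgz, zero_add]
    rw [h2, norm_mul, norm_pow, inner_self_eq_norm_sq_to_K] at h1
    have h4 : ‖((‖g‖ : ℂ)) ^ 2‖ = ‖g‖ ^ 2 := by simp
    have h5 : 1 ≤ ‖μ‖ ^ K := one_le_pow₀ hμ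
    have h6 : ε / (‖z‖ + 1) * ‖z‖ ≤ ε := by
      rw [div_mul_eq_mul_div, div_le_iff₀ (by positivity)]
      nlinarith [norm_nonneg z]
    erw [h4] at h1
    nlinarith [sq_nonneg ‖g‖]
  have hg0 : g = 0 := by
    have := le_of_forall_pos_le_add hbound
    have h1 : ‖g‖ = 0 := by nlinarith [norm_nonneg g]
    simpa using h1
  rw [sub_eq_zero.1 hg0]
  exact Submodule.starProjection_apply_mem _ _

lemma finiteDimensional_block (y : V → ℤ → H) [Finite V] (A : Set V) (k : ℕ) :
    FiniteDimensional ℂ (Submodule.span ℂ (seg y A (Ico 1 (k + 1)))) := by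
  refine FiniteDimensional.span_of_finite ℂ ?_
  have h1 : (A ×ˢ Ico (1 : ℤ) (k + 1)).Finite := A.toFinite.prod (Set.finite_Ico _ _)
  refine (h1.image fun q => y q.1 q.2).subset ?_
  rintro _ ⟨v, hv, n, hn, rfl⟩
  exact ⟨(v, n), ⟨hv, hn⟩, rfl⟩

/-- The future of `A` is the sum of the remote future and a finite dimensional part. -/
lemma future_eq_sup (y : V → ℤ → H) [Finite V] (A : Set V) (k : ℕ) :
    cspan ℂ (seg y A (Ici 1)) = cspan ℂ (seg y A (Ici (k + 1))) ⊔
      Submodule.span ℂ (seg y A (Ico 1 (k + 1))) := by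
  have := finiteDimensional_block y A k
  refine le_antisymm (cspan_le (Submodule.isClosed_sup_finiteDimensional _ _ (isClosed_cspan _)) ?_)
    (sup_le (cspan_mono (seg_mono subset_rfl (Ici_subset_Ici.2 (by omega))))
      ((span_le_cspan _).trans (cspan_mono (seg_mono subset_rfl Ico_subset_Ici_self))))
  rintro _ ⟨v, hv, n, hn, rfl⟩
  by_cases h : n < k + 1
  · exact Submodule.mem_sup_right (Submodule.subset_span (mem_seg hv ⟨hn, h⟩))
  · exact Submodule.mem_sup_left (mem_cspan_seg hv (not_lt.1 h))

lemma DecayingCorrelations.exists_half (hmix : DecayingCorrelations y) (A B : Set V) :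
    ∃ k : ℕ, ∀ a ∈ cspan ℂ (seg y B (Iic 0)), ∀ b ∈ cspan ℂ (seg y A (Ici (k + 1))),
      ‖inner ℂ a b‖ ≤ 1 / 2 * ‖a‖ * ‖b‖ := by
  obtain ⟨k, hk⟩ := hmix (1 / 2) (by norm_num)
  exact ⟨k, fun a ha b hb => hk a (cspan_mono (seg_mono (subset_univ _) subset_rfl) ha) b
    (cspan_mono (seg_mono (subset_univ _) (Ici_subset_Ici.2 (by omega))) hb)⟩

lemma isClosed_past_sup_future [Finite V] (hmix : DecayingCorrelations y) (A B : Set V) :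
    IsClosed ((cspan ℂ (seg y B (Iic 0)) ⊔ cspan ℂ (seg y A (Ici 1)) : Submodule ℂ H) : Set H) := by
  obtain ⟨k, hk⟩ := hmix.exists_half A B
  rw [future_eq_sup y A k, ← sup_assoc]
  have := finiteDimensional_block y A k
  exact Submodule.isClosed_sup_finiteDimensional _ _
    (isClosed_sup_of_inner_le (isClosed_cspan _) (isClosed_cspan _) hk)

lemma exists_eq_add_of_mem_inf [Fintype V]
    (hind : ∀ c : V → ℂ, ∑ v, c v • y v 0 ∈ cspan ℂ (seg y univ (Iic (-1))) → c = 0)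
    {S₁ S₂ : Set V} {z : H}
    (hz : z ∈ cspan ℂ (seg y S₁ (Iic 0)) ⊓ cspan ℂ (seg y S₂ (Iic 0))) :
    ∃ p ∈ cspan ℂ (seg y S₁ (Iic (-1))) ⊓ cspan ℂ (seg y S₂ (Iic (-1))),
      ∃ q ∈ Submodule.span ℂ (slice y (S₁ ∩ S₂) 0), z = p + q := by
  obtain ⟨c, hc, p, hp, hzp⟩ := exists_decomp_of_mem_cspan (seg_Iic_subset (y := y) S₁ 0) hz.1
  obtain ⟨d, hd, q, hq, hzq⟩ := exists_decomp_of_mem_cspan (seg_Iic_subset (y := y) S₂ 0) hz.2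
  norm_num at hp hq
  have hcd : c - d = 0 := by
    refine hind _ ?_
    have h1 : ∑ v, (c - d) v • y v 0 = q - p := by
      simp only [Pi.sub_apply, sub_smul, Finset.sum_sub_distrib]
      rw [sub_eq_sub_iff_add_eq_add, add_comm, ← hzp, hzq]
    rw [h1]
    exact Submodule.sub_mem _ (cspan_mono (seg_mono (subset_univ _) subset_rfl) hq)
      (cspan_mono (seg_mono (subset_univ _) subset_rfl) hp)
  obtain rfl := sub_eq_zero.1 hcd
  have hpq : p = q := add_right_cancel (hzp.symm.trans hzq)
  refine ⟨p, ⟨hp, hpq ▸ hq⟩, _, sum_mem_span_slice fun v hv => ?_, hzp⟩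
  by_cases h : v ∈ S₁
  · exact hd v fun h' => hv ⟨h, h'⟩
  · exact hc v h

lemma pow_apply_mem_past_sup_future [Fintype V] {U : H ≃ₗᵢ[ℂ] H}
    (hU : ∀ v n, U (y v n) = y v (n + 1))
    (hind : ∀ c : V → ℂ, ∑ v, c v • y v 0 ∈ cspan ℂ (seg y univ (Iic (-1))) → c = 0)
    {S₁ S₂ : Set V} (k : ℕ) {z : H}
    (hz : z ∈ cspan ℂ (seg y S₁ (Iic 0)) ⊓ cspan ℂ (seg y S₂ (Iic 0))) :
    (U ^ k) z ∈ cspan ℂ (seg y univ (Iic 0)) ⊔ cspan ℂ (seg y (S₁ ∩ S₂) (Ici 1)) := by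
  induction k generalizing z with
  | zero => exact Submodule.mem_sup_left (cspan_mono (seg_mono (subset_univ _) subset_rfl) hz.1)
  | succ k ih =>
    obtain ⟨p, hp, q, hq, rfl⟩ := exists_eq_add_of_mem_inf hind hz
    obtain ⟨c, hc, rfl⟩ := exists_coeff_of_mem_span_slice hq
    rw [map_add]
    refine Submodule.add_mem _ ?_ (Submodule.mem_sup_right ?_)
    · rw [pow_succ, LinearIsometryEquiv.coe_mul, Function.comp_apply]
      exact ih ⟨map_mem_cspan_seg hU (fun n hn => by simp at hn ⊢; omega) hp.1,
        map_mem_cspan_seg hU (fun n hn => by simp at hn ⊢; omega) hp.2⟩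
    · rw [map_sum]
      refine Submodule.sum_mem _ fun v _ => ?_
      rw [map_smul, pow_apply_process hU]
      by_cases hv : v ∈ S₁ ∩ S₂
      · exact Submodule.smul_mem _ _ (mem_cspan_seg hv (by simp))
      · simp [hc v hv]

lemma mem_cspan_seg_univ_of_mem_inf [Fintype V] {U : H ≃ₗᵢ[ℂ] H}
    (hU : ∀ v n, U (y v n) = y v (n + 1))
    (hind : ∀ c : V → ℂ, ∑ v, c v • y v 0 ∈ cspan ℂ (seg y univ (Iic (-1))) → c = 0)
    (hmix : DecayingCorrelations y) {S₁ S₂ : Set V} {z : H}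
    (hz : z ∈ cspan ℂ (seg y S₁ (Iic 0)) ⊓ cspan ℂ (seg y S₂ (Iic 0))) :
    z ∈ cspan ℂ (seg y (S₁ ∩ S₂) univ) := by
  set M := cspan ℂ (seg y (S₁ ∩ S₂) univ)
  obtain ⟨C, hC, hdec⟩ := exists_bounded_decomp (isClosed_cspan _) (isClosed_cspan _)
    (isClosed_past_sup_future hmix (S₁ ∩ S₂) univ)
  let g := z - M.starProjection z
  have hgM : ∀ w ∈ M, inner ℂ g w = 0 := fun w hw =>
    Submodule.starProjection_inner_eq_zero _ w hw
  have hgz : inner ℂ g z = inner ℂ g g := by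
    have h1 : z = g + M.starProjection z := by simp [g]
    conv_lhs => rw [h1]
    rw [inner_add_right, hgM _ (Submodule.starProjection_apply_mem _ _), add_zero]
  have hg : g ∈ cspan ℂ (seg y univ univ) :=
    Submodule.sub_mem _ (cspan_mono (seg_mono (subset_univ _) (subset_univ _)) hz.1)
      (cspan_mono (seg_mono (subset_univ _) (subset_univ _))
        (Submodule.starProjection_apply_mem M z))
  have hSM : ∀ (k : ℕ), ∀ w ∈ M, (U.symm ^ k) w ∈ M := by
    intro k w hw
    induction k with
    | zero => simpa
    | succ k ih =>
      rw [pow_succ', LinearIsometryEquiv.coe_mul, Function.comp_apply]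
      exact map_mem_cspan_seg (symm_apply_process hU) (fun _ _ => mem_univ _) ih
  have hbound : ∀ ε > (0 : ℝ), ‖g‖ ^ 2 ≤ 0 + ε := by
    intro ε hε
    obtain ⟨K, hK⟩ := exists_inner_pow_le hU hmix hg (ε := ε / (C * ‖z‖ + 1)) (by positivity)
    obtain ⟨r, hr, q, hq, hrq, hn⟩ := hdec _ (pow_apply_mem_past_sup_future hU hind K hz)
    rw [LinearIsometryEquiv.norm_map] at hn
    have h1 := hK K le_rfl r hr
    have h2 : inner ℂ g g = inner ℂ ((U ^ K) g) r := by
      rw [← hgz, ← LinearIsometryEquiv.inner_map_map (U ^ K), hrq, inner_add_right,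
        symm_pow_apply U K g q,
        hgM _ (hSM K q (cspan_mono (seg_mono subset_rfl (subset_univ _)) hq)), add_zero]
    rw [norm_inner_symm, ← h2, inner_self_eq_norm_sq_to_K] at h1
    have h4 : ‖((‖g‖ : ℂ)) ^ 2‖ = ‖g‖ ^ 2 := by simp
    erw [h4] at h1
    have h6 : ε / (C * ‖z‖ + 1) * ‖r‖ ≤ ε := by
      rw [div_mul_eq_mul_div, div_le_iff₀ (by positivity)]
      nlinarith [norm_nonneg z]
    linarith
  have hg0 : g = 0 := by
    have := le_of_forall_pos_le_add hbound
    have h1 : ‖g‖ = 0 := by nlinarith [norm_nonneg g]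
    simpa using h1
  rw [sub_eq_zero.1 hg0]
  exact Submodule.starProjection_apply_mem _ _

/-- The intersection of the pasts of two subprocesses of a stationary process with linearly
independent innovations and decaying correlations is the past of the common subprocess. -/
theorem past_inf_past_le [Fintype V] {U : H ≃ₗᵢ[ℂ] H}
    (hU : ∀ v n, U (y v n) = y v (n + 1))
    (hind : ∀ c : V → ℂ, ∑ v, c v • y v 0 ∈ cspan ℂ (seg y univ (Iic (-1))) → c = 0)
    (hmix : DecayingCorrelations y) (S₁ S₂ : Set V) :
    cspan ℂ (seg y S₁ (Iic 0)) ⊓ cspan ℂ (seg y S₂ (Iic 0)) ≤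
      cspan ℂ (seg y (S₁ ∩ S₂) (Iic 0)) := by
  set I := cspan ℂ (seg y S₁ (Iic 0)) ⊓ cspan ℂ (seg y S₂ (Iic 0))
  set A := S₁ ∩ S₂
  set N := cspan ℂ (seg y A (Iic 0))
  set G := cspan ℂ (seg y A (Ici 1))
  have hNI : N ≤ I := le_inf (cspan_mono (seg_mono inter_subset_left subset_rfl))
    (cspan_mono (seg_mono inter_subset_right subset_rfl))
  have hI : I ≤ N ⊔ I ⊓ G := by
    intro z hz
    have h1 : cspan ℂ (seg y A univ) ≤ N ⊔ G := by
      refine cspan_le (isClosed_past_sup_future hmix A A) ?_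
      rintro _ ⟨v, hv, n, -, rfl⟩
      rcases le_or_gt n 0 with h | h
      · exact Submodule.mem_sup_left (mem_cspan_seg hv h)
      · exact Submodule.mem_sup_right (mem_cspan_seg hv h)
    obtain ⟨p, hp, g, hg, rfl⟩ :=
      Submodule.mem_sup.1 (h1 (mem_cspan_seg_univ_of_mem_inf hU hind hmix hz))
    refine Submodule.add_mem_sup hp ⟨?_, hg⟩
    simpa using I.sub_mem hz (hNI hp)
  have hfin : FiniteDimensional ℂ (I ⊓ G : Submodule ℂ H) := by
    obtain ⟨k, hk⟩ := hmix.exists_half A univ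
    have := finiteDimensional_block y A k
    let f : (I ⊓ G : Submodule ℂ H) →ₗ[ℂ] H ⧸ cspan ℂ (seg y A (Ici (k + 1))) :=
      (Submodule.mkQ _).comp (I ⊓ G).subtype
    have hf : ∀ z, f z ∈ (Submodule.span ℂ (seg y A (Ico 1 (k + 1)))).map
        (Submodule.mkQ (cspan ℂ (seg y A (Ici (k + 1))))) := by
      rintro ⟨z, hz⟩
      obtain ⟨g, hg, q, hq, rfl⟩ := Submodule.mem_sup.1 ((future_eq_sup y A k).le hz.2)
      refine ⟨q, hq, ?_⟩
      simp only [f, LinearMap.comp_apply, Submodule.subtype_apply, map_add]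
      have h0 : Submodule.mkQ (cspan ℂ (seg y A (Ici ((k : ℤ) + 1)))) g = 0 :=
        (Submodule.Quotient.mk_eq_zero _).2 hg
      rw [h0, zero_add]
    refine Module.Finite.of_injective (f.codRestrict _ hf) ?_
    rw [← LinearMap.ker_eq_bot, LinearMap.ker_codRestrict, LinearMap.ker_eq_bot']
    rintro ⟨z, hz⟩ h0
    have h1 : z ∈ cspan ℂ (seg y A (Ici (k + 1))) := (Submodule.Quotient.mk_eq_zero _).1 h0
    have h2 := hk z (cspan_mono (seg_mono (subset_univ _) subset_rfl) hz.1.1) z h1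
    exact Subtype.ext (eq_zero_of_inner_le h2)
  by_contra hcon
  obtain ⟨z₀, hz₀, hz₀N⟩ := SetLike.not_le_iff_exists.1 hcon
  let Q : Submodule ℂ (H ⧸ N) := I.map N.mkQ
  have hQ : Q ≤ (I ⊓ G).map N.mkQ := by
    rintro _ ⟨z, hz, rfl⟩
    obtain ⟨p, hp, g, hg, rfl⟩ := Submodule.mem_sup.1 (hI hz)
    refine ⟨g, hg, ?_⟩
    have h0 : N.mkQ p = 0 := (Submodule.Quotient.mk_eq_zero _).2 hp
    rw [map_add, h0, zero_add]
  have hQfin : FiniteDimensional ℂ Q := Submodule.finiteDimensional_of_le hQ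
  let s : H →ₗ[ℂ] H := U.symm.toLinearEquiv
  let f : (H ⧸ N) →ₗ[ℂ] (H ⧸ N) := N.mapQ N s fun z hz => symm_mem_past hU hz
  have hfQ : ∀ q ∈ Q, f q ∈ Q := by
    rintro _ ⟨z, hz, rfl⟩
    exact ⟨U.symm z, ⟨symm_mem_past hU hz.1, symm_mem_past hU hz.2⟩, rfl⟩
  have : Nontrivial Q := by
    refine ⟨⟨⟨N.mkQ z₀, z₀, hz₀, rfl⟩, 0, fun h => hz₀N ?_⟩⟩
    exact (Submodule.Quotient.mk_eq_zero _).1 (congrArg Subtype.val h)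
  obtain ⟨μ, hμ⟩ := Module.End.exists_eigenvalue (f.restrict hfQ)
  obtain ⟨⟨_, z, hz, rfl⟩, hev⟩ := hμ.exists_hasEigenvector
  have h1 : U.symm z - μ • z ∈ N := by
    have h2 : f (N.mkQ z) = μ • N.mkQ z := congrArg Subtype.val hev.apply_eq_smul
    exact (Submodule.Quotient.eq N).1 (h2 : N.mkQ (U.symm z) = N.mkQ (μ • z))
  have hzN : z ∈ cspan ℂ (seg y univ (Iic 0)) :=
    cspan_mono (seg_mono (subset_univ _) subset_rfl) hz.1
  have h3 : z ∈ N := by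
    rcases lt_or_ge ‖μ‖ 1 with h | h
    · exact mem_past_of_shift_sub_mem_of_norm_lt_one hU hind h hzN h1
    · exact mem_past_of_shift_sub_mem_of_one_le_norm hU hmix h hzN h1
  exact hev.2 (Subtype.ext ((Submodule.Quotient.mk_eq_zero _).2 h3))

end StationaryIntersection


section GramStationary

open Set

variable {V H : Type*} [NormedAddCommGroup H] [InnerProductSpace ℂ H] [CompleteSpace H]

omit [CompleteSpace H] in
lemma exists_shift_of_gram (H : Type*) [NormedAddCommGroup H] [InnerProductSpace ℂ H]
    [CompleteSpace H] {y : V → ℤ → H} (hd : cspan ℂ (seg y univ univ) = ⊤)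
    (hgram : ∀ v n w m, inner ℂ (y v (n + 1)) (y w (m + 1)) = inner ℂ (y v n) (y w m)) :
    ∃ U : H ≃ₗᵢ[ℂ] H, ∀ v n, U (y v n) = y v (n + 1) := by
  let e : (V × ℤ →₀ ℂ) →ₗ[ℂ] H := Finsupp.linearCombination ℂ fun q => y q.1 q.2
  let f : (V × ℤ →₀ ℂ) ≃ₗ[ℂ] (V × ℤ →₀ ℂ) :=
    Finsupp.domLCongr ((Equiv.refl V).prodCongr (Equiv.addRight (1 : ℤ)))
  have hf : ∀ c, e (f c) = c.sum fun q r => r • y q.1 (q.2 + 1) := by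
    intro c
    simp only [e, f, Finsupp.domLCongr_apply, Finsupp.domCongr_apply,
      Finsupp.linearCombination_equivMapDomain]
    rfl
  have hdense : DenseRange e := by
    have h1 : LinearMap.range e = Submodule.span ℂ (seg y univ univ) := by
      rw [Finsupp.range_linearCombination]
      congr 1
      ext z
      constructor
      · rintro ⟨⟨v, n⟩, rfl⟩
        exact mem_seg trivial trivial
      · rintro ⟨v, -, n, -, rfl⟩
        exact ⟨(v, n), rfl⟩
    rw [DenseRange, ← LinearMap.coe_range, h1, Submodule.dense_iff_topologicalClosure_eq_top]
    exact hd
  have hnorm : ∀ c, ‖e (f c)‖ = ‖e c‖ := by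
    intro c
    have h1 : inner ℂ (e (f c)) (e (f c)) = inner ℂ (e c) (e c) := by
      rw [hf, Finsupp.linearCombination_apply]
      simp only [Finsupp.sum, sum_inner, inner_sum, inner_smul_left, inner_smul_right, hgram]
    rw [@norm_eq_sqrt_re_inner ℂ, @norm_eq_sqrt_re_inner ℂ, h1]
  refine ⟨f.extendOfIsometry e e hdense hdense hnorm, fun v n => ?_⟩
  have h1 : y v n = e (Finsupp.single (v, n) 1) := by simp [e]
  rw [h1, LinearEquiv.extendOfIsometry_eq, hf]
  simp

omit [CompleteSpace H] in
lemma mem_cspan_val_image (K : Submodule ℂ H) (hK : IsClosed (K : Set H)) {T : Set K}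
    {z : H} :
    z ∈ cspan ℂ ((Subtype.val : K → H) '' T) ↔ ∃ w ∈ cspan ℂ T, (w : H) = z := by
  constructor
  · intro hz
    have h1 : cspan ℂ ((Subtype.val : K → H) '' T) ≤ (cspan ℂ T).map K.subtype := by
      refine cspan_le ?_ ?_
      · rw [Submodule.map_coe]
        exact hK.isClosedEmbedding_subtypeVal.isClosedMap _ (isClosed_cspan (𝕜 := ℂ) (E := K) T)
      · rintro _ ⟨w, hw, rfl⟩
        exact ⟨w, subset_cspan _ hw, rfl⟩
    exact h1 hz
  · rintro ⟨w, hw, rfl⟩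
    exact map_mem_cspan (T' := (Subtype.val : K → H) '' T) K.subtypeL
      (fun z hz => subset_cspan _ ⟨z, hz, rfl⟩) hw

lemma past_inf_past_le_of_gram [Fintype V] {y : V → ℤ → H}
    (hgram : ∀ v n w m, inner ℂ (y v (n + 1)) (y w (m + 1)) = inner ℂ (y v n) (y w m))
    (hind : ∀ c : V → ℂ, ∑ v, c v • y v 0 ∈ cspan ℂ (seg y univ (Iic (-1))) → c = 0)
    (hmix : DecayingCorrelations y) (S₁ S₂ : Set V) :
    cspan ℂ (seg y S₁ (Iic 0)) ⊓ cspan ℂ (seg y S₂ (Iic 0)) ≤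
      cspan ℂ (seg y (S₁ ∩ S₂) (Iic 0)) := by
  set K := cspan ℂ (seg y univ univ) with hKdef
  have hK : IsClosed (K : Set H) := isClosed_cspan _
  let x : V → ℤ → K := fun v n => ⟨y v n, mem_cspan_seg trivial trivial⟩
  have hx : ∀ B J, seg y B J = (Subtype.val : K → H) '' seg (E := K) x B J := by
    intro B J
    ext z
    constructor
    · rintro ⟨v, hv, n, hn, rfl⟩
      exact ⟨_, mem_seg (y := x) hv hn, rfl⟩
    · rintro ⟨_, ⟨v, hv, n, hn, rfl⟩, rfl⟩
      exact mem_seg hv hn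
  have hmem : ∀ B J (z : K), (z : H) ∈ cspan ℂ (seg y B J) ↔ z ∈ cspan ℂ (seg x B J) := by
    intro B J z
    rw [hx, mem_cspan_val_image K hK]
    constructor
    · rintro ⟨w, hw, h⟩
      rwa [← Subtype.ext h]
    · exact fun h => ⟨z, h, rfl⟩
  have hd : cspan ℂ (seg x univ univ) = ⊤ := by
    rw [eq_top_iff]
    exact fun z _ => (hmem _ _ z).1 z.2
  obtain ⟨U, hU⟩ := exists_shift_of_gram K hd (fun v n w m => hgram v n w m)
  have h1 := past_inf_past_le hU (fun c hc => hind c (by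
      have := (hmem _ _ _).2 hc
      simpa [x] using this))
    (fun ε hε => by
      obtain ⟨k, hk⟩ := hmix ε hε
      exact ⟨k, fun a ha b hb => hk a ((hmem _ _ _).2 ha) b ((hmem _ _ _).2 hb)⟩) S₁ S₂
  intro z hz
  have hzK : z ∈ K := cspan_mono (seg_mono (subset_univ _) (subset_univ _)) hz.1
  exact (hmem _ _ ⟨z, hzK⟩).2 (h1 ⟨(hmem _ _ ⟨z, hzK⟩).1 hz.1, (hmem _ _ ⟨z, hzK⟩).1 hz.2⟩)

/-- A version of `past_inf_past_le_of_gram` that allows vanishing components. -/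
theorem past_inf_past_le_of_gram' [Fintype V] {y : V → ℤ → H}
    (hgram : ∀ v n w m, inner ℂ (y v (n + 1)) (y w (m + 1)) = inner ℂ (y v n) (y w m))
    (hind : ∀ c : V → ℂ, ∑ v, c v • y v 0 ∈ cspan ℂ (seg y univ (Iic (-1))) →
      ∀ v, c v • y v 0 = 0)
    (hmix : DecayingCorrelations y) (S₁ S₂ : Set V) :
    cspan ℂ (seg y S₁ (Iic 0)) ⊓ cspan ℂ (seg y S₂ (Iic 0)) ≤
      cspan ℂ (seg y (S₁ ∩ S₂) (Iic 0)) := by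
  classical
  have hstep : ∀ v n, y v (n + 1) = 0 ↔ y v n = 0 := fun v n => by
    rw [← inner_self_eq_zero (𝕜 := ℂ), hgram, inner_self_eq_zero]
  have hzero : ∀ v n, y v n = 0 ↔ y v 0 = 0 := by
    intro v n
    induction n using Int.induction_on with
    | zero => rfl
    | succ i ih => rw [hstep, ih]
    | pred i ih => rw [← hstep, sub_add_cancel, ih]
  let W := {v // y v 0 ≠ 0}
  let x : W → ℤ → H := fun w => y w
  have hle : ∀ B J, cspan ℂ (seg x (Subtype.val ⁻¹' B) J) ≤ cspan ℂ (seg y B J) := by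
    refine fun B J => cspan_mono ?_
    rintro _ ⟨v, hv, n, hn, rfl⟩
    exact mem_seg (y := y) hv hn
  have heq : ∀ B J, cspan ℂ (seg y B J) ≤ cspan ℂ (seg x (Subtype.val ⁻¹' B) J) := by
    refine fun B J => cspan_le (isClosed_cspan _) ?_
    rintro _ ⟨v, hv, n, hn, rfl⟩
    by_cases h : y v 0 = 0
    · rw [(hzero v n).2 h]
      exact Submodule.zero_mem _
    · exact mem_cspan_seg (y := x) (v := ⟨v, h⟩) hv hn
  have h1 := past_inf_past_le_of_gram (y := x) (fun v n w m => hgram v n w m) (fun c hc => by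
      have h2 : ∑ w, c w • x w 0 = ∑ v, Function.extend Subtype.val c 0 v • y v 0 := by
        refine Fintype.sum_of_injective Subtype.val Subtype.val_injective _ _ ?_ ?_
        · intro v hv
          rw [Function.extend_apply' _ _ _ (by simpa using hv)]
          simp
        · intro w
          rw [Subtype.val_injective.extend_apply]
      rw [h2] at hc
      funext w
      have h3 := hind _ (hle univ _ hc) w
      rw [Subtype.val_injective.extend_apply] at h3
      exact (smul_eq_zero.1 h3).resolve_right w.2)
    (fun ε hε => by
      obtain ⟨k, hk⟩ := hmix ε hε
      exact ⟨k, fun a ha b hb => hk a (hle univ _ ha) b (hle univ _ hb)⟩)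
    (Subtype.val ⁻¹' S₁) (Subtype.val ⁻¹' S₂)
  exact fun z hz => hle _ _ (h1 ⟨heq _ _ hz.1, heq _ _ hz.2⟩)

end GramStationary

section RealStationary

open Set

variable {V : Type*} [MeasurableSpace Ω] {μ : Measure Ω}

/-- The inclusion of real into complex square integrable functions. -/
def complexify (μ : Measure Ω) : Lp ℝ 2 μ →L[ℝ] Lp ℂ 2 μ := Complex.ofRealCLM.compLpL 2 μ

/-- The real part of a complex square integrable function. -/
def realPart (μ : Measure Ω) : Lp ℂ 2 μ →L[ℝ] Lp ℝ 2 μ := Complex.reCLM.compLpL 2 μ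

/-- The imaginary part of a complex square integrable function. -/
def imagPart (μ : Measure Ω) : Lp ℂ 2 μ →L[ℝ] Lp ℝ 2 μ := Complex.imCLM.compLpL 2 μ

lemma coeFn_complexify (z : Lp ℝ 2 μ) : complexify μ z =ᵐ[μ] fun ω => (z ω : ℂ) :=
  Complex.ofRealCLM.coeFn_compLpL z

lemma coeFn_realPart (z : Lp ℂ 2 μ) : realPart μ z =ᵐ[μ] fun ω => (z ω).re :=
  Complex.reCLM.coeFn_compLpL z

lemma coeFn_imagPart (z : Lp ℂ 2 μ) : imagPart μ z =ᵐ[μ] fun ω => (z ω).im :=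
  Complex.imCLM.coeFn_compLpL z

lemma complexify_decomp (z : Lp ℂ 2 μ) :
    z = complexify μ (realPart μ z) + Complex.I • complexify μ (imagPart μ z) := by
  refine Lp.ext ?_
  filter_upwards [coeFn_realPart z, coeFn_imagPart z, coeFn_complexify (realPart μ z),
    coeFn_complexify (imagPart μ z), Lp.coeFn_add (complexify μ (realPart μ z))
      (Complex.I • complexify μ (imagPart μ z)),
    Lp.coeFn_smul Complex.I (complexify μ (imagPart μ z))] with ω h1 h2 h3 h4 h5 h6
  rw [h5, Pi.add_apply, h6, Pi.smul_apply, h3, h4, h1, h2, smul_eq_mul, mul_comm]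
  exact (Complex.re_add_im _).symm

lemma realPart_smul_complexify (c : ℂ) (z : Lp ℝ 2 μ) :
    realPart μ (c • complexify μ z) = c.re • z := by
  refine Lp.ext ?_
  filter_upwards [coeFn_realPart (c • complexify μ z), coeFn_complexify z,
    Lp.coeFn_smul c (complexify μ z), Lp.coeFn_smul c.re z] with ω h1 h2 h3 h4
  simp [h1, h2, h3, h4]

lemma imagPart_smul_complexify (c : ℂ) (z : Lp ℝ 2 μ) :
    imagPart μ (c • complexify μ z) = c.im • z := by
  refine Lp.ext ?_
  filter_upwards [coeFn_imagPart (c • complexify μ z), coeFn_complexify z,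
    Lp.coeFn_smul c (complexify μ z), Lp.coeFn_smul c.im z] with ω h1 h2 h3 h4
  simp [h1, h2, h3, h4]

lemma realPart_smul (c : ℂ) (z : Lp ℂ 2 μ) :
    realPart μ (c • z) = c.re • realPart μ z - c.im • imagPart μ z := by
  conv_lhs => rw [complexify_decomp z, smul_add, smul_smul, map_add]
  simp [realPart_smul_complexify, sub_eq_add_neg]

lemma imagPart_smul (c : ℂ) (z : Lp ℂ 2 μ) :
    imagPart μ (c • z) = c.im • realPart μ z + c.re • imagPart μ z := by
  conv_lhs => rw [complexify_decomp z, smul_add, smul_smul, map_add]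
  simp [imagPart_smul_complexify]

lemma inner_complexify (z w : Lp ℝ 2 μ) :
    inner ℂ (complexify μ z) (complexify μ w) = ((inner ℝ z w : ℝ) : ℂ) := by
  rw [L2.inner_def, L2.inner_def, ← integral_complex_ofReal]
  refine integral_congr_ae ?_
  filter_upwards [coeFn_complexify z, coeFn_complexify w] with ω h1 h2
  simp [h1, h2]

lemma norm_realPart_le (z : Lp ℂ 2 μ) : ‖realPart μ z‖ ≤ ‖z‖ := by
  refine Lp.norm_le_norm_of_ae_le ?_
  filter_upwards [coeFn_realPart z] with ω h
  rw [h]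
  exact Complex.abs_re_le_norm _

lemma norm_imagPart_le (z : Lp ℂ 2 μ) : ‖imagPart μ z‖ ≤ ‖z‖ := by
  refine Lp.norm_le_norm_of_ae_le ?_
  filter_upwards [coeFn_imagPart z] with ω h
  rw [h]
  exact Complex.abs_im_le_norm _

lemma realPart_imagPart_mem {T : Set (Lp ℝ 2 μ)} {z : Lp ℂ 2 μ}
    (hz : z ∈ cspan ℂ (complexify μ '' T)) :
    realPart μ z ∈ cspan ℝ T ∧ imagPart μ z ∈ cspan ℝ T := by
  let L : Submodule ℂ (Lp ℂ 2 μ) :=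
    { carrier := {z | realPart μ z ∈ cspan ℝ T ∧ imagPart μ z ∈ cspan ℝ T}
      add_mem' := fun ha hb => by
        simp only [mem_ofPred_eq, map_add]
        exact ⟨Submodule.add_mem _ ha.1 hb.1, Submodule.add_mem _ ha.2 hb.2⟩
      zero_mem' := by simp
      smul_mem' := fun c a ha => by
        simp only [mem_ofPred_eq, realPart_smul, imagPart_smul]
        exact ⟨Submodule.sub_mem _ (Submodule.smul_mem _ _ ha.1) (Submodule.smul_mem _ _ ha.2),
          Submodule.add_mem _ (Submodule.smul_mem _ _ ha.1) (Submodule.smul_mem _ _ ha.2)⟩ }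
  have hL : IsClosed (L : Set (Lp ℂ 2 μ)) :=
    ((isClosed_cspan T).preimage (realPart μ).continuous).inter
      ((isClosed_cspan T).preimage (imagPart μ).continuous)
  refine (cspan_le hL ?_ : cspan ℂ (complexify μ '' T) ≤ L) hz
  rintro _ ⟨w, hw, rfl⟩
  have h1 := realPart_smul_complexify 1 w
  have h2 := imagPart_smul_complexify 1 w
  simp only [one_smul, Complex.one_re, Complex.one_im, zero_smul] at h1 h2
  change realPart μ _ ∈ _ ∧ imagPart μ _ ∈ _
  rw [h1, h2]
  exact ⟨subset_cspan _ hw, Submodule.zero_mem _⟩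

lemma complexify_mem {T : Set (Lp ℝ 2 μ)} {z : Lp ℝ 2 μ} (hz : z ∈ cspan ℝ T) :
    complexify μ z ∈ cspan ℂ (complexify μ '' T) := by
  have h1 : cspan ℝ T ≤ ((cspan ℂ (complexify μ '' T)).restrictScalars ℝ).comap
      (complexify μ : Lp ℝ 2 μ →ₗ[ℝ] Lp ℂ 2 μ) :=
    cspan_le ((isClosed_cspan (complexify μ '' T)).preimage (complexify μ).continuous)
      fun w hw => subset_cspan _ ⟨w, hw, rfl⟩
  exact h1 hz

/-- The intersection of the pasts of two subprocesses of a real stationary process. -/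
theorem real_past_inf_past_le [Fintype V] {x : V → ℤ → Lp ℝ 2 μ} (t : ℤ)
    (hgram : ∀ v n w m, inner ℝ (x v (n + 1)) (x w (m + 1)) = inner ℝ (x v n) (x w m))
    (hind : ∀ c : V → ℝ, ∑ v, c v • x v t ∈ cspan ℝ (seg x univ (Iic (t - 1))) →
      ∀ v, c v • x v t = 0)
    (hmix : ∀ ε > (0 : ℝ), ∃ k : ℕ, ∀ a ∈ cspan ℝ (seg x univ (Iic t)),
      ∀ b ∈ cspan ℝ (seg x univ (Ici (t + k))), |inner ℝ a b| ≤ ε * ‖a‖ * ‖b‖)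
    (S₁ S₂ : Set V) :
    cspan ℝ (seg x S₁ (Iic t)) ⊓ cspan ℝ (seg x S₂ (Iic t)) ≤
      cspan ℝ (seg x (S₁ ∩ S₂) (Iic t)) := by
  let y : V → ℤ → Lp ℂ 2 μ := fun v n => complexify μ (x v (n + t))
  have hseg : ∀ (B : Set V) (J J' : Set ℤ), (∀ n, n + t ∈ J' ↔ n ∈ J) →
      seg y B J = complexify μ '' seg x B J' := by
    intro B J J' hJ
    ext z
    constructor
    · rintro ⟨v, hv, n, hn, rfl⟩
      exact ⟨_, mem_seg hv ((hJ n).2 hn), rfl⟩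
    · rintro ⟨_, ⟨v, hv, n, hn, rfl⟩, rfl⟩
      refine ⟨v, hv, n - t, (hJ _).1 (by simpa using hn), ?_⟩
      simp [y]
  have hpast : ∀ B, seg y B (Iic 0) = complexify μ '' seg x B (Iic t) := fun B =>
    hseg B _ _ fun n => by simp
  have h1 := past_inf_past_le_of_gram' (y := y)
    (fun v n w m => by
      simp only [y, inner_complexify, add_right_comm _ (1 : ℤ) t, hgram])
    (fun c hc v => by
      rw [hseg univ (Iic (-1)) (Iic (t - 1)) (fun n => by simp; omega)] at hc
      have h2 := realPart_imagPart_mem hc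
      simp only [y, map_sum, realPart_smul_complexify, imagPart_smul_complexify, zero_add] at h2
      have h3 := hind _ h2.1 v
      have h4 := hind _ h2.2 v
      simp only [y, zero_add]
      rw [complexify_decomp (c v • complexify μ (x v t)), realPart_smul_complexify,
        imagPart_smul_complexify, h3, h4]
      simp)
    (fun ε hε => by
      obtain ⟨k, hk⟩ := hmix (ε / 4) (by positivity)
      refine ⟨k, fun a ha b hb => ?_⟩
      rw [hpast] at ha
      rw [hseg univ (Ici (k : ℤ)) (Ici (t + k)) (fun n => by simp; omega)] at hb
      obtain ⟨ha1, ha2⟩ := realPart_imagPart_mem ha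
      obtain ⟨hb1, hb2⟩ := realPart_imagPart_mem hb
      have hb' : ∀ p ∈ cspan ℝ (seg x univ (Iic t)), ∀ q ∈ cspan ℝ (seg x univ (Ici (t + k))),
          ‖p‖ ≤ ‖a‖ → ‖q‖ ≤ ‖b‖ → ‖((inner ℝ p q : ℝ) : ℂ)‖ ≤ ε / 4 * ‖a‖ * ‖b‖ := by
        intro p hp q hq hpa hqb
        rw [Complex.norm_real, Real.norm_eq_abs]
        refine (hk p hp q hq).trans ?_
        gcongr
      have e1 := hb' _ ha1 _ hb1 (norm_realPart_le a) (norm_realPart_le b)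
      have e2 := hb' _ ha1 _ hb2 (norm_realPart_le a) (norm_imagPart_le b)
      have e3 := hb' _ ha2 _ hb1 (norm_imagPart_le a) (norm_realPart_le b)
      have e4 := hb' _ ha2 _ hb2 (norm_imagPart_le a) (norm_imagPart_le b)
      rw [complexify_decomp a, complexify_decomp b, inner_add_left, inner_add_right,
        inner_add_right, inner_smul_left, inner_smul_left, inner_smul_right, inner_smul_right,
        inner_complexify, inner_complexify, inner_complexify, inner_complexify,
        ← complexify_decomp a, ← complexify_decomp b]
      refine (norm_add_le _ _).trans ((add_le_add (norm_add_le _ _) (norm_add_le _ _)).trans ?_)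
      simp only [norm_mul, RCLike.norm_conj, Complex.norm_I, one_mul]
      linarith)
    S₁ S₂
  intro z hz
  have h2 := h1 (x := complexify μ z) ⟨by rw [hpast]; exact complexify_mem hz.1,
    by rw [hpast]; exact complexify_mem hz.2⟩
  rw [hpast] at h2
  have h3 := (realPart_imagPart_mem h2).1
  have h4 := realPart_smul_complexify 1 z
  simp only [one_smul, Complex.one_re] at h4
  rwa [h4] at h3

end RealStationary

/-! ### Centered Gaussian subspaces of `L²` -/

section GaussianSubspace

variable [MeasurableSpace Ω] {μ : Measure Ω}

/-- Every element of the submodule has a centered Gaussian law. -/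
def IsGaussianSubspace (M : Submodule ℝ (Lp ℝ 2 μ)) : Prop :=
  ∀ y ∈ M, HasGaussianLaw y μ ∧ ∫ ω, y ω ∂μ = 0

lemma integrable_of_L2 [IsFiniteMeasure μ] (y : Lp ℝ 2 μ) : Integrable y μ :=
  (Lp.memLp y).integrable (by norm_num)

lemma variance_eq_norm_sq [IsProbabilityMeasure μ] {y : Lp ℝ 2 μ} (h : ∫ ω, y ω ∂μ = 0) :
    Var[y; μ] = ‖y‖ ^ 2 := by
  rw [variance_of_integral_eq_zero (Lp.aestronglyMeasurable y).aemeasurable h,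
    ← real_inner_self_eq_norm_sq, L2.inner_def]
  simp [sq]

lemma covariance_eq_inner [IsProbabilityMeasure μ] {y z : Lp ℝ 2 μ} (hy : ∫ ω, y ω ∂μ = 0)
    (hz : ∫ ω, z ω ∂μ = 0) : cov[y, z; μ] = inner ℝ y z := by
  rw [covariance_eq_sub (Lp.memLp y) (Lp.memLp z), hy, hz, L2.inner_def]
  simp [mul_comm]

lemma tendsto_integral_cexp [IsProbabilityMeasure μ] {y : ℕ → Lp ℝ 2 μ} {z : Lp ℝ 2 μ}
    (h : Tendsto y atTop (nhds z))
    (hy : ∀ n, ∫ ω, Complex.exp (y n ω * Complex.I) ∂μ = Real.exp (-‖y n‖ ^ 2 / 2)) :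
    ∫ ω, Complex.exp (z ω * Complex.I) ∂μ = Real.exp (-‖z‖ ^ 2 / 2) := by
  obtain ⟨ns, hns, hae⟩ := (tendstoInMeasure_of_tendsto_Lp h).exists_seq_tendsto_ae
  have h1 : Tendsto (fun n => ∫ ω, Complex.exp (y (ns n) ω * Complex.I) ∂μ) atTop
      (nhds (∫ ω, Complex.exp (z ω * Complex.I) ∂μ)) := by
    refine tendsto_integral_of_dominated_convergence (fun _ => 1) (fun n => ?_)
      (integrable_const _) (fun n => ?_) ?_
    · have := (Lp.aestronglyMeasurable (y (ns n)))
      exact (by fun_prop : Continuous fun r : ℝ =>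
        Complex.exp (r * Complex.I)).comp_aestronglyMeasurable this
    · exact Eventually.of_forall fun ω => (Complex.norm_exp_ofReal_mul_I _).le
    · filter_upwards [hae] with ω hω
      exact ((by fun_prop : Continuous fun r : ℝ =>
        Complex.exp (r * Complex.I)).tendsto _).comp hω
  have h2 : Tendsto (fun n => ((Real.exp (-‖y (ns n)‖ ^ 2 / 2) : ℝ) : ℂ)) atTop
      (nhds ((Real.exp (-‖z‖ ^ 2 / 2) : ℝ) : ℂ)) :=
    ((by fun_prop : Continuous fun w : Lp ℝ 2 μ =>
      ((Real.exp (-‖w‖ ^ 2 / 2) : ℝ) : ℂ)).tendsto z).comp (h.comp hns.tendsto_atTop)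
  simp only [hy] at h1
  exact tendsto_nhds_unique h1 h2

lemma integral_cexp_of_hasGaussianLaw [IsProbabilityMeasure μ] {y : Lp ℝ 2 μ}
    (h : HasGaussianLaw y μ) (h0 : ∫ ω, y ω ∂μ = 0) :
    ∫ ω, Complex.exp (y ω * Complex.I) ∂μ = Real.exp (-‖y‖ ^ 2 / 2) := by
  have h1 := charFun_gaussianReal (μ := 0) (v := (‖y‖ ^ 2).toNNReal) 1
  have h2 := h.map_eq_gaussianReal
  rw [h0, variance_eq_norm_sq h0] at h2
  rw [← h2, charFun_apply_real,
    integral_map (Lp.aestronglyMeasurable y).aemeasurable (by fun_prop),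
    Real.coe_toNNReal _ (by positivity)] at h1
  simp only [Complex.ofReal_one, one_mul] at h1
  rw [h1]
  push_cast
  congr 1
  ring

lemma map_eq_gaussianReal_of_integral_cexp [IsProbabilityMeasure μ] {y : Lp ℝ 2 μ}
    (h : ∀ c : ℝ, ∫ ω, Complex.exp ((c • y : Lp ℝ 2 μ) ω * Complex.I) ∂μ =
      Real.exp (-‖c • y‖ ^ 2 / 2)) :
    μ.map y = gaussianReal 0 (‖y‖ ^ 2).toNNReal := by
  have := Measure.isProbabilityMeasure_map (μ := μ) (Lp.aestronglyMeasurable y).aemeasurable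
  refine Measure.ext_of_charFun (funext fun c => ?_)
  rw [charFun_gaussianReal, charFun_apply_real,
    integral_map (Lp.aestronglyMeasurable y).aemeasurable (by fun_prop)]
  have h1 : ∫ ω, Complex.exp ((c • y : Lp ℝ 2 μ) ω * Complex.I) ∂μ =
      ∫ ω, Complex.exp (c * y ω * Complex.I) ∂μ := by
    refine integral_congr_ae ?_
    filter_upwards [Lp.coeFn_smul c y] with ω hω
    rw [hω]
    simp
  rw [← h1, h c, Real.coe_toNNReal _ (by positivity), norm_smul]
  push_cast
  congr 1
  simp only [Real.norm_eq_abs, mul_pow]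
  rw [← Complex.ofReal_pow |c|, sq_abs]
  push_cast
  ring

lemma isGaussianSubspace_cspan [IsProbabilityMeasure μ] {T : Set (Lp ℝ 2 μ)}
    (h : IsGaussianSubspace (Submodule.span ℝ T)) : IsGaussianSubspace (cspan ℝ T) := by
  have key : ∀ y ∈ cspan ℝ T,
      ∫ ω, Complex.exp (y ω * Complex.I) ∂μ = Real.exp (-‖y‖ ^ 2 / 2) := by
    intro y hy
    obtain ⟨u, hu, hlim⟩ := mem_closure_iff_seq_limit.1
      (show y ∈ closure (Submodule.span ℝ T : Set (Lp ℝ 2 μ)) from hy)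
    exact tendsto_integral_cexp hlim fun n =>
      integral_cexp_of_hasGaussianLaw (h _ (hu n)).1 (h _ (hu n)).2
  intro y hy
  have hmap := map_eq_gaussianReal_of_integral_cexp fun c =>
    key (c • y) (Submodule.smul_mem _ c hy)
  refine ⟨⟨by rw [hmap]; infer_instance⟩, ?_⟩
  have := integral_map (μ := μ) (φ := y) (f := fun r : ℝ => r)
    (Lp.aestronglyMeasurable y).aemeasurable (by fun_prop)
  rw [← this, hmap, integral_id_gaussianReal]

/-- Any family in a Gaussian subspace is a Gaussian process. -/
lemma IsGaussianSubspace.isGaussianProcess [IsProbabilityMeasure μ] {M : Submodule ℝ (Lp ℝ 2 μ)}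
    (hM : IsGaussianSubspace M) {ι : Type*} {y : ι → Lp ℝ 2 μ} (hy : ∀ i, y i ∈ M) :
    IsGaussianProcess (fun i ω => y i ω) μ := by
  refine ⟨fun I => ⟨isGaussian_of_isGaussian_map fun L => ?_⟩⟩
  classical
  have hmeas : AEMeasurable (fun ω => I.restrict (fun i => y i ω)) μ :=
    aemeasurable_pi_lambda _ fun i => (Lp.aestronglyMeasurable (y i)).aemeasurable
  rw [AEMeasurable.map_map_of_aemeasurable (by fun_prop) hmeas]
  have hz : (∑ i : I, L (Pi.single i 1) • y i) ∈ M :=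
    Submodule.sum_mem _ fun i _ => Submodule.smul_mem _ _ (hy i)
  refine ((hM _ hz).1.congr ?_).isGaussian_map
  have h1 : ∀ᵐ ω ∂μ, ∀ i : I, (L (Pi.single i 1) • y i : Lp ℝ 2 μ) ω =
      L (Pi.single i 1) * y i ω := by
    rw [ae_all_iff]
    intro i
    filter_upwards [Lp.coeFn_smul (L (Pi.single i 1)) (y i)] with ω hω
    rw [hω]
    simp
  filter_upwards [h1, Lp.coeFn_finsetSum Finset.univ
    fun i : I => (L (Pi.single i 1) • y i : Lp ℝ 2 μ)] with ω h1 h2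
  rw [h2]
  simp only [Finset.sum_apply, Function.comp_apply, h1]
  have h3 : I.restrict (fun i => y i ω) =
      ∑ i : I, (y i ω) • (Pi.single i (1 : ℝ) : I → ℝ) := by
    ext j
    simp [Finset.sum_apply, Pi.single_apply]
  rw [h3, map_sum]
  exact Finset.sum_congr rfl fun i _ => by rw [map_smul, smul_eq_mul, mul_comm]

end GaussianSubspace

/-! ### The centered process -/

section Centered

variable {V : Type*} [MeasurableSpace Ω] {μ : Measure Ω}

lemma hasGaussianLaw_sub_const {f : Ω → ℝ} (hf : HasGaussianLaw f μ) (r : ℝ) :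
    HasGaussianLaw (fun ω => f ω - r) μ := by
  have := hf.isGaussian_map
  refine ⟨?_⟩
  have h : μ.map (fun ω => f ω - r) = (μ.map f).map (fun y => y - r) := by
    rw [AEMeasurable.map_map_of_aemeasurable (by fun_prop) hf.aemeasurable]
    rfl
  rw [h]
  infer_instance

lemma Stationary.integral_eq {X : V → ℤ → Ω → ℝ} (hX : ∀ v t, Measurable (X v t))
    (hS : Stationary μ X) (t : ℤ) {g : (ℤ × V → ℝ) → ℝ} (hg : Measurable g) :
    ∫ ω, g (fun q => X q.2 (t + q.1) ω) ∂μ = ∫ ω, g (fun q => X q.2 q.1 ω) ∂μ := by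
  rw [← integral_map (μ := μ) (φ := fun ω => fun q : ℤ × V => X q.2 (t + q.1) ω)
      (measurable_pi_lambda _ fun q => hX _ _).aemeasurable hg.aestronglyMeasurable, hS t,
    integral_map (measurable_pi_lambda _ fun q => hX _ _).aemeasurable hg.aestronglyMeasurable]

lemma exists_centered [IsProbabilityMeasure μ] {X : V → ℤ → Ω → ℝ}
    (hX : ∀ v t, Measurable (X v t)) (hS : Stationary μ X)
    (hG : ∀ (n : ℕ) (v : Fin n → V) (s : Fin n → ℤ) (c : Fin n → ℝ),
      ∃ (m : ℝ) (σ2 : NNReal),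
        Measure.map (fun ω => ∑ i, c i * X (v i) (s i) ω) μ = gaussianReal m σ2) :
    ∃ (m : V → ℝ) (x : V → ℤ → Lp ℝ 2 μ),
      (∀ v t, x v t =ᵐ[μ] fun ω => X v t ω - m v) ∧
      IsGaussianSubspace (cspan ℝ (seg x Set.univ Set.univ)) ∧
      ∀ v n w k, inner ℝ (x v (n + 1)) (x w (k + 1)) = inner ℝ (x v n) (x w k) := by
  have hlaw : ∀ (n : ℕ) (v : Fin n → V) (s : Fin n → ℤ) (c : Fin n → ℝ),
      HasGaussianLaw (fun ω => ∑ i, c i * X (v i) (s i) ω) μ := by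
    intro n v s c
    obtain ⟨m, σ2, h⟩ := hG n v s c
    exact ⟨by rw [h]; infer_instance⟩
  have hL2 : ∀ v t, MemLp (X v t) 2 μ := fun v t => by
    simpa using (hlaw 1 (fun _ => v) (fun _ => t) (fun _ => 1)).memLp_two
  have hmean : ∀ v t, ∫ ω, X v t ω ∂μ = ∫ ω, X v 0 ω ∂μ := fun v t => by
    simpa using hS.integral_eq hX t (measurable_pi_apply ((0 : ℤ), v))
  let m : V → ℝ := fun v => ∫ ω, X v 0 ω ∂μ
  let x : V → ℤ → Lp ℝ 2 μ := fun v t => ((hL2 v t).sub (memLp_const (m v))).toLp _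
  have hx : ∀ v t, x v t =ᵐ[μ] fun ω => X v t ω - m v := fun v t => MemLp.coeFn_toLp _
  refine ⟨m, x, hx, isGaussianSubspace_cspan ?_, ?_⟩
  · intro y hy
    obtain ⟨n, c, g, rfl⟩ := Submodule.mem_span_set'.1 hy
    choose v _ s _ hvs using fun i => (g i).2
    have hae : (∑ i, c i • (g i : Lp ℝ 2 μ) : Lp ℝ 2 μ) =ᵐ[μ]
        fun ω => ∑ i, c i * X (v i) (s i) ω - ∑ i, c i * m (v i) := by
      have h1 : ∀ᵐ ω ∂μ, ∀ i, (c i • (g i : Lp ℝ 2 μ) : Lp ℝ 2 μ) ω =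
          c i * (X (v i) (s i) ω - m (v i)) := by
        rw [ae_all_iff]
        intro i
        filter_upwards [Lp.coeFn_smul (c i) (g i : Lp ℝ 2 μ), hx (v i) (s i)] with ω h1 h2
        rw [h1, Pi.smul_apply, ← hvs i, h2, smul_eq_mul]
      filter_upwards [h1, Lp.coeFn_finsetSum Finset.univ
        fun i => (c i • (g i : Lp ℝ 2 μ) : Lp ℝ 2 μ)] with ω h1 h2
      rw [h2, Finset.sum_apply, ← Finset.sum_sub_distrib]
      exact Finset.sum_congr rfl fun i _ => by rw [h1 i, mul_sub]
    refine ⟨(hasGaussianLaw_sub_const (hlaw n v s c) _).congr hae.symm, ?_⟩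
    have hi : ∀ v t, Integrable (X v t) μ := fun v t => (hL2 v t).integrable (by norm_num)
    rw [integral_congr_ae hae, integral_sub (integrable_finsetSum _ fun i _ =>
      (hi _ _).const_mul _) (integrable_const _), integral_finsetSum _ fun i _ =>
      (hi _ _).const_mul _]
    simp [integral_const_mul, hmean, m]
  · intro v n w k
    have h : ∀ v n w k, inner ℝ (x v n) (x w k) =
        ∫ ω, (X v n ω - m v) * (X w k ω - m w) ∂μ := by
      intro v n w k
      rw [L2.inner_def]
      refine integral_congr_ae ?_
      filter_upwards [hx v n, hx w k] with ω h1 h2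
      simp [h1, h2, mul_comm]
    rw [h, h]
    have := hS.integral_eq hX 1 (g := fun f => (f (n, v) - m v) * (f (k, w) - m w))
      (by fun_prop)
    simpa [add_comm] using this

end Centered

/-! ### Strong mixing bounds correlations -/

section Mixing

lemma aestronglyMeasurable_of_mem_cspan {m m₀ : MeasurableSpace Ω} {μ : Measure Ω} (hm : m ≤ m₀)
    {T : Set (Lp ℝ 2 μ)} (hT : ∀ y ∈ T, AEStronglyMeasurable[m] y μ) {y : Lp ℝ 2 μ}
    (hy : y ∈ cspan ℝ T) : AEStronglyMeasurable[m] y μ := by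
  have : Fact (m ≤ m₀) := ⟨hm⟩
  have h : cspan ℝ T ≤ lpMeas ℝ ℝ m 2 μ :=
    cspan_le (isClosed_aestronglyMeasurable hm) fun z hz =>
      mem_lpMeas_iff_aestronglyMeasurable.2 (hT z hz)
  exact mem_lpMeas_iff_aestronglyMeasurable.1 (h hy)

lemma abs_integral_mul_le {m m₀ : MeasurableSpace Ω} {μ : Measure Ω} [IsFiniteMeasure μ]
    (hm : m ≤ m₀) {g h : Ω → ℝ} {c : ℝ} (hh : Integrable h μ) (hg : StronglyMeasurable[m] g)
    (hg1 : ∀ ω, |g ω| ≤ 1) (hc : ∀ A, MeasurableSet[m] A → |∫ ω in A, h ω ∂μ| ≤ c) :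
    |∫ ω, g ω * h ω ∂μ| ≤ 2 * c := by
  have h1 : ∫ ω, g ω * h ω ∂μ = ∫ ω, g ω * (μ[h | m]) ω ∂μ := by
    rw [← integral_condExp hm]
    refine integral_congr_ae ?_
    exact condExp_stronglyMeasurable_mul_of_bound hm hg hh 1 (Eventually.of_forall hg1)
  have hA : MeasurableSet[m] {ω | 0 ≤ (μ[h | m]) ω} :=
    measurableSet_le measurable_const stronglyMeasurable_condExp.measurable
  calc |∫ ω, g ω * h ω ∂μ| ≤ ∫ ω, |(μ[h | m]) ω| ∂μ := by
        rw [h1]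
        refine (abs_integral_le_integral_abs).trans (integral_mono_of_nonneg
          (Eventually.of_forall fun _ => abs_nonneg _) integrable_condExp.abs
          (Eventually.of_forall fun ω => ?_))
        simp only [abs_mul]
        exact mul_le_of_le_one_left (abs_nonneg _) (hg1 ω)
    _ = ∫ ω in {ω | 0 ≤ (μ[h | m]) ω}, h ω ∂μ - ∫ ω in {ω | 0 ≤ (μ[h | m]) ω}ᶜ, h ω ∂μ := by
        rw [← setIntegral_condExp hm hh hA, ← setIntegral_condExp hm hh hA.compl,
          ← integral_add_compl (hm _ hA) integrable_condExp.abs, sub_eq_add_neg, ← integral_neg]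
        congr 1
        · exact setIntegral_congr_fun (hm _ hA) fun ω hω => abs_of_nonneg hω
        · exact setIntegral_congr_fun (hm _ hA.compl) fun ω hω => abs_of_neg (not_le.1 hω)
    _ ≤ 2 * c := by
        have h2 := abs_le.1 (hc _ hA)
        have h3 := abs_le.1 (hc _ hA.compl)
        linarith

lemma abs_integral_mul_sub_le {m₁ m₂ m₀ : MeasurableSpace Ω} {μ : Measure Ω}
    [IsProbabilityMeasure μ] (hm₁ : m₁ ≤ m₀) (hm₂ : m₂ ≤ m₀) {f g : Ω → ℝ} {α : ℝ}
    (hα : ∀ A B, MeasurableSet[m₁] A → MeasurableSet[m₂] B →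
      |μ.real (A ∩ B) - μ.real A * μ.real B| ≤ α)
    (hf : StronglyMeasurable[m₁] f) (hf1 : ∀ ω, |f ω| ≤ 1)
    (hg : StronglyMeasurable[m₂] g) (hg1 : ∀ ω, |g ω| ≤ 1) :
    |∫ ω, f ω * g ω ∂μ - (∫ ω, f ω ∂μ) * ∫ ω, g ω ∂μ| ≤ 4 * α := by
  have hfi : Integrable f μ :=
    Integrable.of_bound (hf.mono hm₁).aestronglyMeasurable 1 (Eventually.of_forall hf1)
  have hgi : Integrable g μ :=
    Integrable.of_bound (hg.mono hm₂).aestronglyMeasurable 1 (Eventually.of_forall hg1)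
  have hfgi : Integrable (fun ω => g ω * f ω) μ :=
    hfi.bdd_mul (c := 1) (hg.mono hm₂).aestronglyMeasurable (Eventually.of_forall hg1)
  have key : ∀ B, MeasurableSet[m₂] B → |∫ ω in B, (f ω - ∫ ω, f ω ∂μ) ∂μ| ≤ 2 * α := by
    intro B hB
    have hB0 := hm₂ _ hB
    have hBi : Integrable (B.indicator fun _ => (1 : ℝ)) μ := (integrable_const 1).indicator hB0
    have h1 : ∫ ω in B, (f ω - ∫ ω, f ω ∂μ) ∂μ =
        ∫ ω, f ω * (B.indicator (fun _ => (1 : ℝ)) ω - μ.real B) ∂μ := by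
      have h2 : ∀ ω, f ω * (B.indicator (fun _ => (1 : ℝ)) ω - μ.real B) =
          B.indicator f ω - f ω * μ.real B := by
        intro ω
        by_cases hω : ω ∈ B <;> simp [hω, mul_sub]
      simp_rw [h2]
      rw [integral_sub hfi.integrableOn (integrable_const _), integral_sub
        (hfi.indicator hB0) (hfi.mul_const _), integral_indicator hB0, integral_mul_const]
      simp [mul_comm]
    rw [h1]
    refine abs_integral_mul_le hm₁ (hBi.sub (integrable_const _)) hf hf1 fun A hA => ?_
    refine le_of_eq_of_le ?_ (hα A B hA hB)
    rw [integral_sub hBi.integrableOn (integrable_const _), setIntegral_indicator hB0]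
    simp
  have h3 := abs_integral_mul_le hm₂ (hfi.sub (integrable_const _)) hg hg1 key
  have h4 : ∫ ω, g ω * (f ω - ∫ ω, f ω ∂μ) ∂μ =
      ∫ ω, f ω * g ω ∂μ - (∫ ω, f ω ∂μ) * ∫ ω, g ω ∂μ := by
    simp only [mul_sub]
    rw [integral_sub hfgi (hgi.mul_const _), integral_mul_const]
    simp only [mul_comm]
  change |∫ ω, g ω * (f ω - ∫ ω, f ω ∂μ) ∂μ| ≤ _ at h3
  rw [h4] at h3
  linarith

variable {m₀ : MeasurableSpace Ω} {μ : Measure Ω} [IsProbabilityMeasure μ]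

lemma IsGaussianSubspace.integral_cos_sin {M : Submodule ℝ (Lp ℝ 2 μ)}
    (hM : IsGaussianSubspace M) {y : Lp ℝ 2 μ} (hy : y ∈ M) :
    ∫ ω, Real.cos (y ω) ∂μ = Real.exp (-‖y‖ ^ 2 / 2) ∧ ∫ ω, Real.sin (y ω) ∂μ = 0 := by
  have h := integral_cexp_of_hasGaussianLaw (hM y hy).1 (hM y hy).2
  have hi : Integrable (fun ω => Complex.exp (y ω * Complex.I)) μ :=
    Integrable.of_bound ((by fun_prop : Continuous fun r : ℝ =>
        Complex.exp (r * Complex.I)).comp_aestronglyMeasurable (Lp.aestronglyMeasurable y)) 1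
      (Eventually.of_forall fun ω => (Complex.norm_exp_ofReal_mul_I _).le)
  constructor
  · have := congrArg Complex.re h
    rw [Complex.ofReal_re, ← RCLike.re_eq_complex_re, ← integral_re hi] at this
    rw [← this]
    simp [Complex.exp_ofReal_mul_I_re]
  · have := congrArg Complex.im h
    rw [Complex.ofReal_im, ← RCLike.im_eq_complex_im, ← integral_im hi] at this
    rw [← this]
    simp [Complex.exp_ofReal_mul_I_im]

lemma IsGaussianSubspace.inner_le_of_unit {m₁ m₂ m₀ : MeasurableSpace Ω} {μ : Measure Ω}
    [IsProbabilityMeasure μ] {M : Submodule ℝ (Lp ℝ 2 μ)} (hM : IsGaussianSubspace M)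
    (hm₁ : m₁ ≤ m₀) (hm₂ : m₂ ≤ m₀) {α : ℝ}
    (hα : ∀ A B, MeasurableSet[m₁] A → MeasurableSet[m₂] B →
      |μ.real (A ∩ B) - μ.real A * μ.real B| ≤ α)
    {a b : Lp ℝ 2 μ} (ha : a ∈ M) (hb : b ∈ M) (ha1 : AEStronglyMeasurable[m₁] a μ)
    (hb1 : AEStronglyMeasurable[m₂] b μ) (hna : ‖a‖ = 1) (hnb : ‖b‖ = 1) :
    inner ℝ a b ≤ 24 * α := by
  have hcc : ∀ {u : ℝ → ℝ}, Continuous u → (∀ r, |u r| ≤ 1) →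
      |∫ ω, u (a ω) * u (b ω) ∂μ - (∫ ω, u (a ω) ∂μ) * ∫ ω, u (b ω) ∂μ| ≤ 4 * α := by
    intro u hu hu1
    have h := abs_integral_mul_sub_le hm₁ hm₂ hα
      (hu.comp_stronglyMeasurable ha1.stronglyMeasurable_mk) (fun ω => hu1 _)
      (hu.comp_stronglyMeasurable hb1.stronglyMeasurable_mk) (fun ω => hu1 _)
    have e1 : ∫ ω, u (a ω) ∂μ = ∫ ω, u (ha1.mk a ω) ∂μ :=
      integral_congr_ae (by filter_upwards [ha1.ae_eq_mk] with ω h; rw [h])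
    have e2 : ∫ ω, u (b ω) ∂μ = ∫ ω, u (hb1.mk b ω) ∂μ :=
      integral_congr_ae (by filter_upwards [hb1.ae_eq_mk] with ω h; rw [h])
    have e3 : ∫ ω, u (a ω) * u (b ω) ∂μ = ∫ ω, u (ha1.mk a ω) * u (hb1.mk b ω) ∂μ :=
      integral_congr_ae (by
        filter_upwards [ha1.ae_eq_mk, hb1.ae_eq_mk] with ω h h'
        rw [h, h'])
    rw [e1, e2, e3]
    exact h
  have hcos := abs_le.1 (hcc Real.continuous_cos Real.abs_cos_le_one)
  have hsin := abs_le.1 (hcc Real.continuous_sin Real.abs_sin_le_one)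
  have hbd : ∀ {u : ℝ → ℝ}, Continuous u → (∀ r, |u r| ≤ 1) →
      Integrable (fun ω => u (a ω) * u (b ω)) μ := by
    intro u hu hu1
    refine Integrable.of_bound ((hu.comp_aestronglyMeasurable (Lp.aestronglyMeasurable a)).mul
      (hu.comp_aestronglyMeasurable (Lp.aestronglyMeasurable b))) 1
      (Eventually.of_forall fun ω => ?_)
    change ‖u (a ω) * u (b ω)‖ ≤ 1
    rw [norm_mul]
    exact mul_le_one₀ (hu1 _) (norm_nonneg _) (hu1 _)
  have hsum : ∫ ω, Real.cos ((a - b : Lp ℝ 2 μ) ω) ∂μ =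
      ∫ ω, Real.cos (a ω) * Real.cos (b ω) ∂μ + ∫ ω, Real.sin (a ω) * Real.sin (b ω) ∂μ := by
    rw [← integral_add (hbd Real.continuous_cos Real.abs_cos_le_one)
      (hbd Real.continuous_sin Real.abs_sin_le_one)]
    refine integral_congr_ae ?_
    filter_upwards [Lp.coeFn_sub a b] with ω h
    rw [h, Pi.sub_apply, Real.cos_sub]
  have hn : ‖a - b‖ ^ 2 = 2 - 2 * inner ℝ a b := by
    rw [norm_sub_sq_real, hna, hnb]
    ring
  rw [(hM.integral_cos_sin (M.sub_mem ha hb)).1, hn] at hsum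
  rw [(hM.integral_cos_sin ha).1, (hM.integral_cos_sin hb).1, hna, hnb, ← Real.exp_add] at hcos
  rw [(hM.integral_cos_sin ha).2] at hsin
  have e1 : Real.exp (-(2 - 2 * inner ℝ a b) / 2) = Real.exp (-1) * Real.exp (inner ℝ a b) := by
    rw [← Real.exp_add]
    congr 1
    ring
  have e2 : (-(1 : ℝ) ^ 2 / 2 + -(1 : ℝ) ^ 2 / 2) = -1 := by norm_num
  rw [e1] at hsum
  rw [e2] at hcos
  have h1 : Real.exp (-1) * inner ℝ a b ≤ 8 * α := by
    have := mul_le_mul_of_nonneg_left (Real.add_one_le_exp (inner ℝ a b)) (Real.exp_pos (-1)).le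
    linarith
  have h2 : 0 ≤ α := (abs_nonneg _).trans (hα ∅ ∅ (@MeasurableSet.empty _ m₁) (@MeasurableSet.empty _ m₂))
  have h3 : Real.exp 1 ≤ 3 := by linarith [Real.exp_one_lt_d9]
  have h4 := mul_le_mul_of_nonneg_left h1 (Real.exp_pos 1).le
  rw [← mul_assoc, ← Real.exp_add] at h4
  norm_num at h4
  nlinarith

lemma IsGaussianSubspace.abs_inner_le {m₁ m₂ m₀ : MeasurableSpace Ω} {μ : Measure Ω}
    [IsProbabilityMeasure μ] {M : Submodule ℝ (Lp ℝ 2 μ)} (hM : IsGaussianSubspace M)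
    (hm₁ : m₁ ≤ m₀) (hm₂ : m₂ ≤ m₀) {α : ℝ}
    (hα : ∀ A B, MeasurableSet[m₁] A → MeasurableSet[m₂] B →
      |μ.real (A ∩ B) - μ.real A * μ.real B| ≤ α)
    {a b : Lp ℝ 2 μ} (ha : a ∈ M) (hb : b ∈ M) (ha1 : AEStronglyMeasurable[m₁] a μ)
    (hb1 : AEStronglyMeasurable[m₂] b μ) :
    |inner ℝ a b| ≤ 24 * α * ‖a‖ * ‖b‖ := by
  have h2 : 0 ≤ α := (abs_nonneg _).trans (hα ∅ ∅ (@MeasurableSet.empty _ m₁) (@MeasurableSet.empty _ m₂))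
  rcases eq_or_ne a 0 with rfl | ha0
  · simp
  rcases eq_or_ne b 0 with rfl | hb0
  · simp
  have hsm := fun {m : MeasurableSpace Ω} {z : Lp ℝ 2 μ} (c : ℝ)
    (hz : AEStronglyMeasurable[m] z μ) => (hz.const_smul c).congr (Lp.coeFn_smul c z).symm
  have hnorm : ∀ {z : Lp ℝ 2 μ}, z ≠ 0 → ‖(‖z‖⁻¹ : ℝ) • z‖ = 1 := fun hz => by
    rw [norm_smul, norm_inv, norm_norm, inv_mul_cancel₀ (norm_ne_zero_iff.2 hz)]
  have hmain : ∀ {z : Lp ℝ 2 μ}, z ∈ M → AEStronglyMeasurable[m₁] z μ → z ≠ 0 →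
      inner ℝ z b ≤ 24 * α * ‖z‖ * ‖b‖ := by
    intro z hz hz1 hz0
    have := hM.inner_le_of_unit hm₁ hm₂ hα (M.smul_mem (‖z‖⁻¹ : ℝ) hz)
      (M.smul_mem (‖b‖⁻¹ : ℝ) hb) (hsm _ hz1) (hsm _ hb1) (hnorm hz0) (hnorm hb0)
    rw [real_inner_smul_left, real_inner_smul_right] at this
    have hz' := norm_pos_iff.2 hz0
    have hb' := norm_pos_iff.2 hb0
    calc inner ℝ z b = (‖z‖⁻¹ * (‖b‖⁻¹ * inner ℝ z b)) * (‖z‖ * ‖b‖) := by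
          field_simp
      _ ≤ (24 * α) * (‖z‖ * ‖b‖) := mul_le_mul_of_nonneg_right this (by positivity)
      _ = _ := by ring
  refine abs_le'.2 ⟨hmain ha ha1 ha0, ?_⟩
  have := hmain (M.smul_mem (-1 : ℝ) ha) (hsm _ ha1) (smul_ne_zero (by norm_num) ha0)
  simpa using this

lemma StrongMixing.exists_inner_le {V : Type*} {X : V → ℤ → Ω → ℝ}
    (hX : ∀ v t, Measurable (X v t)) (hS : StrongMixing μ X) {m : V → ℝ}
    {x : V → ℤ → Lp ℝ 2 μ} (hx : ∀ v t, x v t =ᵐ[μ] fun ω => X v t ω - m v)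
    (hG : IsGaussianSubspace (cspan ℝ (seg x Set.univ Set.univ))) (t : ℤ) {ε : ℝ} (hε : 0 < ε) :
    ∃ k : ℕ, ∀ a ∈ cspan ℝ (seg x Set.univ (Set.Iic t)),
      ∀ b ∈ cspan ℝ (seg x Set.univ (Set.Ici (t + k))), |inner ℝ a b| ≤ ε * ‖a‖ * ‖b‖ := by
  obtain ⟨k, hk⟩ := hS t (ε / 24) (by positivity)
  refine ⟨k, fun a ha b hb => ?_⟩
  have hsm : ∀ (m' : MeasurableSpace Ω) (v : V) (s : ℤ),
      MeasurableSpace.comap (X v s) inferInstance ≤ m' → AEStronglyMeasurable[m'] (x v s) μ := by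
    intro m' v s h
    have h1 : Measurable[m'] (fun ω => X v s ω - m v) :=
      (Measurable.mono (comap_measurable (X v s)) h le_rfl).sub_const _
    exact (h1.stronglyMeasurable.aestronglyMeasurable).congr (hx v s).symm
  have hle₁ : (⨆ (v : V), ⨆ s ≤ t, MeasurableSpace.comap (X v s) inferInstance) ≤ m₀ :=
    iSup_le fun v => iSup₂_le fun s _ => (hX v s).comap_le
  have hle₂ : (⨆ (v : V), ⨆ (s : ℤ) (_ : t + k ≤ s),
      MeasurableSpace.comap (X v s) inferInstance) ≤ m₀ :=
    iSup_le fun v => iSup₂_le fun s _ => (hX v s).comap_le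
  have := hG.abs_inner_le hle₁ hle₂ (α := ε / 24) (fun A B hA hB => hk k le_rfl A B hA hB)
    (cspan_mono (seg_mono subset_rfl (Set.subset_univ _)) ha)
    (cspan_mono (seg_mono subset_rfl (Set.subset_univ _)) hb)
    (aestronglyMeasurable_of_mem_cspan hle₁ (by
      rintro _ ⟨v, _, s, hs, rfl⟩
      exact hsm _ v s (le_iSup_of_le v (le_iSup₂_of_le s hs le_rfl))) ha)
    (aestronglyMeasurable_of_mem_cspan hle₂ (by
      rintro _ ⟨v, _, s, hs, rfl⟩
      exact hsm _ v s (le_iSup_of_le v (le_iSup₂_of_le s hs le_rfl))) hb)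
  linarith

end Mixing

/-! ### Conditional independence through set integrals -/

section CondIndep

variable {m₁ m₂ m₃ m m' n m₀ : MeasurableSpace Ω} {μ : Measure Ω}

lemma integral_mul_condExp_swap [IsFiniteMeasure μ] (hm : m ≤ m₀) {f y : Ω → ℝ}
    (hy : Integrable y μ) (hf : AEStronglyMeasurable f μ) (hf1 : ∀ ω, |f ω| ≤ 1) :
    ∫ ω, y ω * (μ[f | m]) ω ∂μ = ∫ ω, (μ[y | m]) ω * f ω ∂μ := by
  have hfi : Integrable f μ := Integrable.of_bound hf 1 (Eventually.of_forall hf1)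
  have hb : ∀ᵐ ω ∂μ, ‖(μ[f | m]) ω‖ ≤ 1 :=
    ae_bdd_abs_condExp_of_ae_bdd_abs (Eventually.of_forall hf1)
  have hi1 : Integrable (fun ω => y ω * (μ[f | m]) ω) μ :=
    hy.mul_bdd (c := 1) integrable_condExp.aestronglyMeasurable hb
  have hi2 : Integrable (fun ω => (μ[y | m]) ω * f ω) μ :=
    integrable_condExp.mul_bdd (c := 1) hf (Eventually.of_forall hf1)
  rw [← integral_condExp hm, ← integral_condExp (f := fun ω => (μ[y | m]) ω * f ω) hm]
  have h1 : μ[fun ω => y ω * (μ[f | m]) ω | m] =ᵐ[μ] fun ω => (μ[y | m]) ω * (μ[f | m]) ω :=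
    condExp_mul_of_stronglyMeasurable_right stronglyMeasurable_condExp hi1 hy
  have h2 : μ[fun ω => (μ[y | m]) ω * f ω | m] =ᵐ[μ] fun ω => (μ[y | m]) ω * (μ[f | m]) ω :=
    condExp_mul_of_stronglyMeasurable_left stronglyMeasurable_condExp hi2 hfi
  exact integral_congr_ae (h1.trans h2.symm)

lemma abs_indicator_one_le (s : Set Ω) (ω : Ω) : |s.indicator (fun _ => (1 : ℝ)) ω| ≤ 1 := by
  by_cases h : ω ∈ s <;> simp [h]

lemma integral_mul_indicator_one (f : Ω → ℝ) {s : Set Ω} (hs : MeasurableSet[m₀] s) :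
    ∫ ω, f ω * s.indicator (fun _ => (1 : ℝ)) ω ∂μ = ∫ ω in s, f ω ∂μ := by
  rw [← integral_indicator hs]
  congr 1
  ext ω
  by_cases h : ω ∈ s <;> simp [h]

lemma setIntegral_condExp_indicator_swap [IsFiniteMeasure μ] (hm : m ≤ m₀) {y : Ω → ℝ}
    (hy : Integrable y μ) {C : Set Ω} (hC : MeasurableSet[m₀] C) :
    ∫ ω, y ω * (μ[C.indicator fun _ => (1 : ℝ) | m]) ω ∂μ = ∫ ω in C, (μ[y | m]) ω ∂μ := by
  rw [integral_mul_condExp_swap hm hy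
    ((aestronglyMeasurable_const).indicator hC) (abs_indicator_one_le C),
    integral_mul_indicator_one _ hC]

lemma condIndepSigma_iff [IsFiniteMeasure μ] (h₁ : m₁ ≤ m₀) (h₂ : m₂ ⊔ m₃ ≤ m₀) :
    CondIndepSigma μ m₁ m₂ m₃ ↔ ∀ s, MeasurableSet[m₁] s → ∀ C, MeasurableSet[m₂ ⊔ m₃] C →
      ∫ ω in s, (μ[C.indicator fun _ => (1 : ℝ) | m₃]) ω ∂μ =
        ∫ ω in s, C.indicator (fun _ => (1 : ℝ)) ω ∂μ := by
  have h₃ : m₃ ≤ m₀ := le_sup_right.trans h₂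
  have hi : ∀ {s}, MeasurableSet[m₀] s → Integrable (s.indicator fun _ => (1 : ℝ)) μ :=
    fun hs => (integrable_const 1).indicator hs
  have hl : ∀ s, MeasurableSet[m₀] s → ∀ C, MeasurableSet[m₀] C →
      ∫ ω in s, (μ[C.indicator fun _ => (1 : ℝ) | m₃]) ω ∂μ =
      ∫ ω in C, (μ[s.indicator fun _ => (1 : ℝ) | m₃]) ω ∂μ := by
    intro s hs C hC
    rw [← setIntegral_condExp_indicator_swap h₃ (hi hs) hC, ← integral_mul_indicator_one _ hs]
    simp only [mul_comm]
  have hr : ∀ s, MeasurableSet[m₀] s → ∀ C, MeasurableSet[m₀] C →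
      ∫ ω in s, C.indicator (fun _ => (1 : ℝ)) ω ∂μ =
      ∫ ω in C, s.indicator (fun _ => (1 : ℝ)) ω ∂μ := by
    intro s hs C hC
    rw [← integral_mul_indicator_one _ hs, ← integral_mul_indicator_one _ hC]
    simp only [mul_comm]
  constructor
  · intro h s hs C hC
    rw [hl s (h₁ _ hs) C (h₂ _ hC), hr s (h₁ _ hs) C (h₂ _ hC),
      ← setIntegral_condExp h₂ (hi (h₁ _ hs)) hC]
    exact (setIntegral_congr_ae (h₂ _ hC) (by filter_upwards [h s hs] with ω h _ using h)).symm
  · intro h s hs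
    refine (ae_eq_condExp_of_forall_setIntegral_eq h₂ (hi (h₁ _ hs))
      (fun _ _ _ => integrable_condExp.integrableOn) (fun C hC _ => ?_) ?_).symm
    · rw [← hl s (h₁ _ hs) C (h₂ _ hC), h s hs C hC, hr s (h₁ _ hs) C (h₂ _ hC)]
    · exact (stronglyMeasurable_condExp.mono
        (le_sup_right : m₃ ≤ m₂ ⊔ m₃)).aestronglyMeasurable

lemma CondIndepSigma.condExp_eq [IsFiniteMeasure μ] (h₁ : m₁ ≤ m₀) (h₂ : m₂ ⊔ m₃ ≤ m₀)
    (h : CondIndepSigma μ m₁ m₂ m₃) {y : Ω → ℝ} (hy : Integrable y μ)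
    (hym : StronglyMeasurable[m₁] y) : μ[y | m₂ ⊔ m₃] =ᵐ[μ] μ[y | m₃] := by
  have h₃ : m₃ ≤ m₀ := le_sup_right.trans h₂
  rw [condIndepSigma_iff h₁ h₂] at h
  refine (ae_eq_condExp_of_forall_setIntegral_eq h₂ hy
      (fun _ _ _ => integrable_condExp.integrableOn) (fun C hC _ => ?_)
      (stronglyMeasurable_condExp.mono
        (le_sup_right : m₃ ≤ m₂ ⊔ m₃)).aestronglyMeasurable).symm
  have hCi : Integrable (C.indicator fun _ => (1 : ℝ)) μ :=
    (integrable_const 1).indicator (h₂ _ hC)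
  have h3 : μ[μ[C.indicator fun _ => (1 : ℝ) | m₃] | m₁] =ᵐ[μ]
      μ[C.indicator fun _ => (1 : ℝ) | m₁] := by
    refine ae_eq_condExp_of_forall_setIntegral_eq h₁ hCi
      (fun _ _ _ => integrable_condExp.integrableOn) (fun s hs _ => ?_)
      stronglyMeasurable_condExp.aestronglyMeasurable
    rw [setIntegral_condExp h₁ integrable_condExp hs, h s hs C hC]
  have hb : ∀ᵐ ω ∂μ, ‖(μ[C.indicator fun _ => (1 : ℝ) | m₃]) ω‖ ≤ 1 :=
    ae_bdd_abs_condExp_of_ae_bdd_abs (Eventually.of_forall (abs_indicator_one_le C))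
  have hi1 : Integrable (fun ω => y ω * (μ[C.indicator fun _ => (1 : ℝ) | m₃]) ω) μ :=
    hy.mul_bdd (c := 1) integrable_condExp.aestronglyMeasurable hb
  have hi2 : Integrable (fun ω => y ω * C.indicator (fun _ => (1 : ℝ)) ω) μ :=
    hy.mul_bdd (c := 1) hCi.aestronglyMeasurable
      (Eventually.of_forall (abs_indicator_one_le C))
  rw [← setIntegral_condExp_indicator_swap h₃ hy (h₂ _ hC), ← integral_condExp h₁,
    ← integral_mul_indicator_one _ (h₂ _ hC),
    ← integral_condExp (f := fun ω => y ω * C.indicator (fun _ => (1 : ℝ)) ω) h₁]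
  refine integral_congr_ae ?_
  refine (condExp_mul_of_stronglyMeasurable_left hym hi1 integrable_condExp).trans ?_
  refine EventuallyEq.trans ?_ (condExp_mul_of_stronglyMeasurable_left hym hi2 hCi).symm
  filter_upwards [h3] with ω hω
  simp [hω]

/-- Adding independent information to the generating σ-algebra. -/
lemma condIndepSigma_of_indep [IsProbabilityMeasure μ] (h₂₃ : m₂ ⊔ m₃ ≤ m₀) (hn : n ≤ m₀)
    (h₁ : m₁ ≤ m₃ ⊔ n) (hind : Indep n (m₂ ⊔ m₃) μ) : CondIndepSigma μ m₁ m₂ m₃ := by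
  have h₃ : m₃ ≤ m₀ := le_sup_right.trans h₂₃
  have h₃n : m₃ ⊔ n ≤ m₀ := sup_le h₃ hn
  rw [condIndepSigma_iff (h₁.trans h₃n) h₂₃]
  intro s hs C hC
  replace hs := h₁ _ hs
  have hCi : Integrable (C.indicator fun _ => (1 : ℝ)) μ :=
    (integrable_const 1).indicator (h₂₃ _ hC)
  have hprod : ∀ f : Ω → ℝ, Integrable f μ → StronglyMeasurable[m₂ ⊔ m₃] f →
      ∀ A B, MeasurableSet[m₃] A → MeasurableSet[n] B →
      ∫ ω in A ∩ B, f ω ∂μ = μ.real B * ∫ ω in A, f ω ∂μ := by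
    intro f hf hfm A B hA hB
    have hA' : MeasurableSet[m₂ ⊔ m₃] A := le_sup_right (a := m₂) _ hA
    have h1 := condExp_indep_eq h₂₃ hn (hfm.indicator hA') hind.symm
    have h2 := setIntegral_condExp hn (hf.indicator (h₃ _ hA)) hB
    rw [setIntegral_congr_ae (hn _ hB) (g := fun _ => ∫ ω, A.indicator f ω ∂μ)
      (by filter_upwards [h1] with ω h _ using h), setIntegral_const,
      integral_indicator (h₃ _ hA), setIntegral_indicator (h₃ _ hA), Set.inter_comm] at h2
    rw [← h2, smul_eq_mul]
  refine MeasurableSpace.induction_on_inter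
    (C := fun s _ => ∫ ω in s, (μ[C.indicator fun _ => (1 : ℝ) | m₃]) ω ∂μ =
        ∫ ω in s, C.indicator (fun _ => (1 : ℝ)) ω ∂μ)
    (m := m₃ ⊔ n) (s := {s | ∃ A B, MeasurableSet[m₃] A ∧ MeasurableSet[n] B ∧ A ∩ B = s})
    ?_ ?_ ?_ ?_ ?_ ?_ s hs
  · refine le_antisymm (sup_le ?_ ?_) (MeasurableSpace.generateFrom_le ?_)
    · intro A hA
      exact MeasurableSpace.measurableSet_generateFrom
        ⟨A, Set.univ, hA, @MeasurableSet.univ _ n, Set.inter_univ _⟩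
    · intro B hB
      exact MeasurableSpace.measurableSet_generateFrom
        ⟨Set.univ, B, @MeasurableSet.univ _ m₃, hB, Set.univ_inter _⟩
    · rintro _ ⟨A, B, hA, hB, rfl⟩
      exact @MeasurableSet.inter _ (m₃ ⊔ n) _ _ (le_sup_left (a := m₃) _ hA)
        (le_sup_right (a := m₃) _ hB)
  · rintro _ ⟨A, B, hA, hB, rfl⟩ _ ⟨A', B', hA', hB', rfl⟩ _
    exact ⟨A ∩ A', B ∩ B', hA.inter hA', hB.inter hB', Set.inter_inter_inter_comm _ _ _ _⟩
  · simp
  · rintro _ ⟨A, B, hA, hB, rfl⟩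
    rw [hprod _ integrable_condExp (stronglyMeasurable_condExp.mono le_sup_right) A B hA hB,
      hprod _ hCi (stronglyMeasurable_const.indicator hC) A B hA hB, setIntegral_condExp h₃ hCi hA]
  · intro t ht h
    have e1 := integral_add_compl (h₃n _ ht)
      (integrable_condExp (f := C.indicator fun _ => (1 : ℝ)) (m := m₃) (μ := μ))
    have e2 := integral_add_compl (h₃n _ ht) hCi
    rw [integral_condExp h₃] at e1
    linarith
  · intro f hd hf h
    rw [integral_iUnion (fun i => h₃n _ (hf i)) hd integrable_condExp.integrableOn,
      integral_iUnion (fun i => h₃n _ (hf i)) hd hCi.integrableOn]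
    exact tsum_congr h

end CondIndep

/-! ### Completed σ-algebras generated by elements of `L²` -/

section GaussianSigma

/-- The completed σ-algebra generated by a set of elements of `L²`. -/
def gsig {m₀ : MeasurableSpace Ω} {μ : Measure Ω} (T : Set (Lp ℝ 2 μ)) : MeasurableSpace Ω :=
  mComplete μ (⨆ y ∈ T, MeasurableSpace.comap (y : Ω → ℝ) inferInstance)

variable {m m' m₀ : MeasurableSpace Ω} {μ : Measure Ω}

lemma mComplete_le_iff :
    mComplete μ m ≤ m' ↔ m ≤ m' ∧ ∀ s, μ s = 0 → MeasurableSet[m'] s := by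
  rw [mComplete, sup_le_iff]
  refine and_congr_right fun _ => ?_
  rw [MeasurableSpace.generateFrom_le_iff]
  rfl

lemma measurableSet_mComplete_of_null {s : Set Ω} (hs : μ s = 0) :
    MeasurableSet[mComplete μ m] s := (mComplete_le_iff.1 le_rfl).2 s hs

lemma measurable_of_ae_eq (hnull : ∀ s, μ s = 0 → MeasurableSet[m'] s)
    {f g : Ω → ℝ} (hfg : f =ᵐ[μ] g) (hg : Measurable[m'] g) : Measurable[m'] f := by
  intro A hA
  have h0 : μ {ω | ¬ f ω = g ω} = 0 := hfg
  have h1 : f ⁻¹' A = (g ⁻¹' A \ {ω | ¬ f ω = g ω}) ∪ (f ⁻¹' A ∩ {ω | ¬ f ω = g ω}) := by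
    ext ω
    by_cases h : f ω = g ω <;> simp [h]
  rw [h1]
  exact ((hg hA).diff (hnull _ h0)).union (hnull _ (measure_mono_null Set.inter_subset_right h0))

lemma gsig_le_iff {T : Set (Lp ℝ 2 μ)} :
    gsig T ≤ m' ↔ (∀ y ∈ T, Measurable[m'] (y : Ω → ℝ)) ∧ ∀ s, μ s = 0 → MeasurableSet[m'] s := by
  rw [gsig, mComplete_le_iff, iSup₂_le_iff]
  simp only [measurable_iff_comap_le]

lemma gsig_le (hc : ∀ s, μ s = 0 → MeasurableSet s) (T : Set (Lp ℝ 2 μ)) : gsig T ≤ m₀ :=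
  gsig_le_iff.2 ⟨fun y _ => (Lp.stronglyMeasurable y).measurable, hc⟩

lemma measurable_gsig {T : Set (Lp ℝ 2 μ)} {y : Lp ℝ 2 μ} (hy : y ∈ T) :
    Measurable[gsig T] (y : Ω → ℝ) := (gsig_le_iff.1 le_rfl).1 y hy

lemma measurableSet_gsig_of_null {T : Set (Lp ℝ 2 μ)} {s : Set Ω} (hs : μ s = 0) :
    MeasurableSet[gsig T] s := measurableSet_mComplete_of_null hs

lemma gsig_mono {T T' : Set (Lp ℝ 2 μ)} (h : T ⊆ T') : gsig T ≤ gsig T' :=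
  gsig_le_iff.2 ⟨fun _ hy => measurable_gsig (h hy), fun _ => measurableSet_gsig_of_null⟩

lemma gsig_union (T T' : Set (Lp ℝ 2 μ)) : gsig (T ∪ T') = gsig T ⊔ gsig T' := by
  refine le_antisymm (gsig_le_iff.2 ⟨?_, fun s hs =>
      (le_sup_left : gsig T ≤ _) s (measurableSet_gsig_of_null hs)⟩)
    (sup_le (gsig_mono Set.subset_union_left) (gsig_mono Set.subset_union_right))
  rintro y (hy | hy)
  · exact (measurable_gsig hy).mono le_sup_left le_rfl
  · exact (measurable_gsig hy).mono le_sup_right le_rfl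

lemma aestronglyMeasurable_gsig {T : Set (Lp ℝ 2 μ)} (hc : ∀ s, μ s = 0 → MeasurableSet s)
    {y : Lp ℝ 2 μ} (hy : y ∈ cspan ℝ T) : AEStronglyMeasurable[gsig T] y μ :=
  aestronglyMeasurable_of_mem_cspan (gsig_le hc T)
    (fun _ hz => (measurable_gsig hz).stronglyMeasurable.aestronglyMeasurable) hy

lemma measurable_gsig_of_mem_cspan {T : Set (Lp ℝ 2 μ)} (hc : ∀ s, μ s = 0 → MeasurableSet s)
    {y : Lp ℝ 2 μ} (hy : y ∈ cspan ℝ T) : Measurable[gsig T] (y : Ω → ℝ) :=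
  measurable_of_ae_eq (fun _ => measurableSet_gsig_of_null)
    (aestronglyMeasurable_gsig hc hy).ae_eq_mk
    (aestronglyMeasurable_gsig hc hy).stronglyMeasurable_mk.measurable

lemma gsig_le_gsig {T T' : Set (Lp ℝ 2 μ)} (hc : ∀ s, μ s = 0 → MeasurableSet s)
    (h : T ⊆ cspan ℝ T') : gsig T ≤ gsig T' :=
  gsig_le_iff.2 ⟨fun _ hy => measurable_gsig_of_mem_cspan hc (h hy),
    fun _ => measurableSet_gsig_of_null⟩

lemma pastSigma_eq_gsig {V : Type*} {X : V → ℤ → Ω → ℝ} {c : V → ℝ} {x : V → ℤ → Lp ℝ 2 μ}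
    (hx : ∀ v t, x v t =ᵐ[μ] fun ω => X v t ω - c v) (A : Set V) (t : ℤ) :
    pastSigma μ X A t = gsig (seg x A (Set.Iic t)) := by
  apply le_antisymm
  · rw [pastSigma, mComplete_le_iff]
    refine ⟨iSup₂_le fun v hv => iSup₂_le fun s hs => ?_, fun _ => measurableSet_gsig_of_null⟩
    rw [← measurable_iff_comap_le]
    have h1 : X v s =ᵐ[μ] fun ω => x v s ω + c v := by
      filter_upwards [hx v s] with ω h
      rw [h, sub_add_cancel]
    have h2 : Measurable[gsig (seg x A (Set.Iic t))] (x v s : Ω → ℝ) :=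
      measurable_gsig (mem_seg hv hs)
    have h3 : Measurable[gsig (seg x A (Set.Iic t))] fun ω => x v s ω + c v := h2.add_const _
    exact measurable_of_ae_eq (fun _ => measurableSet_gsig_of_null) h1 h3
  · refine (gsig_le_iff (m' := pastSigma μ X A t)).2
      ⟨?_, fun _ h => measurableSet_mComplete_of_null h⟩
    rintro _ ⟨v, hv, s, hs, rfl⟩
    refine measurable_of_ae_eq (fun _ => measurableSet_mComplete_of_null) (hx v s) ?_
    refine Measurable.sub_const ?_ _
    rw [measurable_iff_comap_le]
    refine le_trans ?_ (mComplete_le_iff.1 le_rfl).1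
    exact le_iSup₂_of_le v hv (le_iSup₂_of_le s hs le_rfl)

lemma exists_ae_eq_of_mComplete {s : Set Ω} (hs : MeasurableSet[mComplete μ m] s) :
    ∃ s', MeasurableSet[m] s' ∧ s =ᵐ[μ] s' := by
  have h : mComplete μ m ≤ eventuallyMeasurableSpace m (ae μ) := by
    rw [mComplete_le_iff]
    refine ⟨le_eventuallyMeasurableSpace, fun s hs => ⟨∅, @MeasurableSet.empty _ m, ?_⟩⟩
    exact ae_eq_empty.2 hs
  exact h s hs

lemma indep_mComplete (h : Indep m m' μ) :
    Indep (mComplete μ m) (mComplete μ m') μ := by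
  rw [Indep_iff] at h ⊢
  intro s t hs ht
  obtain ⟨s', hs', hss⟩ := exists_ae_eq_of_mComplete hs
  obtain ⟨t', ht', htt⟩ := exists_ae_eq_of_mComplete ht
  rw [measure_congr hss, measure_congr htt, measure_congr (hss.inter htt), h s' t' hs' ht']

lemma iSup_comap_eq_comap_pi (T : Set (Lp ℝ 2 μ)) :
    (⨆ y ∈ T, MeasurableSpace.comap (y : Ω → ℝ) inferInstance) =
      MeasurableSpace.comap (fun ω (y : T) => (y : Lp ℝ 2 μ) ω) MeasurableSpace.pi := by
  rw [MeasurableSpace.pi, MeasurableSpace.comap_iSup, iSup_subtype']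
  refine iSup_congr fun y => ?_
  rw [MeasurableSpace.comap_comp]
  rfl

/-- Orthogonal families in a Gaussian subspace generate independent σ-algebras. -/
lemma IsGaussianSubspace.indep_gsig [IsProbabilityMeasure μ] {M : Submodule ℝ (Lp ℝ 2 μ)}
    (hM : IsGaussianSubspace M) {T T' : Set (Lp ℝ 2 μ)} (hT : T ⊆ M) (hT' : T' ⊆ M)
    (h : ∀ y ∈ T, ∀ z ∈ T', inner ℝ y z = 0) : Indep (gsig T) (gsig T') μ := by
  apply indep_mComplete
  rw [iSup_comap_eq_comap_pi, iSup_comap_eq_comap_pi]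
  have hp : IsGaussianProcess (Sum.elim (fun (y : T) ω => (y : Lp ℝ 2 μ) ω)
      (fun (z : T') ω => (z : Lp ℝ 2 μ) ω)) μ := by
    have := hM.isGaussianProcess (y := Sum.elim (fun y : T => (y : Lp ℝ 2 μ))
      (fun z : T' => (z : Lp ℝ 2 μ))) (by rintro (y | z); exacts [hT y.2, hT' z.2])
    convert this using 1
    ext (y | z) <;> rfl
  refine hp.indepFun_of_covariance_eq_zero
    (fun y => (Lp.aestronglyMeasurable _).aemeasurable)
    (fun y => (Lp.aestronglyMeasurable _).aemeasurable) fun y z => ?_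
  exact (covariance_eq_inner (hM _ (hT y.2)).2 (hM _ (hT' z.2)).2).trans (h _ y.2 _ z.2)

lemma IsGaussianSubspace.condExp_gsig [IsProbabilityMeasure μ] {M : Submodule ℝ (Lp ℝ 2 μ)}
    (hM : IsGaussianSubspace M) (hc : ∀ s, μ s = 0 → MeasurableSet s) {T : Set (Lp ℝ 2 μ)}
    (hT : T ⊆ M) {y u : Lp ℝ 2 μ} (hu : u ∈ cspan ℝ T) (hyu : y - u ∈ M)
    (h : ∀ z ∈ T, inner ℝ z (y - u) = 0) : μ[y | gsig T] =ᵐ[μ] u := by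
  have h1 : μ[u | gsig T] =ᵐ[μ] u := by
    rw [condExp_of_stronglyMeasurable (gsig_le hc T)
      (measurable_gsig_of_mem_cspan hc hu).stronglyMeasurable (integrable_of_L2 u)]
  have hi : Indep (gsig {y - u}) (gsig T) μ :=
    hM.indep_gsig (by simpa using hyu) hT fun a ha z hz => by
      rw [Set.mem_singleton_iff.1 ha, real_inner_comm]
      exact h z hz
  have hm : StronglyMeasurable[gsig {y - u}] ((y - u : Lp ℝ 2 μ) : Ω → ℝ) :=
    (measurable_gsig (Set.mem_singleton _)).stronglyMeasurable
  have h2 : μ[(y - u : Lp ℝ 2 μ) | gsig T] =ᵐ[μ] fun _ => ∫ ω, (y - u : Lp ℝ 2 μ) ω ∂μ :=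
    condExp_indep_eq (gsig_le hc {y - u}) (gsig_le hc T) hm hi
  rw [(hM _ hyu).2] at h2
  have h3 : (y : Ω → ℝ) =ᵐ[μ] (u : Ω → ℝ) + ((y - u : Lp ℝ 2 μ) : Ω → ℝ) := by
    filter_upwards [Lp.coeFn_sub y u] with ω hω
    rw [Pi.add_apply, hω, Pi.sub_apply, add_sub_cancel]
  refine (condExp_congr_ae h3).trans
    ((condExp_add (integrable_of_L2 _) (integrable_of_L2 _) _).trans ?_)
  filter_upwards [h1, h2] with ω h1 h2
  rw [Pi.add_apply, h1, h2, add_zero]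

/-- Conditional independence in a Gaussian space is a statement about projections. -/
theorem IsGaussianSubspace.condIndepSigma_gsig_iff [IsProbabilityMeasure μ]
    {M : Submodule ℝ (Lp ℝ 2 μ)} (hM : IsGaussianSubspace M) (hMc : IsClosed (M : Set (Lp ℝ 2 μ)))
    (hc : ∀ s, μ s = 0 → MeasurableSet s) {T₁ T₂ T₃ : Set (Lp ℝ 2 μ)} (h₁ : T₁ ⊆ M) (h₂ : T₂ ⊆ M)
    (h₃ : T₃ ⊆ M) :
    CondIndepSigma μ (gsig T₁) (gsig T₂) (gsig T₃) ↔
      ∀ y ∈ T₁, ∃ u ∈ cspan ℝ T₃, ∀ z ∈ T₂ ∪ T₃, inner ℝ z (y - u) = 0 := by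
  have h₂₃ : gsig T₂ ⊔ gsig T₃ ≤ m₀ := sup_le (gsig_le hc _) (gsig_le hc _)
  have hM₃ : cspan ℝ T₃ ≤ M := cspan_le hMc h₃
  have hM₂₃ : cspan ℝ (T₂ ∪ T₃) ≤ M := cspan_le hMc (Set.union_subset h₂ h₃)
  have hproj : ∀ (T : Set (Lp ℝ 2 μ)) (y : Lp ℝ 2 μ), ∀ z ∈ T,
      inner ℝ z (y - (cspan ℝ T).starProjection y) = 0 := fun T y z hz => by
    rw [real_inner_comm]
    exact Submodule.starProjection_inner_eq_zero y z (subset_cspan T hz)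
  constructor
  · intro h y hy
    refine ⟨(cspan ℝ T₃).starProjection y, Submodule.starProjection_apply_mem _ _, ?_⟩
    have e := h.condExp_eq (gsig_le hc _) h₂₃ (integrable_of_L2 y)
      (measurable_gsig hy).stronglyMeasurable
    rw [← gsig_union] at e
    have e1 := hM.condExp_gsig hc h₃ (Submodule.starProjection_apply_mem _ y)
      (M.sub_mem (h₁ hy) (hM₃ (Submodule.starProjection_apply_mem _ y))) (hproj T₃ y)
    have e2 := hM.condExp_gsig hc (Set.union_subset h₂ h₃)
      (Submodule.starProjection_apply_mem _ y)
      (M.sub_mem (h₁ hy) (hM₂₃ (Submodule.starProjection_apply_mem _ y))) (hproj (T₂ ∪ T₃) y)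
    have e3 : (cspan ℝ (T₂ ∪ T₃)).starProjection y = (cspan ℝ T₃).starProjection y :=
      Lp.ext (e2.symm.trans (e.trans e1))
    rw [← e3]
    exact hproj (T₂ ∪ T₃) y
  · intro h
    choose! u hu hz using h
    have hR : (fun y => y - u y) '' T₁ ⊆ M := by
      rintro _ ⟨y, hy, rfl⟩
      exact M.sub_mem (h₁ hy) (hM₃ (hu y hy))
    refine condIndepSigma_of_indep (n := gsig ((fun y => y - u y) '' T₁)) h₂₃ (gsig_le hc _) ?_ ?_
    · rw [← gsig_union]
      refine gsig_le_gsig hc fun y hy => ?_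
      have h1 : u y ∈ cspan ℝ (T₃ ∪ (fun y => y - u y) '' T₁) :=
        cspan_mono Set.subset_union_left (hu y hy)
      have h2 : y - u y ∈ cspan ℝ (T₃ ∪ (fun y => y - u y) '' T₁) :=
        subset_cspan _ (Or.inr ⟨y, hy, rfl⟩)
      simpa using Submodule.add_mem _ h1 h2
    · rw [← gsig_union]
      refine hM.indep_gsig hR (Set.union_subset h₂ h₃) ?_
      rintro _ ⟨y, hy, rfl⟩ z hzT
      rw [real_inner_comm]
      exact hz y hy z hzT

end GaussianSigma

/-! ### Consequences of condition (P) -/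

section ConditionPConsequences

variable {V : Type*} [Fintype V] {m₀ : MeasurableSpace Ω} {μ : Measure Ω} {X : V → ℤ → Ω → ℝ}

lemma absolutelyContinuous_withDensity_of_continuousAt {E : Type*} [TopologicalSpace E]
    [MeasurableSpace E] [BorelSpace E] {ν : Measure E} {f : E → ℝ}
    (h : ∀ᵐ y ∂ν, 0 < f y ∧ ContinuousAt f y) :
    ν ≪ ν.withDensity fun y => ENNReal.ofReal (f y) := by
  have hC : MeasurableSet {y | ContinuousAt f y} := (IsGδ.setOfPred_continuousAt f).measurableSet
  have hr : ν.restrict {y | ContinuousAt f y} = ν :=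
    Measure.restrict_eq_self_of_ae_mem (h.mono fun _ hy => hy.2)
  have hf : AEMeasurable f ν := by
    rw [← hr]
    exact ContinuousOn.aemeasurable (fun y hy => ContinuousAt.continuousWithinAt hy) hC
  exact withDensity_absolutelyContinuous' hf.ennreal_ofReal
    (h.mono fun y hy => (ENNReal.ofReal_pos.2 hy.1).ne')

lemma ConditionP.exists_isProductMeasure [IsProbabilityMeasure μ]
    (hX : ∀ v t, Measurable (X v t)) (hP : ConditionP μ X) (t : ℤ)
    (hF : pastSigma μ X Set.univ t ≤ m₀) :
    ∃ ν : Measure (V → ℝ), IsProductMeasure ν ∧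
      (∀ B, MeasurableSet B → μ ((fun ω v => X v (t + 1) ω) ⁻¹' B) ≠ 0 → ν B ≠ 0) ∧
      ∀ B, MeasurableSet B →
        MeasurableSet[pastSigma μ X Set.univ t] ((fun ω v => X v (t + 1) ω) ⁻¹' B) →
        ν B = 0 ∨ ν Bᶜ = 0 := by
  obtain ⟨ν, hν, h⟩ := hP
  obtain ⟨κ, f, hκ, hcond, hdens⟩ := h t
  have hY : Measurable fun ω v => X v (t + 1) ω := measurable_pi_lambda _ fun v => hX v _
  refine ⟨ν, hν, fun B hB h0 hB0 => h0 ?_, fun B hB hBF => ?_⟩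
  · have h1 : μ[fun ω => B.indicator (fun _ => (1 : ℝ)) (fun v => X v (t + 1) ω) |
        pastSigma μ X Set.univ t] =ᵐ[μ] fun _ => 0 := by
      filter_upwards [hcond B hB, hdens] with ω h1 h2
      rw [h1, h2.1, withDensity_absolutelyContinuous _ _ hB0, ENNReal.toReal_zero]
    have h2 : ∫ ω, B.indicator (fun _ => (1 : ℝ)) (fun v => X v (t + 1) ω) ∂μ = 0 := by
      rw [← integral_condExp hF, integral_congr_ae h1, integral_zero]
    have h3 : (fun ω => B.indicator (fun _ => (1 : ℝ)) (fun v => X v (t + 1) ω)) =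
        ((fun ω v => X v (t + 1) ω) ⁻¹' B).indicator fun _ => (1 : ℝ) := rfl
    rw [h3, integral_indicator_const _ (hY hB), smul_eq_mul, mul_one, measureReal_eq_zero_iff] at h2
    exact h2
  · have h1 : μ[fun ω => B.indicator (fun _ => (1 : ℝ)) (fun v => X v (t + 1) ω) |
        pastSigma μ X Set.univ t] =
        ((fun ω v => X v (t + 1) ω) ⁻¹' B).indicator fun _ => (1 : ℝ) :=
      condExp_of_stronglyMeasurable hF (stronglyMeasurable_const.indicator hBF)
        ((integrable_const _).indicator (hY hB))
    have h2 := hcond B hB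
    rw [h1] at h2
    obtain ⟨ω, h2, h3, h4⟩ := (h2.and hdens).exists
    have h5 := absolutelyContinuous_withDensity_of_continuousAt h4
    rw [← h3] at h5
    by_cases hω : ω ∈ (fun ω v => X v (t + 1) ω) ⁻¹' B
    · rw [Set.indicator_of_mem hω] at h2
      refine Or.inr (h5 ((prob_compl_eq_zero_iff hB).2 ?_))
      rwa [eq_comm, ENNReal.toReal_eq_one_iff] at h2
    · rw [Set.indicator_of_notMem hω] at h2
      refine Or.inl (h5 ?_)
      exact ((ENNReal.toReal_eq_zero_iff _).1 h2.symm).resolve_right (measure_ne_top _ _)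

lemma IsProductMeasure.pi_ne_zero {ν : Measure (V → ℝ)} (hν : IsProductMeasure ν)
    {I : V → Set ℝ} (hI : ∀ v, MeasurableSet (I v)) (h : ∀ v, ν ((fun y => y v) ⁻¹' I v) ≠ 0) :
    ν (Set.univ.pi I) ≠ 0 := by
  classical
  obtain ⟨νv, hνv⟩ := hν
  rw [hνv I hI, Finset.prod_ne_zero_iff]
  intro v _ h0
  apply h v
  have h1 : (fun y : V → ℝ => y v) ⁻¹' I v =
      Set.univ.pi (Function.update (fun _ => Set.univ) v (I v)) := by
    ext y
    simp only [Set.mem_preimage, Set.mem_univ_pi]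
    constructor
    · intro hy w
      rcases eq_or_ne w v with rfl | hw
      · simpa using hy
      · simp [hw]
    · intro hy
      simpa using hy v
  rw [h1, hνv]
  · exact Finset.prod_eq_zero (Finset.mem_univ v) (by simpa using h0)
  · intro w
    rcases eq_or_ne w v with rfl | hw
    · simpa using hI w
    · simp [hw]

lemma HasGaussianLaw.measure_ball_ne_zero [IsProbabilityMeasure μ] {y : Lp ℝ 2 μ}
    (hy : HasGaussianLaw y μ) (h0 : ∫ ω, y ω ∂μ = 0) {a δ : ℝ} (hδ : 0 < δ)
    (ha : a = 0 ∨ y ≠ 0) : μ {ω | |y ω - a| < δ} ≠ 0 := by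
  have hm : AEMeasurable y μ := (Lp.aestronglyMeasurable y).aemeasurable
  have h1 : μ {ω | |y ω - a| < δ} = μ.map y (Metric.ball a δ) := by
    rw [Measure.map_apply_of_aemeasurable hm Metric.isOpen_ball.measurableSet]
    rfl
  rw [h1, hy.map_eq_gaussianReal, h0]
  by_cases hv : (Var[y; μ]).toNNReal = 0
  · have h2 : y = 0 := by
      rw [Real.toNNReal_eq_zero, variance_eq_norm_sq h0] at hv
      have := norm_nonneg y
      exact norm_eq_zero.1 (by nlinarith)
    have h3 : a = 0 := ha.resolve_right (not_not.2 h2)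
    rw [hv, gaussianReal_zero_var, h3, Measure.dirac_apply' _ Metric.isOpen_ball.measurableSet]
    simp [hδ]
  · intro h
    have := gaussianReal_absolutelyContinuous' 0 hv h
    exact (Metric.measure_ball_pos volume a hδ).ne' this

/-- Under condition (P), the components of a Gaussian process that are not almost surely
constant are linearly independent modulo the past. -/
theorem ConditionP.smul_eq_zero_of_sum_mem [IsProbabilityMeasure μ]
    (hX : ∀ v t, Measurable (X v t)) (hP : ConditionP μ X)
    (hc : ∀ s, μ s = 0 → MeasurableSet s) {m : V → ℝ} {x : V → ℤ → Lp ℝ 2 μ}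
    (hx : ∀ v t, x v t =ᵐ[μ] fun ω => X v t ω - m v)
    (hG : IsGaussianSubspace (cspan ℝ (seg x Set.univ Set.univ))) (t : ℤ) (c : V → ℝ)
    (hsum : ∑ v, c v • x v t ∈ cspan ℝ (seg x Set.univ (Set.Iic (t - 1)))) (v : V) :
    c v • x v t = 0 := by
  classical
  by_contra hne
  obtain ⟨hcv, hxv⟩ := smul_ne_zero_iff.1 hne
  have hF : pastSigma μ X Set.univ (t - 1) ≤ m₀ := by
    rw [pastSigma_eq_gsig hx]
    exact gsig_le hc _
  obtain ⟨ν, hν, hpos, hzero⟩ := hP.exists_isProductMeasure hX (t - 1) hF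
  rw [sub_add_cancel] at hpos hzero
  set C : ℝ := ∑ w, |c w| with hC
  have hC0 : 0 ≤ C := Finset.sum_nonneg fun _ _ => abs_nonneg _
  set δ : ℝ := 1 / (2 * (C + 1)) with hδ
  have hδ0 : 0 < δ := by positivity
  have hCδ : C * δ < 1 / 2 := by
    rw [hδ, mul_one_div, div_lt_div_iff₀ (by positivity) (by positivity)]
    linarith
  set q : ℝ := ∑ w, c w * m w + 1 / 2 with hq
  set B : Set (V → ℝ) := {y | ∑ w, c w * y w ≤ q} with hBdef
  have hB : MeasurableSet B :=
    measurableSet_le (by fun_prop) measurable_const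
  have hrect : ∀ a : V → ℝ, (∀ w, a w = 0 ∨ x w t ≠ 0) →
      ν (Set.univ.pi fun w => Metric.ball (m w + a w) δ) ≠ 0 := by
    intro a ha
    refine hν.pi_ne_zero (fun w => Metric.isOpen_ball.measurableSet) fun w => ?_
    refine hpos _ ((measurable_pi_apply w) Metric.isOpen_ball.measurableSet) fun h0 => ?_
    have hw := hG _ (subset_cspan _ (mem_seg (y := x) (Set.mem_univ w) (Set.mem_univ t)))
    refine HasGaussianLaw.measure_ball_ne_zero hw.1 hw.2 hδ0 (ha w) ?_
    rw [← h0]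
    refine measure_congr ?_
    filter_upwards [hx w t] with ω hω
    refine propext ?_
    change |x w t ω - a w| < δ ↔ |X w t ω - (m w + a w)| < δ
    rw [hω, sub_sub]
  have hest : ∀ a y : V → ℝ, y ∈ Set.univ.pi (fun w => Metric.ball (m w + a w) δ) →
      |∑ w, c w * y w - ∑ w, c w * (m w + a w)| < 1 / 2 := by
    intro a y hy
    refine lt_of_le_of_lt ?_ hCδ
    rw [← Finset.sum_sub_distrib, hC, Finset.sum_mul]
    refine (Finset.abs_sum_le_sum_abs _ _).trans (Finset.sum_le_sum fun w _ => ?_)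
    rw [← mul_sub, abs_mul]
    exact mul_le_mul_of_nonneg_left (le_of_lt (hy w (Set.mem_univ w))) (abs_nonneg _)
  have hmeas : MeasurableSet[pastSigma μ X Set.univ (t - 1)] ((fun ω v => X v t ω) ⁻¹' B) := by
    rw [pastSigma_eq_gsig hx]
    have h1 := measurable_gsig_of_mem_cspan hc hsum
    have h2 : (fun ω => ∑ w, c w * X w t ω - ∑ w, c w * m w) =ᵐ[μ]
        ((∑ w, c w • x w t : Lp ℝ 2 μ) : Ω → ℝ) := by
      have h3 : ∀ w, ((c w • x w t : Lp ℝ 2 μ) : Ω → ℝ) =ᵐ[μ] fun ω => c w * (X w t ω - m w) := by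
        intro w
        filter_upwards [Lp.coeFn_smul (c w) (x w t), hx w t] with ω h4 h5
        rw [h4, Pi.smul_apply, h5, smul_eq_mul]
      filter_upwards [Lp.coeFn_finsetSum Finset.univ fun w => c w • x w t,
        ae_all_iff.2 h3] with ω h4 h5
      rw [h4, Finset.sum_apply, Finset.sum_congr rfl fun w _ => h5 w]
      simp only [mul_sub, Finset.sum_sub_distrib]
    have h3 := measurable_of_ae_eq (fun _ => measurableSet_gsig_of_null) h2 h1
    have h4 := h3 (measurableSet_Iic (a := 1 / 2))
    convert h4 using 1
    ext ω
    simp only [hBdef, hq, Set.mem_preimage, Set.mem_ofPred_eq, Set.mem_Iic]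
    constructor <;> intro h <;> linarith
  rcases hzero B hB hmeas with h0 | h0
  · refine hrect 0 (fun w => Or.inl rfl) (measure_mono_null (fun y hy => ?_) h0)
    have := (abs_lt.1 (hest 0 y hy)).2
    simp only [Pi.zero_apply, add_zero] at this
    change ∑ w, c w * y w ≤ q
    linarith
  · refine hrect (Pi.single v (c v)⁻¹) (fun w => ?_) (measure_mono_null (fun y hy => ?_) h0)
    · rcases eq_or_ne w v with rfl | hw
      · exact Or.inr hxv
      · exact Or.inl (by simp [hw])
    · have := (abs_lt.1 (hest _ y hy)).1
      simp only [mul_add, Finset.sum_add_distrib] at this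
      have h1 : ∑ w, c w * (Pi.single v (c v)⁻¹ : V → ℝ) w = 1 := by
        rw [Finset.sum_eq_single v] <;> simp +contextual [hcv]
      rw [h1] at this
      change ¬ ∑ w, c w * y w ≤ q
      linarith

end ConditionPConsequences

/-! ### Projections in a real Hilbert space -/

section RealHilbert

variable {E V : Type*} [NormedAddCommGroup E] [InnerProductSpace ℝ E] [CompleteSpace E]
  {y : V → ℤ → E} {Q : Set E} {n : ℤ}

lemma inner_sub_starProjection_cspan (T : Set E) (z : E) {w : E} (hw : w ∈ cspan ℝ T) :
    inner ℝ w (z - (cspan ℝ T).starProjection z) = 0 := by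
  rw [real_inner_comm]
  exact Submodule.starProjection_inner_eq_zero z w hw

omit [CompleteSpace E] in
lemma eq_of_inner_sub_eq_zero {T : Set E} {z u w : E} (hu : u ∈ cspan ℝ T)
    (hw : w ∈ cspan ℝ T) (hzu : ∀ v ∈ T, inner ℝ v (z - u) = 0)
    (hzw : ∀ v ∈ T, inner ℝ v (z - w) = 0) : u = w := by
  have h1 : inner ℝ (u - w) (u - w) = 0 := by
    have h2 := inner_eq_zero_of_mem_cspan hzu ((cspan ℝ T).sub_mem hu hw)
    have h3 := inner_eq_zero_of_mem_cspan hzw ((cspan ℝ T).sub_mem hu hw)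
    have h4 : u - w = (z - w) - (z - u) := by abel
    nth_rewrite 2 [h4]
    rw [inner_sub_right, h2, h3, sub_zero]
  exact sub_eq_zero.1 (inner_self_eq_zero.1 h1)

/-- The projection of `y a n`, `a ∈ A`, on `Q` and the values outside `A` involves only `Q` and
the values outside `A ∪ B`. -/
def ProjIndep (y : V → ℤ → E) (Q : Set E) (n : ℤ) (A B : Set V) : Prop :=
  ∀ a ∈ A, ∃ u ∈ cspan ℝ (Q ∪ slice y (A ∪ B)ᶜ n), ∀ z ∈ Q ∪ slice y Aᶜ n,
    inner ℝ z (y a n - u) = 0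

lemma ProjIndep.symm {A B : Set V} (hAB : Disjoint A B) (h : ProjIndep y Q n A B) :
    ProjIndep y Q n B A := by
  intro b hb
  have hsub : ∀ D : Set V, D ⊆ A ∪ B → Q ∪ slice y (A ∪ B)ᶜ n ⊆ Q ∪ slice y Dᶜ n := fun D hD =>
    Set.union_subset_union_right _ (Set.image_mono (Set.compl_subset_compl.2 hD))
  refine ⟨(cspan ℝ (Q ∪ slice y (A ∪ B)ᶜ n)).starProjection (y b n), ?_, ?_⟩
  · rw [Set.union_comm B A]
    exact Submodule.starProjection_apply_mem _ _
  set u := (cspan ℝ (Q ∪ slice y (A ∪ B)ᶜ n)).starProjection (y b n) with hu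
  have hum : u ∈ cspan ℝ (Q ∪ slice y (A ∪ B)ᶜ n) := Submodule.starProjection_apply_mem _ _
  have hperp : ∀ w ∈ cspan ℝ (Q ∪ slice y (A ∪ B)ᶜ n), inner ℝ w (y b n - u) = 0 :=
    fun w hw => inner_sub_starProjection_cspan _ _ hw
  rintro z (hz | ⟨v, hv, rfl⟩)
  · exact hperp z (subset_cspan _ (Or.inl hz))
  by_cases hvA : v ∈ A
  · obtain ⟨w, hw, hwp⟩ := h v hvA
    have h1 : inner ℝ (y b n - u) (y v n - w) = 0 := by
      refine inner_eq_zero_of_mem_cspan hwp (Submodule.sub_mem _ (subset_cspan _ (Or.inr ⟨b, ?_, rfl⟩))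
        (cspan_mono (hsub A Set.subset_union_left) hum))
      exact fun hbA => Set.disjoint_left.1 hAB hbA hb
    have h2 := hperp w hw
    change inner ℝ (y v n) (y b n - u) = 0
    rw [← sub_add_cancel (y v n) w, inner_add_left, h2, real_inner_comm, h1, add_zero]
  · refine hperp _ (subset_cspan _ (Or.inr ⟨v, ?_, rfl⟩))
    rintro (h | h)
    exacts [hvA h, hv h]

omit [CompleteSpace E] in
lemma ProjIndep.singleton_right {a b : V} {B : Set V} (hb : b ∈ B)
    (h : ProjIndep y Q n {a} B) : ProjIndep y Q n {a} {b} := by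
  intro a' ha'
  obtain ⟨u, hu, hz⟩ := h a' ha'
  refine ⟨u, cspan_mono (Set.union_subset_union_right _ (Set.image_mono ?_)) hu, hz⟩
  exact Set.compl_subset_compl.2 (Set.union_subset_union_right _ (Set.singleton_subset_iff.2 hb))

/-- If the components are independent modulo `Q`, pairwise independence of projections implies
independence of projections for sets. -/
theorem projIndep_of_pairwise [Fintype V]
    (hind : ∀ c : V → ℝ, ∑ v, c v • y v n ∈ cspan ℝ Q → ∀ v, c v • y v n = 0) {A B : Set V}
    (hAB : Disjoint A B) (h : ∀ a ∈ A, ∀ b ∈ B, ProjIndep y Q n {a} {b}) :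
    ProjIndep y Q n A B := by
  classical
  have hcoeff : ∀ (D : Set V) (c : V → ℝ) (p : E), p ∈ cspan ℝ Q →
      p + ∑ v, c v • y v n ∈ cspan ℝ (Q ∪ slice y D n) → ∀ v ∉ D, c v • y v n = 0 := by
    intro D c p hp hmem v hv
    obtain ⟨d, hd, q, hq, he⟩ := exists_decomp_of_mem_cspan (subset_refl _) hmem
    have h1 : ∑ w, (c w - d w) • y w n ∈ cspan ℝ Q := by
      have : ∑ w, (c w - d w) • y w n = q - p := by
        simp only [sub_smul, Finset.sum_sub_distrib]
        rw [sub_eq_sub_iff_add_eq_add, add_comm, he]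
      rw [this]
      exact Submodule.sub_mem _ hq hp
    simpa [hd v hv] using hind _ h1 v
  let u : V → E := fun a => (cspan ℝ (Q ∪ slice y {a}ᶜ n)).starProjection (y a n)
  let r : V → ℤ → E := fun a _ => y a n - u a
  have hu : ∀ a, u a ∈ cspan ℝ (Q ∪ slice y {a}ᶜ n) := fun a =>
    Submodule.starProjection_apply_mem _ _
  have hrperp : ∀ a, ∀ w ∈ cspan ℝ (Q ∪ slice y {a}ᶜ n), inner ℝ w (r a n) = 0 := fun a w hw =>
    inner_sub_starProjection_cspan _ _ hw
  have hub : ∀ a ∈ A, ∀ b ∈ B, u a ∈ cspan ℝ (Q ∪ slice y {b}ᶜ n) := by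
    intro a ha b hb
    obtain ⟨w, hw, hwp⟩ := h a ha b hb a rfl
    have hw' : w ∈ cspan ℝ (Q ∪ slice y {a}ᶜ n) := cspan_mono (Set.union_subset_union_right _
      (Set.image_mono (Set.compl_subset_compl.2 Set.subset_union_left))) hw
    have : u a = w := eq_of_inner_sub_eq_zero (hu a) hw'
      (fun v hv => hrperp a v (subset_cspan _ hv)) hwp
    rw [this]
    exact cspan_mono (Set.union_subset_union_right _
      (Set.image_mono (Set.compl_subset_compl.2 Set.subset_union_right))) hw
  have huB : ∀ a ∈ A, u a ∈ cspan ℝ (Q ∪ slice y Bᶜ n) := by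
    intro a ha
    obtain ⟨c, -, p, hp, he⟩ := exists_decomp_of_mem_cspan (subset_refl _) (hu a)
    have h1 : ∀ b ∈ B, c b • y b n = 0 := fun b hb =>
      hcoeff {b}ᶜ c p hp (he ▸ hub a ha b hb) b (by simp)
    rw [he]
    refine Submodule.add_mem _ (cspan_mono Set.subset_union_left hp)
      (Submodule.sum_mem _ fun v _ => ?_)
    by_cases hv : v ∈ B
    · rw [h1 v hv]
      exact Submodule.zero_mem _
    · exact Submodule.smul_mem _ _ (subset_cspan _ (Or.inr ⟨v, hv, rfl⟩))
  have hAB' : ∀ a ∈ A, y a n ∈ cspan ℝ (Q ∪ slice y Bᶜ n) := fun a ha =>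
    subset_cspan _ (Or.inr ⟨a, fun hb => Set.disjoint_left.1 hAB ha hb, rfl⟩)
  intro a ha
  set T : Set E := (Q ∪ slice y (A ∪ B)ᶜ n) ∪ slice r A n with hT
  have hTB : cspan ℝ T ≤ cspan ℝ (Q ∪ slice y Bᶜ n) := by
    refine cspan_le (isClosed_cspan _) (Set.union_subset ?_ ?_)
    · exact (Set.union_subset_union_right _ (Set.image_mono
        (Set.compl_subset_compl.2 Set.subset_union_right))).trans (subset_cspan _)
    · rintro _ ⟨a', ha', rfl⟩
      exact Submodule.sub_mem _ (hAB' a' ha') (huB a' ha')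
  set z : E := y a n - (cspan ℝ T).starProjection (y a n) with hz
  have hzperp : ∀ w ∈ cspan ℝ T, inner ℝ w z = 0 := fun w hw =>
    inner_sub_starProjection_cspan _ _ hw
  have hzmem : z ∈ cspan ℝ (Q ∪ slice y Bᶜ n) :=
    Submodule.sub_mem _ (hAB' a ha) (hTB (Submodule.starProjection_apply_mem _ _))
  obtain ⟨c, hc, p, hp, he⟩ := exists_decomp_of_mem_cspan (subset_refl _) hzmem
  have hcA : ∀ a' ∈ A, c a' • y a' n = 0 := by
    intro a' ha'
    have h1 : inner ℝ z (r a' n) = c a' * inner ℝ (y a' n) (r a' n) := by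
      rw [he, inner_add_left, sum_inner, Finset.sum_eq_single a',
        hrperp a' p (cspan_mono Set.subset_union_left hp), real_inner_smul_left, zero_add]
      · intro w _ hw
        rw [real_inner_smul_left,
          hrperp a' _ (subset_cspan _ (Or.inr ⟨w, hw, rfl⟩)), mul_zero]
      · simp
    have h2 : inner ℝ (y a' n) (r a' n) = inner ℝ (r a' n) (r a' n) := by
      have : y a' n = u a' + r a' n := (add_sub_cancel _ _).symm
      nth_rewrite 1 [this]
      rw [inner_add_left, hrperp a' _ (hu a'), zero_add]
    have h3 : inner ℝ z (r a' n) = 0 := by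
      rw [real_inner_comm]
      exact hzperp _ (subset_cspan _ (Or.inr ⟨a', ha', rfl⟩))
    rw [h3, h2, eq_comm, mul_eq_zero, inner_self_eq_zero] at h1
    rcases h1 with h1 | h1
    · rw [h1, zero_smul]
    · have h4 : y a' n ∈ cspan ℝ (Q ∪ slice y {a'}ᶜ n) := by
        rw [sub_eq_zero.1 h1]
        exact hu a'
      have h5 := hcoeff {a'}ᶜ (Pi.single a' 1) 0 (Submodule.zero_mem _)
        (by simpa [Pi.single_apply, ite_smul] using h4) a' (by simp)
      rw [Pi.single_eq_same, one_smul] at h5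
      rw [h5, smul_zero]
  have hzT : z ∈ cspan ℝ T := by
    rw [he]
    refine Submodule.add_mem _
      (cspan_mono (Set.subset_union_left.trans Set.subset_union_left) hp)
      (Submodule.sum_mem _ fun v _ => ?_)
    by_cases hvA : v ∈ A
    · rw [hcA v hvA]
      exact Submodule.zero_mem _
    by_cases hvB : v ∈ B
    · rw [hc v (not_not.2 hvB), zero_smul]
      exact Submodule.zero_mem _
    · refine Submodule.smul_mem _ _ (subset_cspan _ (Or.inl (Or.inr ⟨v, ?_, rfl⟩)))
      rintro (h | h)
      exacts [hvA h, hvB h]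
  have hz0 : z = 0 := inner_self_eq_zero.1 (hzperp z hzT)
  have hya : y a n ∈ cspan ℝ T := by
    rw [sub_eq_zero.1 hz0]
    exact Submodule.starProjection_apply_mem _ _
  obtain ⟨d, hd, q, hq, he'⟩ := exists_decomp_of_mem_cspan (subset_refl _) hya
  refine ⟨q, hq, fun w hw => ?_⟩
  rw [he', add_sub_cancel_left, inner_sum]
  refine Finset.sum_eq_zero fun a' _ => ?_
  by_cases ha' : a' ∈ A
  · rw [real_inner_smul_right, hrperp a' w, mul_zero]
    refine subset_cspan _ (Set.union_subset_union_right _ (Set.image_mono ?_) hw)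
    exact Set.compl_subset_compl.2 (Set.singleton_subset_iff.2 ha')
  · rw [hd a' ha', zero_smul, inner_zero_right]

/-- The projection of `y b (t + 1)`, `b ∈ B`, on the past does not involve the components in
`A`. -/
def ProjNoncausal (y : V → ℤ → E) (A B : Set V) (t : ℤ) : Prop :=
  ∀ b ∈ B, ∃ u ∈ cspan ℝ (seg y Aᶜ (Set.Iic t)), ∀ z ∈ seg y Set.univ (Set.Iic t),
    inner ℝ z (y b (t + 1) - u) = 0

omit [CompleteSpace E] in
lemma ProjNoncausal.singleton {A B : Set V} {t : ℤ} (h : ProjNoncausal y A B t) {a b : V}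
    (ha : a ∈ A) (hb : b ∈ B) : ProjNoncausal y {a} {b} t := by
  intro b' hb'
  rw [Set.mem_singleton_iff.1 hb']
  obtain ⟨u, hu, hz⟩ := h b hb
  exact ⟨u, cspan_mono (seg_mono (Set.compl_subset_compl.2 (Set.singleton_subset_iff.2 ha))
    le_rfl) hu, hz⟩

theorem projNoncausal_of_pairwise [Finite V] {t : ℤ}
    (hinf : ∀ S₁ S₂ : Set V, cspan ℝ (seg y S₁ (Set.Iic t)) ⊓ cspan ℝ (seg y S₂ (Set.Iic t)) ≤
      cspan ℝ (seg y (S₁ ∩ S₂) (Set.Iic t))) {A B : Set V}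
    (h : ∀ a ∈ A, ∀ b ∈ B, ProjNoncausal y {a} {b} t) : ProjNoncausal y A B t := by
  intro b hb
  refine ⟨(cspan ℝ (seg y Set.univ (Set.Iic t))).starProjection (y b (t + 1)), ?_,
    fun z hz => inner_sub_starProjection_cspan _ _ (subset_cspan _ hz)⟩
  refine Set.Finite.induction_on_subset (motive := fun D _ =>
    (cspan ℝ (seg y Set.univ (Set.Iic t))).starProjection (y b (t + 1)) ∈
      cspan ℝ (seg y Dᶜ (Set.Iic t))) A A.toFinite ?_ ?_
  · rw [Set.compl_empty]
    exact Submodule.starProjection_apply_mem _ _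
  · intro a D ha _ _ ih
    rw [← Set.singleton_union, Set.compl_union]
    refine hinf _ _ ⟨?_, ih⟩
    obtain ⟨u, hu, hz⟩ := h a ha b hb b rfl
    have : (cspan ℝ (seg y Set.univ (Set.Iic t))).starProjection (y b (t + 1)) = u :=
      eq_of_inner_sub_eq_zero (Submodule.starProjection_apply_mem _ _)
        (cspan_mono (seg_mono (Set.subset_univ _) le_rfl) hu)
        (fun z hz => inner_sub_starProjection_cspan _ _ (subset_cspan _ hz)) hz
    rw [this]
    exact hu

end RealHilbert

/-! ### Granger noncausality in Gaussian processes -/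

section GaussianProcess

variable {V : Type*} {m₀ : MeasurableSpace Ω} {μ : Measure Ω} [IsProbabilityMeasure μ]
  {X : V → ℤ → Ω → ℝ} {m : V → ℝ} {x : V → ℤ → Lp ℝ 2 μ}

omit [IsProbabilityMeasure μ] in
lemma seg_subset_cspan_univ (A : Set V) (J : Set ℤ) :
    seg x A J ⊆ cspan ℝ (seg x Set.univ Set.univ) :=
  (seg_mono (Set.subset_univ _) (Set.subset_univ _)).trans (subset_cspan _)

lemma grangerNoncausal_iff (hc : ∀ s, μ s = 0 → MeasurableSet s)
    (hx : ∀ v t, x v t =ᵐ[μ] fun ω => X v t ω - m v)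
    (hG : IsGaussianSubspace (cspan ℝ (seg x Set.univ Set.univ))) {A B : Set V}
    (hAB : Disjoint A B) :
    GrangerNoncausal μ X A B Set.univ ↔ ∀ t, ProjNoncausal x A B t := by
  refine forall_congr' fun t => ?_
  rw [pastSigma_eq_gsig hx, pastSigma_eq_gsig hx, pastSigma_eq_gsig hx,
    hG.condIndepSigma_gsig_iff (isClosed_cspan _) hc (seg_subset_cspan_univ _ _)
      (seg_subset_cspan_univ _ _) (seg_subset_cspan_univ _ _), ← Set.compl_eq_univ_sdiff]
  have hU : seg x A (Set.Iic t) ∪ seg x Aᶜ (Set.Iic t) = seg x Set.univ (Set.Iic t) := by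
    refine Set.Subset.antisymm (Set.union_subset (seg_mono (Set.subset_univ _) le_rfl)
      (seg_mono (Set.subset_univ _) le_rfl)) ?_
    rintro _ ⟨v, -, s, hs, rfl⟩
    by_cases hv : v ∈ A
    exacts [Or.inl (mem_seg hv hs), Or.inr (mem_seg hv hs)]
  rw [hU]
  constructor
  · exact fun h b hb => h _ (mem_seg hb (Set.mem_Iic.2 le_rfl))
  · rintro h _ ⟨b, hb, s, hs, rfl⟩
    rcases (Set.mem_Iic.1 hs).lt_or_eq with hs | rfl
    · refine ⟨x b s, mem_cspan_seg (fun hA => Set.disjoint_left.1 hAB hA hb)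
        (Set.mem_Iic.2 (by omega)), fun z _ => by simp⟩
    · exact h b hb

lemma contempIndep_iff (hc : ∀ s, μ s = 0 → MeasurableSet s)
    (hx : ∀ v t, x v t =ᵐ[μ] fun ω => X v t ω - m v)
    (hG : IsGaussianSubspace (cspan ℝ (seg x Set.univ Set.univ))) {A B : Set V}
    (hAB : Disjoint A B) :
    ContempIndep μ X A B Set.univ ↔
      ∀ t, ProjIndep x (seg x Set.univ (Set.Iic t)) (t + 1) A B := by
  refine forall_congr' fun t => ?_
  rw [pastSigma_eq_gsig hx, pastSigma_eq_gsig hx, pastSigma_eq_gsig hx, pastSigma_eq_gsig hx,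
    ← gsig_union,
    hG.condIndepSigma_gsig_iff (isClosed_cspan _) hc (seg_subset_cspan_univ _ _)
      (seg_subset_cspan_univ _ _)
      (Set.union_subset (seg_subset_cspan_univ _ _) (seg_subset_cspan_univ _ _)),
    ← Set.compl_eq_univ_sdiff]
  have hslice : ∀ C : Set V, seg x Set.univ (Set.Iic t) ∪ seg x C (Set.Iic (t + 1)) =
      seg x Set.univ (Set.Iic t) ∪ slice x C (t + 1) := by
    intro C
    refine Set.Subset.antisymm (Set.union_subset Set.subset_union_left ?_)
      (Set.union_subset_union_right _ ?_)
    · refine (seg_Iic_subset C (t + 1)).trans (Set.union_subset_union_left _ ?_)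
      rw [add_sub_cancel_right]
      exact seg_mono (Set.subset_univ _) le_rfl
    · rintro _ ⟨v, hv, rfl⟩
      exact mem_seg hv (Set.mem_Iic.2 le_rfl)
  have hU : seg x B (Set.Iic (t + 1)) ∪
      (seg x Set.univ (Set.Iic t) ∪ seg x (A ∪ B)ᶜ (Set.Iic (t + 1))) =
      seg x Set.univ (Set.Iic t) ∪ slice x Aᶜ (t + 1) := by
    rw [Set.union_left_comm, ← hslice]
    congr 1
    refine Set.Subset.antisymm (Set.union_subset (seg_mono ?_ le_rfl) (seg_mono ?_ le_rfl)) ?_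
    · exact fun v hB hA => Set.disjoint_left.1 hAB hA hB
    · exact Set.compl_subset_compl.2 Set.subset_union_left
    · rintro _ ⟨v, hv, s, hs, rfl⟩
      by_cases hB : v ∈ B
      · exact Or.inl (mem_seg hB hs)
      · exact Or.inr (mem_seg (fun h => h.elim hv hB) hs)
  rw [hU, hslice]
  constructor
  · exact fun h a ha => h _ (mem_seg ha (Set.mem_Iic.2 le_rfl))
  · rintro h _ ⟨a, ha, s, hs, rfl⟩
    rcases (Set.mem_Iic.1 hs).lt_or_eq with hs | rfl
    · exact ⟨x a s, subset_cspan _ (Or.inl (mem_seg (Set.mem_univ _) (Set.mem_Iic.2 (by omega)))),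
        fun z _ => by simp⟩
    · exact h a ha

end GaussianProcess

/-! ### Markov properties determined by pairwise noncausality -/

section Markov

variable {V : Type*} {m₀ : MeasurableSpace Ω} {μ : Measure Ω} {X : V → ℤ → Ω → ℝ}

/-- If noncausality and contemporaneous independence of sets are determined by pairs of
components, then the three Markov properties are equivalent. -/
theorem markov_equivalence_of_pairwise
    (hN : ∀ A B : Set V, Disjoint A B → (GrangerNoncausal μ X A B Set.univ ↔
      ∀ a ∈ A, ∀ b ∈ B, GrangerNoncausal μ X {a} {b} Set.univ))
    (hsymm : ∀ A B : Set V, Disjoint A B → ContempIndep μ X A B Set.univ →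
      ContempIndep μ X B A Set.univ)
    (hsing : ∀ (a : V) (B : Set V), a ∉ B → ContempIndep μ X {a} B Set.univ → ∀ b ∈ B,
      ContempIndep μ X {a} {b} Set.univ)
    (hC : ∀ A B : Set V, Disjoint A B →
      (∀ a ∈ A, ∀ b ∈ B, ContempIndep μ X {a} {b} Set.univ) → ContempIndep μ X A B Set.univ)
    (G : MixedGraph V) :
    (BlockRecursiveMarkov μ X G Set.univ ↔ LocalMarkov μ X G Set.univ) ∧
    (LocalMarkov μ X G Set.univ ↔ PairwiseMarkov μ X G Set.univ) := by
  have hBL : BlockRecursiveMarkov μ X G Set.univ → LocalMarkov μ X G Set.univ :=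
    fun h a _ => h {a} (Set.subset_univ _)
  have hdisj : ∀ A D : Set V, Disjoint (Set.univ \ (D ∪ A)) A := fun A D =>
    Set.disjoint_left.2 fun v hv hA => hv.2 (Or.inr hA)
  have hLP : LocalMarkov μ X G Set.univ → PairwiseMarkov μ X G Set.univ := by
    intro h a _ b _ hab
    constructor
    · intro hdir
      refine (hN _ _ (hdisj _ _)).1 (h b (Set.mem_univ b)).1 a ⟨Set.mem_univ a, ?_⟩ b rfl
      rintro (⟨⟨b', rfl, hd⟩, -⟩ | rfl)
      exacts [hdir hd, hab rfl]
    · intro hund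
      refine hsing a _ (fun ha => ha.2 (Or.inr rfl)) (hsymm _ _ (hdisj _ _) (h a (Set.mem_univ a)).2)
        b ⟨Set.mem_univ b, ?_⟩
      rintro (⟨⟨a', rfl, hd⟩, -⟩ | rfl)
      exacts [hund (G.undir_symm _ _ hd), hab rfl]
  have hPB : PairwiseMarkov μ X G Set.univ → BlockRecursiveMarkov μ X G Set.univ := by
    intro h A _
    have hne : ∀ D : Set V, ∀ a ∈ Set.univ \ (D ∪ A), ∀ b ∈ A, a ≠ b := by
      rintro D a ha b hb rfl
      exact ha.2 (Or.inr hb)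
    constructor
    · refine (hN _ _ (hdisj _ _)).2 fun a ha b hb =>
        (h a (Set.mem_univ a) b (Set.mem_univ b) (hne _ a ha b hb)).1 fun hd => ha.2 ?_
      exact Or.inl ⟨⟨b, hb, hd⟩, fun hA => ha.2 (Or.inr hA)⟩
    · refine hC _ _ (hdisj _ _) fun a ha b hb =>
        (h a (Set.mem_univ a) b (Set.mem_univ b) (hne _ a ha b hb)).2 fun hd => ha.2 ?_
      exact Or.inl ⟨⟨b, hb, hd⟩, fun hA => ha.2 (Or.inr hA)⟩
  exact ⟨⟨hBL, fun h => hPB (hLP h)⟩, ⟨hLP, fun h => hBL (hPB h)⟩⟩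

lemma condIndepSigma_of_not_le {m₁ m₂ m₃ m₀ : MeasurableSpace Ω} {μ : Measure Ω}
    (h : ¬ m₃ ≤ m₀) : CondIndepSigma μ m₁ m₂ m₃ := by
  intro s _
  rw [condExp_of_not_le h, condExp_of_not_le fun h' => h (le_sup_right.trans h')]

end Markov

/-- Proposition: sufficient condition (i), Gaussian processes.
Under (M) and (P), if `X_V` is a Gaussian process (every finite linear combination of
values of the process has a possibly degenerate Gaussian law), then (BC), (LC) and (PC)
are equivalent. -/
theorem markov_equivalence_of_gaussian
    {V Ω : Type*} [Fintype V] [MeasurableSpace Ω]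
    (μ : Measure Ω) [IsProbabilityMeasure μ]
    (X : V → ℤ → Ω → ℝ) (hXmeas : ∀ v t, Measurable (X v t))
    (hM : ConditionM μ X) (hP : ConditionP μ X)
    (hGauss : ∀ (n : ℕ) (v : Fin n → V) (s : Fin n → ℤ) (c : Fin n → ℝ),
      ∃ (m : ℝ) (σ2 : NNReal),
        Measure.map (fun ω => ∑ i, c i * X (v i) (s i) ω) μ = gaussianReal m σ2)
    (G : MixedGraph V) :
    (BlockRecursiveMarkov μ X G Set.univ ↔ LocalMarkov μ X G Set.univ) ∧
    (LocalMarkov μ X G Set.univ ↔ PairwiseMarkov μ X G Set.univ) := by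
  by_cases hc : ∀ s, μ s = 0 → MeasurableSet s
  · obtain ⟨m, x, hx, hG, hgram⟩ := exists_centered hXmeas hM.1 hGauss
    have hind := fun t => hP.smul_eq_zero_of_sum_mem hXmeas hc hx hG t
    have hinf := fun t => real_past_inf_past_le t hgram (hind t) fun ε hε =>
      hM.2.exists_inner_le hXmeas hx hG t hε
    have hsingle : ∀ {a b : V} {A B : Set V}, Disjoint A B → a ∈ A → b ∈ B →
        Disjoint ({a} : Set V) {b} := fun hAB ha hb =>
      hAB.mono (Set.singleton_subset_iff.2 ha) (Set.singleton_subset_iff.2 hb)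
    refine markov_equivalence_of_pairwise (fun A B hAB => ⟨fun h a ha b hb => ?_, fun h => ?_⟩)
      (fun A B hAB h => ?_) (fun a B haB h b hb => ?_) (fun A B hAB h => ?_) G
    · rw [grangerNoncausal_iff hc hx hG hAB] at h
      rw [grangerNoncausal_iff hc hx hG (hsingle hAB ha hb)]
      exact fun t => (h t).singleton ha hb
    · rw [grangerNoncausal_iff hc hx hG hAB]
      exact fun t => projNoncausal_of_pairwise (hinf t) fun a ha b hb =>
        (grangerNoncausal_iff hc hx hG (hsingle hAB ha hb)).1 (h a ha b hb) t
    · rw [contempIndep_iff hc hx hG hAB] at h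
      rw [contempIndep_iff hc hx hG hAB.symm]
      exact fun t => (h t).symm hAB
    · have hAB : Disjoint {a} B := Set.disjoint_singleton_left.2 haB
      rw [contempIndep_iff hc hx hG hAB] at h
      rw [contempIndep_iff hc hx hG (hsingle hAB rfl hb)]
      exact fun t => (h t).singleton_right hb
    · rw [contempIndep_iff hc hx hG hAB]
      refine fun t => projIndep_of_pairwise (fun c hsum => hind (t + 1) c ?_) hAB fun a ha b hb =>
        (contempIndep_iff hc hx hG (hsingle hAB ha hb)).1 (h a ha b hb) t
      rwa [add_sub_cancel_right]
  · have hnot : ∀ (A : Set V) (t : ℤ), ¬ pastSigma μ X A t ≤ _ := fun A t h =>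
      hc (mComplete_le_iff.1 h).2
    have hN : ∀ A B : Set V, GrangerNoncausal μ X A B Set.univ := fun A B t =>
      condIndepSigma_of_not_le (hnot _ _)
    have hI : ∀ A B : Set V, ContempIndep μ X A B Set.univ := fun A B t =>
      condIndepSigma_of_not_le fun h => hnot _ _ (le_sup_left.trans h)
    exact markov_equivalence_of_pairwise (fun A B _ => by simp [hN]) (fun A B _ _ => hI B A)
      (fun a B _ _ b _ => hI {a} {b}) (fun A B _ _ => hI A B) G

end GraphicalTS
end
end

section
/- Let (Ω,𝔉,P) be a probability space and, for each t∈ℤ, let 𝒜_t, ℬ_t, 𝒮_t be sub-σ-algebras of 𝔉 such that 𝒜_t⊆𝒜_{t+1}, ℬ_t⊆ℬ_{t+1}, and 𝒮_t⊆𝒮_{t+1} for all t. Set 𝒜_∞=⋁_{t∈ℤ}𝒜_t, ℬ_∞=⋁_{t∈ℤ}ℬ_t, 𝒮_∞=⋁_{t∈ℤ}𝒮_t. If 𝒜_t⊥ℬ_t|𝒮_t for every t∈ℤ, then 𝒜_∞⊥ℬ_∞|𝒮_∞. -/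
open MeasureTheory ProbabilityTheory Filter

noncomputable section

namespace GraphicalTS

/-! ### σ-algebras, conditional independence, Granger causality -/

variable {Ω : Type*}

/-- Two conditional expectations that agree on the indicators of a π-system agree on the
indicators of all sets of the σ-algebra it generates. -/
theorem condExp_indicator_ae_eq_of_isPiSystem {Ω : Type*} {m m₁ m₂ m0 : MeasurableSpace Ω}
    {μ : Measure Ω} [IsFiniteMeasure μ] (hm : m ≤ m0) (hm₁ : m₁ ≤ m0) (hm₂ : m₂ ≤ m0)
    {C : Set (Set Ω)} (hC : m = MeasurableSpace.generateFrom C) (hpi : IsPiSystem C)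
    (h : ∀ s ∈ C, μ[s.indicator fun _ => (1 : ℝ) | m₁] =ᵐ[μ]
      μ[s.indicator fun _ => (1 : ℝ) | m₂])
    {s : Set Ω} (hs : MeasurableSet[m] s) :
    μ[s.indicator fun _ => (1 : ℝ) | m₁] =ᵐ[μ] μ[s.indicator fun _ => (1 : ℝ) | m₂] := by
  have hint : ∀ t, MeasurableSet[m] t → Integrable (t.indicator fun _ => (1 : ℝ)) μ :=
    fun t ht => (integrable_const 1).indicator (hm t ht)
  induction s, hs using MeasurableSpace.induction_on_inter hC hpi with
  | empty => simp
  | basic t ht => exact h t ht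
  | compl t ht ih =>
    have hcompl : tᶜ.indicator (fun _ => (1 : ℝ)) =
        (fun _ => (1 : ℝ)) - t.indicator fun _ => (1 : ℝ) := Set.indicator_compl _ _
    rw [hcompl]
    refine (condExp_sub (integrable_const 1) (hint t ht) m₁).trans
      (EventuallyEq.trans ?_ (condExp_sub (integrable_const 1) (hint t ht) m₂).symm)
    rw [condExp_const hm₁, condExp_const hm₂]
    exact EventuallyEq.rfl.sub ih
  | iUnion f hdisj hf ih =>
    have hunion : (⋃ i, f i).indicator (fun _ => (1 : ℝ)) =
        fun x => ∑' i, (f i).indicator (fun _ => (1 : ℝ)) x := by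
      funext x
      by_cases hx : ∃ i, x ∈ f i
      · obtain ⟨i, hi⟩ := hx
        rw [tsum_eq_single i fun j hj => Set.indicator_of_notMem
            (Set.disjoint_left.1 (hdisj hj.symm) hi) _,
          Set.indicator_of_mem hi, Set.indicator_of_mem (Set.mem_iUnion_of_mem i hi)]
      · have hx' : ∀ i, x ∉ f i := not_exists.1 hx
        simp [hx']
    have hsum : ∑' i, ∫⁻ x, ‖(f i).indicator (fun _ => (1 : ℝ)) x‖ₑ ∂μ ≠ ⊤ := by
      simp_rw [enorm_indicator_eq_indicator_enorm, enorm_one]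
      simp_rw [lintegral_indicator_const (hm _ (hf _)), one_mul]
      rw [← measure_iUnion hdisj fun i => hm _ (hf i)]
      exact measure_ne_top _ _
    have hmeas := fun i => (hint _ (hf i)).aestronglyMeasurable
    rw [hunion]
    refine (condExp_tsum hmeas hsum).trans
      (EventuallyEq.trans ?_ (condExp_tsum hmeas hsum).symm)
    filter_upwards [ae_all_iff.2 ih] with x hx
    exact tsum_congr hx

/-- Lévy's upward theorem along an increasing family of σ-algebras indexed by `ℤ`. -/
theorem tendsto_ae_condExp_iSup_int {Ω : Type*} {m0 : MeasurableSpace Ω}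
    {μ : Measure Ω} [IsFiniteMeasure μ] {M : ℤ → MeasurableSpace Ω}
    (hle : ∀ t, M t ≤ m0) (hmono : Monotone M) (g : Ω → ℝ) (t : ℤ) :
    ∀ᵐ x ∂μ, Tendsto (fun n : ℕ => (μ[g | M (t + n)]) x) atTop
      (nhds ((μ[g | ⨆ s, M s]) x)) := by
  let ℱ : Filtration ℕ m0 :=
    { seq := fun n => M (t + n)
      mono' := fun _ _ hij => hmono (by gcongr)
      le' := fun n => hle _ }
  have hsup : ⨆ s, M s = ⨆ n, ℱ n := by
    refine le_antisymm (iSup_le fun s => ?_) (iSup_le fun n => le_iSup M (t + n))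
    exact (hmono (by lia : s ≤ t + ((s - t).toNat : ℤ))).trans (le_iSup ℱ (s - t).toNat)
  rw [hsup]
  exact tendsto_ae_condExp (ℱ := ℱ) g

/-- Conditional independence passes to limit σ-algebras. If
`𝒜_t ⟂ ℬ_t | 𝒮_t` for monotone families of sub-σ-algebras indexed by `t ∈ ℤ`, then
`𝒜_∞ ⟂ ℬ_∞ | 𝒮_∞` for the generated σ-algebras `𝒜_∞ = ⋁_t 𝒜_t` etc. -/
theorem condIndep_iSup_of_monotone
    {Ω : Type*} [m0 : MeasurableSpace Ω]
    (μ : Measure Ω) [IsProbabilityMeasure μ]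
    (𝒜 ℬ 𝒮 : ℤ → MeasurableSpace Ω)
    (h𝒜le : ∀ t, 𝒜 t ≤ m0) (hℬle : ∀ t, ℬ t ≤ m0) (h𝒮le : ∀ t, 𝒮 t ≤ m0)
    (h𝒜mono : ∀ t : ℤ, 𝒜 t ≤ 𝒜 (t + 1))
    (hℬmono : ∀ t : ℤ, ℬ t ≤ ℬ (t + 1))
    (h𝒮mono : ∀ t : ℤ, 𝒮 t ≤ 𝒮 (t + 1))
    (h : ∀ t : ℤ, CondIndepSigma μ (𝒜 t) (ℬ t) (𝒮 t)) :
    CondIndepSigma μ (⨆ t : ℤ, 𝒜 t) (⨆ t : ℤ, ℬ t) (⨆ t : ℤ, 𝒮 t) := by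
  have hAmono : Monotone 𝒜 := monotone_int_of_le_succ h𝒜mono
  have hSmono : Monotone 𝒮 := monotone_int_of_le_succ h𝒮mono
  have hBSmono : Monotone fun t => ℬ t ⊔ 𝒮 t :=
    (monotone_int_of_le_succ hℬmono).sup hSmono
  have hBSle : ∀ t, ℬ t ⊔ 𝒮 t ≤ m0 := fun t => sup_le (hℬle t) (h𝒮le t)
  intro s hs
  rw [← iSup_sup_eq]
  refine condExp_indicator_ae_eq_of_isPiSystem (iSup_le h𝒜le) (iSup_le hBSle) (iSup_le h𝒮le)
    (MeasurableSpace.generateFrom_iUnion_measurableSet 𝒜).symm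
    (isPiSystem_iUnion_of_monotone _ (fun t => (𝒜 t).isPiSystem_measurableSet)
      fun _ _ hij => hAmono hij) (fun G hG => ?_) hs
  obtain ⟨t, ht⟩ := Set.mem_iUnion.1 hG
  have heq : ∀ n : ℕ, μ[G.indicator fun _ => (1 : ℝ) | ℬ (t + n) ⊔ 𝒮 (t + n)] =ᵐ[μ]
      μ[G.indicator fun _ => (1 : ℝ) | 𝒮 (t + n)] :=
    fun n => h (t + n) G (hAmono (by lia : t ≤ t + n) G ht)
  filter_upwards [tendsto_ae_condExp_iSup_int hBSle hBSmono _ t,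
    tendsto_ae_condExp_iSup_int h𝒮le hSmono _ t, ae_all_iff.2 heq] with x hBS hS hx
  exact tendsto_nhds_unique (hBS.congr hx) hS

end GraphicalTS
end
end
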